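/- Fix an integer d ≥ 2, δ ∈ (0,1), and p ∈ (2,∞). Let a^{jk} : ℝ^{d+1} → ℝ (1 ≤ j,k ≤ d) be measurable with a^{jk} = a^{kj} and δ|θ|² ≤ Σ_{j,k=1}^d a^{jk}(t,x) θ^j θ^k ≤ δ⁻¹|θ|² for all (t,x) and θ ∈ ℝ^d, and suppose there is a continuous function ω on [0,∞) with ω(0) = 0 and a_R^# ≤ ω(R) for all R ∈ [0,∞). Set L₀u = u_t + Σ_{j,k} a^{jk} u_{x^j x^k}. Then there exist constants R = R(d,δ,p,ω) > 0 and N = N(d,δ,p) such that for every smooth u with compact support contained in Q_R = (0,R²) × B_R, ‖u_{xx}‖_{L_p(ℝ^{d+1})} ≤ N ‖L₀u‖_{L_p(ℝ^{d+1})}, where ‖u_{xx}‖ is the L_p norm of (Σ_{j,k} |u_{x^j x^k}|²)^{1/2}. -/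

import Mathlib

open MeasureTheory

/-- Partial derivative in `t`. -/
noncomputable def pdt {d : ℕ} (u : ℝ × (Fin d → ℝ) → ℝ) : ℝ × (Fin d → ℝ) → ℝ :=
  fun p => fderiv ℝ u p (1, 0)

/-- Partial derivative in `x^j`. -/
noncomputable def pdx {d : ℕ} (j : Fin d) (u : ℝ × (Fin d → ℝ) → ℝ) :
    ℝ × (Fin d → ℝ) → ℝ :=
  fun p => fderiv ℝ u p (0, Pi.single j 1)

/-- Second partial derivative in `x^j, x^k`. -/
noncomputable def pdxx {d : ℕ} (j k : Fin d) (u : ℝ × (Fin d → ℝ) → ℝ) :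
    ℝ × (Fin d → ℝ) → ℝ :=
  pdx j (pdx k u)

/-- Open Euclidean ball of radius `r` about `x` in `ℝ^d`. -/
def ballC {d : ℕ} (r : ℝ) (x : Fin d → ℝ) : Set (Fin d → ℝ) :=
  {y | ∑ j, (y j - x j) ^ 2 < r ^ 2}

/-- Parabolic cylinder `Q_r(t,x) = (t,t+r²) × B_r(x)`. -/
def Qcyl {d : ℕ} (r : ℝ) (z : ℝ × (Fin d → ℝ)) : Set (ℝ × (Fin d → ℝ)) :=
  Set.Ioo z.1 (z.1 + r ^ 2) ×ˢ ballC r z.2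

/-- `Γ_r(t,x') = (t,t+r²) × B'_r(x') ⊂ ℝ × ℝ^{d-1}` (here `d-1 = n`). -/
def GammaC {n : ℕ} (r : ℝ) (t : ℝ) (x' : Fin n → ℝ) : Set (ℝ × (Fin n → ℝ)) :=
  Set.Ioo t (t + r ^ 2) ×ˢ ballC r x'

/-- `osc_{(t,x')}(a, Λ_r(t,x))`. -/
noncomputable def oscA {n : ℕ}
    (a : ℝ × (Fin (n + 1) → ℝ) → Fin (n + 1) → Fin (n + 1) → ℝ)
    (r : ℝ) (t : ℝ) (x : Fin (n + 1) → ℝ) : ℝ :=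
  (r ^ 5)⁻¹ * (((volume (ballC r (0 : Fin n → ℝ))).toReal) ^ 2)⁻¹ *
    ∫ τ in Set.Ioo (x 0 - r) (x 0 + r),
      ∫ s₁ in GammaC r t (fun j : Fin n => x j.succ),
        ∫ s₂ in GammaC r t (fun j : Fin n => x j.succ),
          ⨆ j, ⨆ k,
            |a (s₁.1, Fin.cons τ s₁.2) j k - a (s₂.1, Fin.cons τ s₂.2) j k|

/-- `a_R^# = sup_{(t,x)} sup_{0 < r ≤ R} osc_{(t,x')}(a, Λ_r(t,x))`. -/
noncomputable def aSharp {n : ℕ}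
    (a : ℝ × (Fin (n + 1) → ℝ) → Fin (n + 1) → Fin (n + 1) → ℝ) (R : ℝ) : ℝ :=
  ⨆ z : ℝ × (Fin (n + 1) → ℝ), ⨆ r : {r : ℝ // 0 < r ∧ r ≤ R},
    oscA a r.val z.1 z.2

/-- `L_p(ℝ^{d+1})` norm (for a real exponent `p`). -/
noncomputable def LpNorm {d : ℕ} (p : ℝ) (f : ℝ × (Fin d → ℝ) → ℝ) : ℝ :=
  (∫ q : ℝ × (Fin d → ℝ), |f q| ^ p) ^ (1 / p)

section
open MeasureTheory Set Filter Topology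
namespace KK

set_option linter.unusedSectionVars false
set_option linter.unusedSimpArgs false
set_option linter.unusedVariables false

/-- directional derivative -/
noncomputable def dd {E : Type*} [NormedAddCommGroup E] [NormedSpace ℝ E] (e : E) (f : E → ℝ) :
    E → ℝ := fun q => fderiv ℝ f q e

/-- smooth with compact support -/
def Sm {E : Type*} [NormedAddCommGroup E] [NormedSpace ℝ E] (f : E → ℝ) : Prop :=
  ContDiff ℝ (⊤ : ℕ∞) f ∧ HasCompactSupport f

section gen
variable {E : Type*} [NormedAddCommGroup E] [NormedSpace ℝ E]

lemma contDiff_dd {f : E → ℝ} (hf : ContDiff ℝ (⊤ : ℕ∞) f) (e : E) :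
    ContDiff ℝ (⊤ : ℕ∞) (dd e f) :=
  (hf.fderiv_right (m := (⊤ : ℕ∞)) (by simp)).clm_apply contDiff_const

lemma Sm.dd {f : E → ℝ} (hf : Sm f) (e : E) : Sm (dd e f) :=
  ⟨contDiff_dd hf.1 e, by
    have := hf.2.fderiv_apply (𝕜 := ℝ) e
    exact this⟩

lemma Sm.mul {f g : E → ℝ} (hf : Sm f) (hg : Sm g) : Sm (fun q => f q * g q) :=
  ⟨hf.1.mul hg.1, hf.2.mul_right⟩

lemma Sm.mul' {f g : E → ℝ} (hf : ContDiff ℝ (⊤ : ℕ∞) f) (hg : Sm g) : Sm (fun q => f q * g q) :=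
  ⟨hf.mul hg.1, hg.2.mul_left⟩

lemma Sm.sub {f g : E → ℝ} (hf : Sm f) (hg : Sm g) : Sm (fun q => f q - g q) :=
  ⟨hf.1.sub hg.1, hf.2.sub hg.2⟩

lemma Sm.const_mul {f : E → ℝ} (c : ℝ) (hf : Sm f) : Sm (fun q => c * f q) :=
  Sm.mul' contDiff_const hf

lemma Sm.cont {f : E → ℝ} (hf : Sm f) : Continuous f := hf.1.continuous

lemma Sm.diff {f : E → ℝ} (hf : Sm f) : Differentiable ℝ f := hf.1.differentiable (by simp)

lemma cdiff {f : E → ℝ} (hf : ContDiff ℝ (⊤ : ℕ∞) f) : Differentiable ℝ f :=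
  hf.differentiable (by simp)

lemma dd_mul {f g : E → ℝ} (hf : Differentiable ℝ f) (hg : Differentiable ℝ g) (e : E) :
    dd e (fun q => f q * g q) = fun q => dd e f q * g q + f q * dd e g q := by
  funext q
  unfold dd
  rw [fderiv_fun_mul (hf q) (hg q)]
  simp
  ring

lemma dd_sub {f g : E → ℝ} (hf : Differentiable ℝ f) (hg : Differentiable ℝ g) (e : E) :
    dd e (fun q => f q - g q) = fun q => dd e f q - dd e g q := by
  funext q
  unfold dd
  rw [fderiv_fun_sub (hf q) (hg q)]
  simp

lemma dd_add {f g : E → ℝ} (hf : Differentiable ℝ f) (hg : Differentiable ℝ g) (e : E) :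
    dd e (fun q => f q + g q) = fun q => dd e f q + dd e g q := by
  funext q
  unfold dd
  rw [fderiv_fun_add (hf q) (hg q)]
  simp

lemma dd_comm {f : E → ℝ} (hf : ContDiff ℝ (⊤ : ℕ∞) f) (e e' : E) :
    dd e (dd e' f) = dd e' (dd e f) := by
  funext q
  have hs : IsSymmSndFDerivAt ℝ f q :=
    hf.contDiffAt.isSymmSndFDerivAt (by simp; exact WithTop.coe_le_coe.2 (le_top : (2:ℕ∞) ≤ ⊤))
  have hd : DifferentiableAt ℝ (fderiv ℝ f) q :=
    ((hf.fderiv_right (m := 1) (by norm_cast)).differentiable (by simp)) q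
  have key : ∀ a b : E, dd a (dd b f) q = fderiv ℝ (fderiv ℝ f) q a b := by
    intro a b
    have : dd b f = fun q => fderiv ℝ f q b := rfl
    unfold dd
    rw [fderiv_clm_apply hd (differentiableAt_const b)]
    simp
  rw [key, key]
  exact hs e e'

lemma dd_line {f : E → ℝ} (hf : Differentiable ℝ f) (e q : E) (s : ℝ) :
    HasDerivAt (fun s : ℝ => f (q + s • e)) (dd e f (q + s • e)) s := by
  have h1 : HasDerivAt (fun s : ℝ => q + s • e) e s := by
    simpa using ((hasDerivAt_id s).smul_const e).const_add q
  exact (hf (q + s • e)).hasFDerivAt.comp_hasDerivAt s h1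

end gen

section intg
variable {E : Type*} [NormedAddCommGroup E] [NormedSpace ℝ E] [FiniteDimensional ℝ E]
  [MeasurableSpace E] [BorelSpace E] {μ : Measure E} [μ.IsAddHaarMeasure]

lemma Sm.integrable {f : E → ℝ} (hf : Sm f) : Integrable f μ :=
  hf.cont.integrable_of_hasCompactSupport hf.2

/-- bounded measurable times smooth compactly supported -/
lemma Sm.integrable_mul {c f : E → ℝ} (hc : Measurable c) {K : ℝ} (hK : ∀ q, |c q| ≤ K)
    (hf : Sm f) : Integrable (fun q => c q * f q) μ :=
  hf.integrable.bdd_mul (c := K) hc.aestronglyMeasurable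
    (Eventually.of_forall fun q => by simpa using hK q)

lemma ibp {c F G : E → ℝ} {e : E} (hc : Measurable c) {K : ℝ} (hK : ∀ q, |c q| ≤ K)
    (hinv : ∀ q (s : ℝ), c (q + s • e) = c q) (hF : Sm F) (hG : Sm G) :
    ∫ q, c q * (dd e F q * G q) ∂μ = - ∫ q, c q * (F q * dd e G q) ∂μ := by
  have h := integral_bilinear_hasLineDerivAt_right_eq_neg_left_of_integrable (μ := μ)
    (f := fun q => c q * G q) (f' := fun q => c q * dd e G q) (g := F) (g' := dd e F) (v := e)
    (B := ContinuousLinearMap.mul ℝ ℝ) ?_ ?_ ?_ ?_ ?_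
  · simp only [ContinuousLinearMap.mul_apply'] at h
    convert h using 1
    · congr 1; funext q; ring
    · congr 2; funext q; ring
  · have := Sm.integrable_mul (μ := μ) hc hK ((hG.dd e).mul hF)
    simpa [mul_assoc] using this
  · have := Sm.integrable_mul (μ := μ) hc hK (hG.mul (hF.dd e))
    simpa [mul_assoc] using this
  · have := Sm.integrable_mul (μ := μ) hc hK (hG.mul hF)
    simpa [mul_assoc] using this
  · intro q _
    unfold HasLineDerivAt
    simp_rw [hinv]
    have := (dd_line hG.diff e q 0).const_mul (c q)
    simpa using this
  · intro q _
    have := (dd_line hF.diff e q 0)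
    unfold HasLineDerivAt
    simpa using this

end intg

/-- Cauchy–Schwarz -/
lemma cs {α : Type*} [MeasurableSpace α] {μ : Measure α} {F G : α → ℝ}
    (h1 : Integrable (fun x => F x ^ 2) μ) (h2 : Integrable (fun x => G x ^ 2) μ)
    (h3 : Integrable (fun x => F x * G x) μ) :
    (∫ x, F x * G x ∂μ) ^ 2 ≤ (∫ x, F x ^ 2 ∂μ) * ∫ x, G x ^ 2 ∂μ := by
  have key : ∀ l : ℝ, 0 ≤ (∫ x, F x ^ 2 ∂μ) * (l * l) + (2 * ∫ x, F x * G x ∂μ) * l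
      + ∫ x, G x ^ 2 ∂μ := by
    intro l
    have : (∫ x, F x ^ 2 ∂μ) * (l * l) + (2 * ∫ x, F x * G x ∂μ) * l + ∫ x, G x ^ 2 ∂μ
        = ∫ x, (l * F x + G x) ^ 2 ∂μ := by
      have e : (fun x => (l * F x + G x) ^ 2)
          = fun x => ((l * l) * F x ^ 2 + (2 * l) * (F x * G x)) + G x ^ 2 := by
        funext x; ring
      have i1 : Integrable (fun x => (l * l) * F x ^ 2 + (2 * l) * (F x * G x)) μ :=
        (h1.const_mul _).add (h3.const_mul _)
      rw [e, integral_add i1 h2,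
        integral_add (h1.const_mul _) (h3.const_mul _), integral_const_mul, integral_const_mul]
      ring
    rw [this]
    exact integral_nonneg fun x => sq_nonneg _
  have := discrim_le_zero key
  unfold discrim at this
  nlinarith

end KK
end

section
open MeasureTheory Set Filter Topology
namespace KK

abbrev X (m : ℕ) := ℝ × (Fin m → ℝ)

instance instHaarX {m : ℕ} : (volume : Measure (X m)).IsAddHaarMeasure :=
  Measure.prod.instIsAddHaarMeasure volume volume

/-- unit time vector -/
def et {m : ℕ} : X m := (1, 0)
/-- unit space vector -/
def ex {m : ℕ} (j : Fin m) : X m := (0, Pi.single j 1)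

/-- elliptic symmetric matrix -/
def EM {m : ℕ} (δ : ℝ) (M : Fin m → Fin m → ℝ) : Prop :=
  (∀ j k, M j k = M k j) ∧ ∀ θ : Fin m → ℝ,
    δ * ∑ j, (θ j) ^ 2 ≤ ∑ j, ∑ k, M j k * θ j * θ k ∧
    ∑ j, ∑ k, M j k * θ j * θ k ≤ δ⁻¹ * ∑ j, (θ j) ^ 2

lemma EM.diag {m : ℕ} {δ : ℝ} {M : Fin m → Fin m → ℝ} (h : EM δ M) (j : Fin m) :
    δ ≤ M j j ∧ M j j ≤ δ⁻¹ := by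
  have := h.2 (Pi.single j 1)
  simpa [Pi.single_apply] using this

lemma EM.bound {m : ℕ} {δ : ℝ} (hδ : 0 < δ) {M : Fin m → Fin m → ℝ} (h : EM δ M) (j k : Fin m) :
    |M j k| ≤ δ⁻¹ := by
  by_cases hjk : j = k
  · subst hjk
    have := h.diag j
    rw [abs_of_nonneg (by linarith)]
    exact this.2
  have hkj : ¬ k = j := fun h => hjk h.symm
  have h1 := (h.2 (fun i => (if i = j then 1 else 0) + (if i = k then 1 else 0))).2
  have h2 := (h.2 (fun i => (if i = j then 1 else 0) - (if i = k then 1 else 0))).2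
  have hj := h.diag j
  have hk := h.diag k
  have e1 : ∑ i : Fin m, ((if i = j then (1:ℝ) else 0) + (if i = k then 1 else 0)) ^ 2 = 2 := by
    have : ∀ i : Fin m, ((if i = j then (1:ℝ) else 0) + (if i = k then 1 else 0)) ^ 2
        = (if i = j then (1:ℝ) else 0) + (if i = k then 1 else 0) := by
      intro i; split_ifs <;> simp_all
    simp_rw [this, Finset.sum_add_distrib]; simp; norm_num
  have e2 : ∑ i : Fin m, ((if i = j then (1:ℝ) else 0) - (if i = k then 1 else 0)) ^ 2 = 2 := by
    have : ∀ i : Fin m, ((if i = j then (1:ℝ) else 0) - (if i = k then 1 else 0)) ^ 2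
        = (if i = j then (1:ℝ) else 0) + (if i = k then 1 else 0) := by
      intro i; split_ifs <;> simp_all
    simp_rw [this, Finset.sum_add_distrib]; simp; norm_num
  rw [e1] at h1
  rw [e2] at h2
  simp [mul_add, add_mul, mul_sub, sub_mul, Finset.sum_add_distrib, Finset.sum_sub_distrib] at h1 h2
  have := h.1 j k
  rw [abs_le]
  constructor <;> linarith

/-- elliptic coefficients depending on one real variable -/
structure Ell (n : ℕ) (δ : ℝ) (A : ℝ → Fin (n + 1) → Fin (n + 1) → ℝ) : Prop where
  meas : ∀ j k, Measurable fun τ => A τ j k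
  em : ∀ τ, EM δ (A τ)

/-- operator with coefficients depending on the first space variable -/
noncomputable def Lb {n : ℕ} (A : ℝ → Fin (n + 1) → Fin (n + 1) → ℝ) (u : X (n + 1) → ℝ) :
    X (n + 1) → ℝ :=
  fun q => dd et u q + ∑ j, ∑ k, A (q.2 0) j k * dd (ex j) (dd (ex k) u) q

noncomputable def H2 {m : ℕ} (u : X m → ℝ) (q : X m) : ℝ :=
  ∑ j, ∑ k, (dd (ex j) (dd (ex k) u) q) ^ 2

noncomputable def en {m : ℕ} (u : X m → ℝ) (q : X m) : ℝ := H2 u q + (dd et u q) ^ 2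

lemma H2_nonneg {m : ℕ} (u : X m → ℝ) (q : X m) : 0 ≤ H2 u q :=
  Finset.sum_nonneg fun _ _ => Finset.sum_nonneg fun _ _ => sq_nonneg _

lemma en_nonneg {m : ℕ} (u : X m → ℝ) (q : X m) : 0 ≤ en u q :=
  add_nonneg (H2_nonneg u q) (sq_nonneg _)

lemma entry_le_H2 {m : ℕ} (u : X m → ℝ) (q : X m) (j k : Fin m) :
    (dd (ex j) (dd (ex k) u) q) ^ 2 ≤ H2 u q := by
  unfold H2
  refine le_trans ?_ (Finset.single_le_sum (f := fun j => ∑ k, (dd (ex j) (dd (ex k) u) q) ^ 2)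
    (fun _ _ => Finset.sum_nonneg fun _ _ => sq_nonneg _) (Finset.mem_univ j))
  exact Finset.single_le_sum (f := fun k => (dd (ex j) (dd (ex k) u) q) ^ 2)
    (fun _ _ => sq_nonneg _) (Finset.mem_univ k)

lemma Sm.sum {E : Type*} [NormedAddCommGroup E] [NormedSpace ℝ E] {ι : Type*} (s : Finset ι)
    {f : ι → E → ℝ} (hf : ∀ i, Sm (f i)) : Sm (fun q => ∑ i ∈ s, f i q) := by
  classical
  induction s using Finset.induction with
  | empty => exact ⟨by simpa using contDiff_const, by
    simp only [Finset.sum_empty]; exact HasCompactSupport.zero⟩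
  | insert a s ha ih =>
    simp only [Finset.sum_insert ha]
    exact ⟨(hf a).1.add ih.1, (hf a).2.add ih.2⟩

lemma Sm.add {E : Type*} [NormedAddCommGroup E] [NormedSpace ℝ E] {f g : E → ℝ} (hf : Sm f)
    (hg : Sm g) : Sm (fun q => f q + g q) := ⟨hf.1.add hg.1, hf.2.add hg.2⟩

lemma Sm.sq {E : Type*} [NormedAddCommGroup E] [NormedSpace ℝ E] {f : E → ℝ} (hf : Sm f) :
    Sm (fun q => f q ^ 2) := by
  simp_rw [pow_two]; exact hf.mul hf

lemma Sm.H2 {m : ℕ} {u : X m → ℝ} (hu : Sm u) : Sm (H2 u) :=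
  Sm.sum _ fun j => Sm.sum _ fun k => ((hu.dd _).dd _).sq

lemma Sm.en {m : ℕ} {u : X m → ℝ} (hu : Sm u) : Sm (en u) := hu.H2.add (hu.dd _).sq

lemma sq_sum2_le {m : ℕ} (x : Fin m → Fin m → ℝ) :
    (∑ j, ∑ k, x j k) ^ 2 ≤ (m : ℝ) ^ 2 * ∑ j, ∑ k, x j k ^ 2 := by
  have h1 := sq_sum_le_card_mul_sum_sq (s := Finset.univ) (f := fun j => ∑ k, x j k)
  have h2 : ∀ j, (∑ k, x j k) ^ 2 ≤ m * ∑ k, x j k ^ 2 := fun j => by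
    simpa using sq_sum_le_card_mul_sum_sq (s := Finset.univ) (f := fun k => x j k)
  simp only [Finset.card_univ, Fintype.card_fin] at h1
  refine h1.trans ?_
  rw [pow_two, mul_assoc, Finset.mul_sum (s := Finset.univ) (a := (m:ℝ))
    (f := fun j => ∑ k, x j k ^ 2)]
  gcongr with j
  exact h2 j

lemma Lb_meas {n : ℕ} {δ : ℝ} {A} (hA : Ell n δ A) {u : X (n + 1) → ℝ} (hu : Sm u) :
    Measurable (Lb A u) := by
  unfold Lb
  refine ((hu.dd _).cont.measurable).add ?_
  refine Finset.measurable_sum _ fun j _ => Finset.measurable_sum _ fun k _ => ?_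
  refine Measurable.mul ?_ ((hu.dd _).dd _).cont.measurable
  exact (hA.meas j k).comp ((measurable_pi_apply 0).comp measurable_snd)

lemma Lb_sq_le {n : ℕ} {δ : ℝ} (hδ : 0 < δ) {A} (hA : Ell n δ A) (u : X (n + 1) → ℝ) (q) :
    (Lb A u q) ^ 2 ≤ (2 + 2 * (n + 1 : ℝ) ^ 2 * δ⁻¹ ^ 2) * en u q := by
  have h := sq_sum2_le (fun j k => A (q.2 0) j k * dd (ex j) (dd (ex k) u) q)
  have h2 : ∑ j, ∑ k, (A (q.2 0) j k * dd (ex j) (dd (ex k) u) q) ^ 2 ≤ δ⁻¹ ^ 2 * H2 u q := by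
    unfold H2
    rw [Finset.mul_sum]
    refine Finset.sum_le_sum fun j _ => ?_
    rw [Finset.mul_sum]
    refine Finset.sum_le_sum fun k _ => ?_
    rw [mul_pow]
    gcongr ?_ * _
    exact sq_le_sq' (by linarith [(abs_le.1 ((hA.em (q.2 0)).bound hδ j k)).1])
      (abs_le.1 ((hA.em (q.2 0)).bound hδ j k)).2
  have h3 : (∑ j, ∑ k, A (q.2 0) j k * dd (ex j) (dd (ex k) u) q) ^ 2
      ≤ (n + 1 : ℝ) ^ 2 * (δ⁻¹ ^ 2 * H2 u q) := by
    refine h.trans ?_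
    push_cast
    gcongr
  unfold Lb en
  have h4 := H2_nonneg u q
  have h5 : 0 ≤ (n + 1 : ℝ) ^ 2 * δ⁻¹ ^ 2 * (dd et u q) ^ 2 := by positivity
  nlinarith [sq_nonneg (dd et u q - ∑ j, ∑ k, A (q.2 0) j k * dd (ex j) (dd (ex k) u) q),
    sq_nonneg (dd et u q)]

lemma Lb_sq_int {n : ℕ} {δ : ℝ} (hδ : 0 < δ) {A} (hA : Ell n δ A) {u : X (n + 1) → ℝ}
    (hu : Sm u) : Integrable (fun q => (Lb A u q) ^ 2) := by
  refine Integrable.mono' (hu.en.integrable.const_mul (2 + 2 * (n + 1 : ℝ) ^ 2 * δ⁻¹ ^ 2))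
    ((Lb_meas hA hu).pow_const 2).aestronglyMeasurable (Eventually.of_forall fun q => ?_)
  rw [Real.norm_of_nonneg (sq_nonneg _)]
  exact Lb_sq_le hδ hA u q

end KK
end

section
open MeasureTheory Set Filter Topology
namespace KK

lemma swapd {m : ℕ} {c F G : X m → ℝ} {e e' : X m} (hc : Measurable c) {K : ℝ}
    (hK : ∀ q, |c q| ≤ K) (h1 : ∀ q (s : ℝ), c (q + s • e) = c q)
    (h2 : ∀ q (s : ℝ), c (q + s • e') = c q) (hF : Sm F) (hG : Sm G) :
    ∫ q, c q * (dd e F q * dd e' G q) = ∫ q, c q * (dd e' F q * dd e G q) := by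
  rw [ibp hc hK h1 hF (hG.dd e'), ibp hc hK h2 hF (hG.dd e), dd_comm hG.1 e e']

lemma dd_self_zero {m : ℕ} {c F : X m → ℝ} {e : X m} (hc : Measurable c) {K : ℝ}
    (hK : ∀ q, |c q| ≤ K) (h1 : ∀ q (s : ℝ), c (q + s • e) = c q) (hF : Sm F) :
    ∫ q, c q * (dd e F q * F q) = 0 := by
  have h := ibp (μ := volume) hc hK h1 hF hF
  have h2 : ∫ q, c q * (F q * dd e F q) = ∫ q, c q * (dd e F q * F q) := by
    congr 1; funext q; ring
  linarith

lemma inv_et {n : ℕ} (c : ℝ → ℝ) (q : X (n + 1)) (s : ℝ) : c ((q + s • et).2 0) = c (q.2 0) := by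
  simp [et]

lemma inv_ex {n : ℕ} (c : ℝ → ℝ) {j : Fin (n + 1)} (hj : j ≠ 0) (q : X (n + 1)) (s : ℝ) :
    c ((q + s • ex j).2 0) = c (q.2 0) := by
  have : (Pi.single j (1:ℝ) : Fin (n + 1) → ℝ) 0 = 0 := Pi.single_eq_of_ne (Ne.symm hj) _
  simp [ex, this]

lemma meas0 {n : ℕ} {c : ℝ → ℝ} (hc : Measurable c) : Measurable fun q : X (n + 1) => c (q.2 0) :=
  hc.comp ((measurable_pi_apply 0).comp measurable_snd)

section
variable {n : ℕ} {δ : ℝ} {A : ℝ → Fin (n + 1) → Fin (n + 1) → ℝ}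

lemma b_bounds (hδ : 0 < δ) (hA : Ell n δ A) (τ : ℝ) :
    δ ≤ (A τ 0 0)⁻¹ ∧ (A τ 0 0)⁻¹ ≤ δ⁻¹ := by
  have h := (hA.em τ).diag 0
  have hp : 0 < A τ 0 0 := lt_of_lt_of_le hδ h.1
  refine ⟨?_, inv_anti₀ hδ h.1⟩
  have := inv_anti₀ hp h.2
  simpa using this

lemma swap_jk (hδ : 0 < δ) (hA : Ell n δ A) {w : X (n + 1) → ℝ} (hw : Sm w) {i : Fin (n + 1)}
    (hi : i ≠ 0) (j k : Fin (n + 1)) :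
    ∫ q : X (n + 1), ((A (q.2 0) 0 0)⁻¹ * A (q.2 0) j k) *
      (dd (ex j) (dd (ex k) w) q * dd (ex i) (dd (ex i) w) q)
    = ∫ q : X (n + 1), ((A (q.2 0) 0 0)⁻¹ * A (q.2 0) j k) *
      (dd (ex k) (dd (ex i) w) q * dd (ex j) (dd (ex i) w) q) := by
  have hm : Measurable fun q : X (n + 1) => (A (q.2 0) 0 0)⁻¹ * A (q.2 0) j k :=
    meas0 ((hA.meas 0 0).inv.mul (hA.meas j k))
  have hb : ∀ q : X (n + 1), |(A (q.2 0) 0 0)⁻¹ * A (q.2 0) j k| ≤ δ⁻¹ * δ⁻¹ := by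
    intro q
    have := b_bounds hδ hA (q.2 0)
    rw [abs_mul]
    gcongr
    · rw [abs_of_nonneg (by linarith)]; exact this.2
    · exact (hA.em _).bound hδ j k
  by_cases hj : j = 0
  · by_cases hk : k = 0
    · subst hj; subst hk
      have : ∀ q : X (n + 1), (A (q.2 0) 0 0)⁻¹ * A (q.2 0) 0 0 = 1 := fun q =>
        inv_mul_cancel₀ (lt_of_lt_of_le hδ ((hA.em (q.2 0)).diag 0).1).ne'
      simp_rw [this]
      have h := swapd (c := fun _ : X (n + 1) => (1:ℝ)) (e := ex 0) (e' := ex i) measurable_const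
        (K := 1) (by simp) (by simp) (by simp) (hw.dd (ex 0)) (hw.dd (ex i))
      rw [h, dd_comm hw.1]
    · have h := swapd (e := ex k) (e' := ex i) hm hb
        (inv_ex (fun τ => (A τ 0 0)⁻¹ * A τ j k) hk)
        (inv_ex (fun τ => (A τ 0 0)⁻¹ * A τ j k) hi) (hw.dd (ex j)) (hw.dd (ex i))
      rw [dd_comm hw.1 (ex j) (ex k), h, dd_comm hw.1 (ex i) (ex j)]
      congr 1; funext q; ring
  · have h := swapd (e := ex j) (e' := ex i) hm hb
      (inv_ex (fun τ => (A τ 0 0)⁻¹ * A τ j k) hj)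
      (inv_ex (fun τ => (A τ 0 0)⁻¹ * A τ j k) hi) (hw.dd (ex k)) (hw.dd (ex i))
    rw [h, dd_comm hw.1 (ex i) (ex k)]

lemma int_bt (hδ : 0 < δ) (hA : Ell n δ A) {w : X (n + 1) → ℝ} (hw : Sm w) {i : Fin (n + 1)}
    (hi : i ≠ 0) :
    ∫ q : X (n + 1), (A (q.2 0) 0 0)⁻¹ * (dd et w q * dd (ex i) (dd (ex i) w) q) = 0 := by
  have hm : Measurable fun q : X (n + 1) => (A (q.2 0) 0 0)⁻¹ := meas0 (hA.meas 0 0).inv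
  have hb : ∀ q : X (n + 1), |(A (q.2 0) 0 0)⁻¹| ≤ δ⁻¹ := by
    intro q
    have := b_bounds hδ hA (q.2 0)
    rw [abs_of_nonneg (by linarith)]; exact this.2
  have h := swapd (e := et) (e' := ex i) hm hb
        (inv_et (fun τ => (A τ 0 0)⁻¹))
        (inv_ex (fun τ => (A τ 0 0)⁻¹) hi) hw (hw.dd (ex i))
  rw [h]
  have := dd_self_zero (e := et) hm hb (inv_et (fun τ => (A τ 0 0)⁻¹)) (hw.dd (ex i))
  rw [← this]
  congr 1; funext q; ring

lemma row_est (hδ : 0 < δ) (hA : Ell n δ A) {w : X (n + 1) → ℝ} (hw : Sm w) {i : Fin (n + 1)}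
    (hi : i ≠ 0) :
    ∫ q, ∑ j, (dd (ex j) (dd (ex i) w) q) ^ 2 ≤ (δ⁻¹) ^ 6 * ∫ q, (Lb A w q) ^ 2 := by
  have hmb : Measurable fun q : X (n + 1) => (A (q.2 0) 0 0)⁻¹ := meas0 (hA.meas 0 0).inv
  have hbb : ∀ q : X (n + 1), |(A (q.2 0) 0 0)⁻¹| ≤ δ⁻¹ := by
    intro q
    have := b_bounds hδ hA (q.2 0)
    rw [abs_of_nonneg (by linarith)]; exact this.2
  have hm : ∀ j k, Measurable fun q : X (n + 1) => (A (q.2 0) 0 0)⁻¹ * A (q.2 0) j k := fun j k =>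
    meas0 ((hA.meas 0 0).inv.mul (hA.meas j k))
  have hb : ∀ j k, ∀ q : X (n + 1), |(A (q.2 0) 0 0)⁻¹ * A (q.2 0) j k| ≤ δ⁻¹ * δ⁻¹ := by
    intro j k q
    rw [abs_mul]
    gcongr
    · exact hbb q
    · exact (hA.em _).bound hδ j k
  have i1 : Integrable fun q : X (n + 1) =>
      (A (q.2 0) 0 0)⁻¹ * (dd et w q * dd (ex i) (dd (ex i) w) q) :=
    Sm.integrable_mul hmb hbb ((hw.dd _).mul ((hw.dd _).dd _))
  have i2 : ∀ j k, Integrable fun q : X (n + 1) => ((A (q.2 0) 0 0)⁻¹ * A (q.2 0) j k) *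
      (dd (ex j) (dd (ex k) w) q * dd (ex i) (dd (ex i) w) q) := fun j k =>
    Sm.integrable_mul (hm j k) (hb j k) (((hw.dd _).dd _).mul ((hw.dd _).dd _))
  have i3 : ∀ j k, Integrable fun q : X (n + 1) => ((A (q.2 0) 0 0)⁻¹ * A (q.2 0) j k) *
      (dd (ex k) (dd (ex i) w) q * dd (ex j) (dd (ex i) w) q) := fun j k =>
    Sm.integrable_mul (hm j k) (hb j k) (((hw.dd _).dd _).mul ((hw.dd _).dd _))
  have e1 : ∫ q : X (n + 1), (A (q.2 0) 0 0)⁻¹ * (Lb A w q * dd (ex i) (dd (ex i) w) q)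
      = ∫ q : X (n + 1), ∑ j, ∑ k, ((A (q.2 0) 0 0)⁻¹ * A (q.2 0) j k) *
      (dd (ex k) (dd (ex i) w) q * dd (ex j) (dd (ex i) w) q) := by
    have : (fun q : X (n + 1) => (A (q.2 0) 0 0)⁻¹ * (Lb A w q * dd (ex i) (dd (ex i) w) q))
      = fun q => (A (q.2 0) 0 0)⁻¹ * (dd et w q * dd (ex i) (dd (ex i) w) q)
        + ∑ j, ∑ k, ((A (q.2 0) 0 0)⁻¹ * A (q.2 0) j k) *
      (dd (ex j) (dd (ex k) w) q * dd (ex i) (dd (ex i) w) q) := by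
      funext q
      unfold Lb
      rw [add_mul, mul_add, Finset.sum_mul, Finset.mul_sum]
      congr 1
      refine Finset.sum_congr rfl fun j _ => ?_
      rw [Finset.sum_mul, Finset.mul_sum]
      refine Finset.sum_congr rfl fun k _ => by ring
    rw [this, integral_add i1 (integrable_finsetSum _ fun j _ => integrable_finsetSum _
      fun k _ => i2 j k), int_bt hδ hA hw hi, zero_add,
      integral_finsetSum _ (fun j _ => integrable_finsetSum _ fun k _ => i2 j k),
      integral_finsetSum _ (fun j _ => integrable_finsetSum _ fun k _ => i3 j k)]
    refine Finset.sum_congr rfl fun j _ => ?_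
    rw [integral_finsetSum _ (fun k _ => i2 j k), integral_finsetSum _ (fun k _ => i3 j k)]
    exact Finset.sum_congr rfl fun k _ => swap_jk hδ hA hw hi j k
  have hsm : Sm (fun q => ∑ j, (dd (ex j) (dd (ex i) w) q) ^ 2) :=
    Sm.sum _ fun j => ((hw.dd _).dd _).sq
  have low : δ ^ 2 * ∫ q, ∑ j, (dd (ex j) (dd (ex i) w) q) ^ 2 ≤
      ∫ q : X (n + 1), ∑ j, ∑ k, ((A (q.2 0) 0 0)⁻¹ * A (q.2 0) j k) *
      (dd (ex k) (dd (ex i) w) q * dd (ex j) (dd (ex i) w) q) := by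
    rw [← integral_const_mul]
    refine integral_mono (hsm.integrable.const_mul _)
      (integrable_finsetSum _ fun j _ => integrable_finsetSum _ fun k _ => i3 j k) fun q => ?_
    have h1 := ((hA.em (q.2 0)).2 (fun j => dd (ex j) (dd (ex i) w) q)).1
    have h2 := (b_bounds hδ hA (q.2 0)).1
    have h3 : ∑ j, ∑ k, ((A (q.2 0) 0 0)⁻¹ * A (q.2 0) j k) *
      (dd (ex k) (dd (ex i) w) q * dd (ex j) (dd (ex i) w) q) = (A (q.2 0) 0 0)⁻¹ *
      ∑ j, ∑ k, A (q.2 0) j k * dd (ex j) (dd (ex i) w) q * dd (ex k) (dd (ex i) w) q := by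
      rw [Finset.mul_sum]
      refine Finset.sum_congr rfl fun j _ => ?_
      rw [Finset.mul_sum]
      exact Finset.sum_congr rfl fun k _ => by ring
    show _ ≤ ∑ j, ∑ k, ((A (q.2 0) 0 0)⁻¹ * A (q.2 0) j k) *
      (dd (ex k) (dd (ex i) w) q * dd (ex j) (dd (ex i) w) q)
    rw [h3]
    have h4 : 0 ≤ ∑ j, (dd (ex j) (dd (ex i) w) q) ^ 2 := Finset.sum_nonneg fun _ _ => sq_nonneg _
    calc δ ^ 2 * ∑ j, (dd (ex j) (dd (ex i) w) q) ^ 2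
        = δ * (δ * ∑ j, (dd (ex j) (dd (ex i) w) q) ^ 2) := by ring
      _ ≤ _ := mul_le_mul h2 h1 (by positivity) (hδ.le.trans h2)
  have hi4 := Lb_sq_int hδ hA hw
  have up : ∫ q : X (n + 1), (A (q.2 0) 0 0)⁻¹ * (Lb A w q * dd (ex i) (dd (ex i) w) q) ≤
      ∫ q, (δ ^ 2 / 2 * ∑ j, (dd (ex j) (dd (ex i) w) q) ^ 2 +
        (δ⁻¹) ^ 4 / 2 * (Lb A w q) ^ 2) := by
    have hmm : Measurable fun q : X (n + 1) => (A (q.2 0) 0 0)⁻¹ * Lb A w q :=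
      hmb.mul (Lb_meas hA hw)
    have ineq : ∀ q : X (n + 1), |(A (q.2 0) 0 0)⁻¹ * (Lb A w q * dd (ex i) (dd (ex i) w) q)| ≤
        δ ^ 2 / 2 * ∑ j, (dd (ex j) (dd (ex i) w) q) ^ 2 + (δ⁻¹) ^ 4 / 2 * (Lb A w q) ^ 2 := by
      intro q
      have h1 : (dd (ex i) (dd (ex i) w) q) ^ 2 ≤ ∑ j, (dd (ex j) (dd (ex i) w) q) ^ 2 :=
        Finset.single_le_sum (f := fun j => (dd (ex j) (dd (ex i) w) q) ^ 2)
          (fun _ _ => sq_nonneg _) (Finset.mem_univ i)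
      have h2 := hbb q
      rw [abs_mul, abs_mul]
      set g := Lb A w q
      set th := dd (ex i) (dd (ex i) w) q
      calc |(A (q.2 0) 0 0)⁻¹| * (|g| * |th|) ≤ δ⁻¹ * (|g| * |th|) := by gcongr
        _ = (δ⁻¹ ^ 2 * |g|) * (δ * |th|) := by field_simp
        _ ≤ δ ^ 2 / 2 * th ^ 2 + δ⁻¹ ^ 4 / 2 * g ^ 2 := by
          rw [← sq_abs th, ← sq_abs g]
          nlinarith [sq_nonneg (δ⁻¹ ^ 2 * |g| - δ * |th|)]
        _ ≤ _ := by gcongr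
    have hir := (hsm.integrable (μ := volume)).const_mul (δ ^ 2 / 2) |>.add (hi4.const_mul ((δ⁻¹) ^ 4 / 2))
    refine integral_mono (hir.mono' ?_ (Eventually.of_forall ineq)) hir
      fun q => (le_abs_self _).trans (ineq q)
    exact (hmb.mul ((Lb_meas hA hw).mul ((hw.dd _).dd _).cont.measurable)).aestronglyMeasurable
  rw [integral_add (hsm.integrable.const_mul _) (hi4.const_mul _), integral_const_mul,
    integral_const_mul] at up
  have h5 : δ ^ 2 * ∫ q, ∑ j, (dd (ex j) (dd (ex i) w) q) ^ 2 ≤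
     (δ⁻¹) ^ 4 * ∫ q, (Lb A w q) ^ 2 := by linarith
  calc ∫ q, ∑ j, (dd (ex j) (dd (ex i) w) q) ^ 2
      = (δ⁻¹) ^ 2 * (δ ^ 2 * ∫ q, ∑ j, (dd (ex j) (dd (ex i) w) q) ^ 2) := by
        field_simp
    _ ≤ (δ⁻¹) ^ 2 * ((δ⁻¹) ^ 4 * ∫ q, (Lb A w q) ^ 2) := by gcongr
    _ = _ := by ring

lemma global_L2 (n : ℕ) {δ : ℝ} (hδ : 0 < δ) : ∃ C : ℝ, 0 < C ∧ ∀ A, Ell n δ A →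
    ∀ w : X (n + 1) → ℝ, Sm w → ∫ q, en w q ≤ C * ∫ q, (Lb A w q) ^ 2 := by
  set m : ℝ := n + 1
  set D : ℝ := δ⁻¹
  have hD : 0 < D := inv_pos.2 hδ
  have hm : 0 < m := by positivity
  refine ⟨(2 * m * D ^ 6 + D ^ 2 * (2 * D ^ 2 + 2 * m ^ 2 * D ^ 4 * (2 * m * D ^ 6)) * (1 + 2 * D ^ 2)
    + 2 * (2 * D ^ 2 + 2 * m ^ 2 * D ^ 4 * (2 * m * D ^ 6))), by positivity, ?_⟩
  intro A hA w hw
  set T : ℝ := ∫ q, (Lb A w q) ^ 2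
  set H' : X (n + 1) → ℝ := fun q => ∑ i : Fin n, ((∑ j, (dd (ex j) (dd (ex i.succ) w) q) ^ 2)
    + (dd (ex 0) (dd (ex i.succ) w) q) ^ 2) with hH'
  have smH' : Sm H' := Sm.sum _ fun i => (Sm.sum _ fun j => ((hw.dd _).dd _).sq).add
    ((hw.dd _).dd _).sq
  have hT : 0 ≤ T := integral_nonneg fun q => sq_nonneg _
  have h1 : ∫ q, H' q ≤ 2 * m * D ^ 6 * T := by
    rw [hH', integral_finsetSum _ (fun i _ => ((Sm.sum _ fun j => ((hw.dd _).dd _).sq).add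
      ((hw.dd _).dd _).sq).integrable)]
    have : ∀ i : Fin n, ∫ q, ((∑ j, (dd (ex j) (dd (ex i.succ) w) q) ^ 2)
        + (dd (ex 0) (dd (ex i.succ) w) q) ^ 2) ≤ 2 * (D ^ 6 * T) := by
      intro i
      have hr := row_est hδ hA hw (Fin.succ_ne_zero i)
      have hs : Sm (fun q => ∑ j, (dd (ex j) (dd (ex i.succ) w) q) ^ 2) :=
        Sm.sum _ fun j => ((hw.dd _).dd _).sq
      have : ∫ q, ((∑ j, (dd (ex j) (dd (ex i.succ) w) q) ^ 2)
        + (dd (ex 0) (dd (ex i.succ) w) q) ^ 2) ≤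
          ∫ q, 2 * ∑ j, (dd (ex j) (dd (ex i.succ) w) q) ^ 2 := by
        refine integral_mono (hs.add ((hw.dd _).dd _).sq).integrable (hs.const_mul 2).integrable
          fun q => ?_
        have := Finset.single_le_sum (f := fun j => (dd (ex j) (dd (ex i.succ) w) q) ^ 2)
          (fun _ _ => sq_nonneg _) (Finset.mem_univ 0)
        simp only at this ⊢
        linarith
      rw [integral_const_mul] at this
      linarith
    refine (Finset.sum_le_sum fun i _ => this i).trans ?_
    simp only [Finset.sum_const, Finset.card_univ, Fintype.card_fin, nsmul_eq_mul]
    have : (n : ℝ) ≤ m := by simp [m]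
    calc (n : ℝ) * (2 * (D ^ 6 * T)) ≤ m * (2 * (D ^ 6 * T)) := by gcongr
      _ = _ := by ring
  have hH2 : ∀ q, H2 w q = (dd (ex 0) (dd (ex 0) w) q) ^ 2 + H' q := by
    intro q
    unfold H2
    rw [hH']
    simp only [Finset.sum_add_distrib]
    rw [Finset.sum_comm, Fin.sum_univ_succ, Fin.sum_univ_succ]
    have : ∀ i : Fin n, dd (ex i.succ) (dd (ex 0) w) q = dd (ex 0) (dd (ex i.succ) w) q :=
      fun i => by rw [dd_comm hw.1]
    simp_rw [this]
    ring
  -- S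
  set S : X (n + 1) → ℝ := fun q => (A (q.2 0) 0 0)⁻¹ * dd et w q + dd (ex 0) (dd (ex 0) w) q
    with hS
  have hSle : ∀ q, S q ^ 2 ≤ 2 * D ^ 2 * (Lb A w q) ^ 2 + 2 * m ^ 2 * D ^ 4 * H' q := by
    intro q
    have hb := b_bounds hδ hA (q.2 0)
    have hpos : 0 < A (q.2 0) 0 0 := lt_of_lt_of_le hδ ((hA.em _).diag 0).1
    set y : Fin (n + 1) → Fin (n + 1) → ℝ := fun j k => if j = 0 ∧ k = 0 then 0 else
      A (q.2 0) j k * dd (ex j) (dd (ex k) w) q with hy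
    have e1 : ∑ j, ∑ k, A (q.2 0) j k * dd (ex j) (dd (ex k) w) q
        = A (q.2 0) 0 0 * dd (ex 0) (dd (ex 0) w) q + ∑ j, ∑ k, y j k := by
      have : ∀ j k, A (q.2 0) j k * dd (ex j) (dd (ex k) w) q = (if j = 0 ∧ k = 0 then
        A (q.2 0) 0 0 * dd (ex 0) (dd (ex 0) w) q else 0) + y j k := by
        intro j k
        simp only [hy]
        split_ifs with h
        · rw [h.1, h.2]; ring
        · ring
      refine (Finset.sum_congr rfl fun j _ => Finset.sum_congr rfl fun k _ => this j k).trans ?_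
      simp_rw [Finset.sum_add_distrib]
      congr 1
      simp [ite_and]
    have e2 : S q = (A (q.2 0) 0 0)⁻¹ * (Lb A w q - ∑ j, ∑ k, y j k) := by
      simp only [hS]
      unfold Lb
      rw [e1]
      field_simp
      ring
    have e3 : (∑ j, ∑ k, y j k) ^ 2 ≤ m ^ 2 * (D ^ 2 * H' q) := by
      refine (sq_sum2_le y).trans ?_
      push_cast
      gcongr
      have : ∀ j k, y j k ^ 2 ≤ D ^ 2 * (if j = 0 ∧ k = 0 then 0 else
        (dd (ex j) (dd (ex k) w) q) ^ 2) := by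
        intro j k
        simp only [hy]
        split_ifs with h
        · simp
        · rw [mul_pow]
          gcongr ?_ * _
          exact sq_le_sq' (by linarith [(abs_le.1 ((hA.em (q.2 0)).bound hδ j k)).1])
            (abs_le.1 ((hA.em (q.2 0)).bound hδ j k)).2
      refine (Finset.sum_le_sum fun j _ => Finset.sum_le_sum fun k _ => this j k).trans ?_
      simp_rw [← Finset.mul_sum]
      gcongr
      have h2 := hH2 q
      unfold H2 at h2
      have : ∀ j k : Fin (n + 1), (dd (ex j) (dd (ex k) w) q) ^ 2 = (if j = 0 ∧ k = 0 then
        (dd (ex 0) (dd (ex 0) w) q) ^ 2 else 0) + (if j = 0 ∧ k = 0 then 0 else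
        (dd (ex j) (dd (ex k) w) q) ^ 2) := by
        intro j k
        split_ifs with h
        · rw [h.1, h.2]; ring
        · ring
      rw [Finset.sum_congr rfl fun j _ => Finset.sum_congr rfl fun k _ => this j k] at h2
      simp_rw [Finset.sum_add_distrib] at h2
      have hz : ∑ j : Fin (n + 1), ∑ k : Fin (n + 1), (if j = 0 ∧ k = 0 then
        (dd (ex 0) (dd (ex 0) w) q) ^ 2 else 0) = (dd (ex 0) (dd (ex 0) w) q) ^ 2 := by
        simp [ite_and]
      rw [hz] at h2
      exact (add_left_cancel h2).le
    rw [e2, mul_pow]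
    have hb2 : ((A (q.2 0) 0 0)⁻¹) ^ 2 ≤ D ^ 2 := by
      have := hδ.le.trans hb.1
      gcongr
      exact hb.2
    calc ((A (q.2 0) 0 0)⁻¹) ^ 2 * (Lb A w q - ∑ j, ∑ k, y j k) ^ 2
        ≤ D ^ 2 * (2 * (Lb A w q) ^ 2 + 2 * (m ^ 2 * (D ^ 2 * H' q))) := by
          gcongr
          nlinarith [sq_nonneg (Lb A w q + ∑ j, ∑ k, y j k)]
      _ = _ := by ring
  have hmb : Measurable fun q : X (n + 1) => (A (q.2 0) 0 0)⁻¹ := meas0 (hA.meas 0 0).inv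
  have mS : Measurable S := (hmb.mul (hw.dd _).cont.measurable).add
    ((hw.dd _).dd _).cont.measurable
  have hi4 := Lb_sq_int hδ hA hw
  have ibd := (hi4.const_mul (2 * D ^ 2)).add
    ((smH'.integrable (μ := volume)).const_mul (2 * m ^ 2 * D ^ 4))
  have iS : Integrable fun q => S q ^ 2 := by
    refine ibd.mono' (mS.pow_const 2).aestronglyMeasurable (Eventually.of_forall fun q => ?_)
    rw [Real.norm_of_nonneg (sq_nonneg _)]
    exact hSle q
  have hSint : ∫ q, S q ^ 2 ≤ (2 * D ^ 2 + 2 * m ^ 2 * D ^ 4 * (2 * m * D ^ 6)) * T := by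
    have := integral_mono iS ibd hSle
    rw [integral_add' (hi4.const_mul (2 * D ^ 2)) ((smH'.integrable (μ := volume)).const_mul
      (2 * m ^ 2 * D ^ 4)), integral_const_mul, integral_const_mul] at this
    refine this.trans ?_
    have : 2 * m ^ 2 * D ^ 4 * ∫ q, H' q ≤ 2 * m ^ 2 * D ^ 4 * (2 * m * D ^ 6 * T) := by gcongr
    simp only [T] at this ⊢
    linarith
  have z : ∫ q, dd (ex 0) (dd (ex 0) w) q * dd et w q = 0 := by
    have h := swapd (c := fun _ : X (n + 1) => (1:ℝ)) (e := ex 0) (e' := et) measurable_const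
      (K := 1) (by simp) (by simp) (by simp) (hw.dd (ex 0)) hw
    have h2 := dd_self_zero (c := fun _ : X (n + 1) => (1:ℝ)) (e := et) measurable_const
      (K := 1) (by simp) (by simp) (hw.dd (ex 0))
    simp only [one_mul] at h h2
    rw [h, h2]
  have hwt : ∫ q, (dd et w q) ^ 2 ≤ D ^ 2 * ∫ q, S q ^ 2 := by
    have hp : ∀ q, δ * (dd et w q) ^ 2 / 2 + dd (ex 0) (dd (ex 0) w) q * dd et w q ≤
        D / 2 * S q ^ 2 := by
      intro q
      have hb := b_bounds hδ hA (q.2 0)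
      have e : dd (ex 0) (dd (ex 0) w) q * dd et w q
         = S q * dd et w q - (A (q.2 0) 0 0)⁻¹ * (dd et w q) ^ 2 := by simp only [hS]; ring
      have h3 : δ * (dd et w q) ^ 2 ≤ (A (q.2 0) 0 0)⁻¹ * (dd et w q) ^ 2 := by
        gcongr; exact hb.1
      have h4 : S q * dd et w q ≤ D / 2 * S q ^ 2 + δ / 2 * (dd et w q) ^ 2 := by
        have h5 : D * δ = 1 := inv_mul_cancel₀ hδ.ne'
        have h6 : D / 2 * S q ^ 2 + δ / 2 * (dd et w q) ^ 2 - S q * dd et w q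
          = D / 2 * (S q - δ * dd et w q) ^ 2 := by
          linear_combination (-S q * dd et w q + δ / 2 * (dd et w q) ^ 2) * -h5
        have : 0 ≤ D / 2 * (S q - δ * dd et w q) ^ 2 := by positivity
        linarith
      linarith
    have i1 : Integrable fun q => δ * (dd et w q) ^ 2 / 2 := by
      have := ((hw.dd et).sq.integrable (μ := volume)).const_mul δ |>.div_const 2
      exact this
    have i2 : Integrable fun q => dd (ex 0) (dd (ex 0) w) q * dd et w q :=
      (((hw.dd _).dd _).mul (hw.dd _)).integrable
    have := integral_mono (i1.add i2) (iS.const_mul (D / 2)) hp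
    rw [integral_add' i1 i2, z, integral_const_mul, integral_div, integral_const_mul] at this
    have h5 : D * δ = 1 := inv_mul_cancel₀ hδ.ne'
    calc ∫ q, (dd et w q) ^ 2 = 2 * D * (δ * (∫ q, (dd et w q) ^ 2) / 2) := by
          linear_combination (-∫ q, (dd et w q) ^ 2) * h5
      _ ≤ 2 * D * (D / 2 * ∫ q, S q ^ 2) := by gcongr; linarith
      _ = _ := by ring
  have hen : ∀ q, en w q ≤ H' q + (1 + 2 * D ^ 2) * (dd et w q) ^ 2 + 2 * S q ^ 2 := by
    intro q
    unfold en
    rw [hH2 q]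
    have hb := b_bounds hδ hA (q.2 0)
    have e : dd (ex 0) (dd (ex 0) w) q = S q - (A (q.2 0) 0 0)⁻¹ * dd et w q := by
      simp only [hS]; ring
    have hb2 : ((A (q.2 0) 0 0)⁻¹) ^ 2 ≤ D ^ 2 := by
      have := hδ.le.trans hb.1
      gcongr
      exact hb.2
    have h7 : ((A (q.2 0) 0 0)⁻¹ * dd et w q) ^ 2 ≤ D ^ 2 * (dd et w q) ^ 2 := by
      rw [mul_pow]; gcongr
    rw [e]
    nlinarith [sq_nonneg (S q + (A (q.2 0) 0 0)⁻¹ * dd et w q)]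
  have i5 : Integrable fun q => H' q + (1 + 2 * D ^ 2) * (dd et w q) ^ 2 :=
    smH'.integrable.add ((hw.dd et).sq.integrable.const_mul _)
  have i6 : Integrable fun q => H' q + (1 + 2 * D ^ 2) * (dd et w q) ^ 2 + 2 * S q ^ 2 :=
    i5.add (iS.const_mul 2)
  have := integral_mono hw.en.integrable i6 hen
  rw [integral_add i5 (iS.const_mul 2),
    integral_add smH'.integrable ((hw.dd et).sq.integrable.const_mul _), integral_const_mul,
    integral_const_mul] at this
  refine this.trans ?_
  set G := 2 * D ^ 2 + 2 * m ^ 2 * D ^ 4 * (2 * m * D ^ 6)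
  have h8 : (1 + 2 * D ^ 2) * ∫ q, (dd et w q) ^ 2 ≤ (1 + 2 * D ^ 2) * (D ^ 2 * (G * T)) := by
    gcongr
    exact hwt.trans (by gcongr)
  calc _ ≤ 2 * m * D ^ 6 * T + (1 + 2 * D ^ 2) * (D ^ 2 * (G * T)) + 2 * (G * T) := by linarith
    _ = _ := by ring
end
end KK
end

section
open MeasureTheory Set Filter Topology
namespace KK

lemma dd_congr {E : Type*} [NormedAddCommGroup E] [NormedSpace ℝ E] {s : Set E} (hs : IsOpen s)
    {f g : E → ℝ} (h : EqOn f g s) (e : E) : EqOn (dd e f) (dd e g) s := by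
  intro q hq
  have : f =ᶠ[𝓝 q] g := Filter.eventuallyEq_of_mem (hs.mem_nhds hq) h
  unfold dd
  rw [this.fderiv_eq]

lemma Sm.bdd {E : Type*} [NormedAddCommGroup E] [NormedSpace ℝ E] {f : E → ℝ} (hf : Sm f) :
    ∃ K, ∀ q, |f q| ≤ K := by
  obtain ⟨K, hK⟩ := hf.2.exists_bound_of_continuous hf.cont
  exact ⟨K, fun q => by simpa using hK q⟩

lemma Sm.bdd_fin {E : Type*} [NormedAddCommGroup E] [NormedSpace ℝ E] {ι : Type*} [Fintype ι]
    {f : ι → E → ℝ} (hf : ∀ i, Sm (f i)) : ∃ K, 0 < K ∧ ∀ i q, |f i q| ≤ K := by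
  choose K hK using fun i => (hf i).bdd
  refine ⟨1 + ∑ i, |K i|, by positivity, fun i q => (hK i q).trans ?_⟩
  have := Finset.single_le_sum (f := fun i => |K i|) (fun _ _ => abs_nonneg _) (Finset.mem_univ i)
  linarith [le_abs_self (K i)]

lemma sq3_le (a b c : ℝ) : (a + b + c) ^ 2 ≤ 3 * a ^ 2 + 3 * b ^ 2 + 3 * c ^ 2 := by
  nlinarith [sq_nonneg (a - b), sq_nonneg (b - c), sq_nonneg (a - c)]

lemma dd2_mul {E : Type*} [NormedAddCommGroup E] [NormedSpace ℝ E] {f g : E → ℝ}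
    (hf : ContDiff ℝ (⊤ : ℕ∞) f) (hg : ContDiff ℝ (⊤ : ℕ∞) g) (e e' : E) (q : E) :
    dd e (dd e' (fun q => f q * g q)) q = f q * dd e (dd e' g) q +
      (dd e f q * dd e' g q + dd e' f q * dd e g q) + dd e (dd e' f) q * g q := by
  rw [dd_mul (cdiff hf) (cdiff hg), dd_add (f := fun q => dd e' f q * g q) (g := fun q => f q * dd e' g q) ((cdiff (contDiff_dd hf _)).mul (cdiff hg))
    ((cdiff hf).mul (cdiff (contDiff_dd hg _))), dd_mul (cdiff (contDiff_dd hf _)) (cdiff hg),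
    dd_mul (cdiff hf) (cdiff (contDiff_dd hg _))]
  ring

lemma Lb_mul {n : ℕ} (A) {f g : X (n + 1) → ℝ} (hf : Sm f) (hg : Sm g) (q) :
    Lb A (fun q => f q * g q) q = f q * Lb A g q + g q * Lb A f q +
      ∑ j, ∑ k, A (q.2 0) j k * (dd (ex j) f q * dd (ex k) g q + dd (ex k) f q * dd (ex j) g q) := by
  unfold Lb
  simp_rw [dd2_mul hf.1 hg.1, dd_mul hf.diff hg.diff]
  simp only [mul_add, Finset.sum_add_distrib, Finset.mul_sum]
  have e1 : ∀ j k, A (q.2 0) j k * (f q * dd (ex j) (dd (ex k) g) q) =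
    f q * (A (q.2 0) j k * dd (ex j) (dd (ex k) g) q) := fun j k => by ring
  have e2 : ∀ j k, A (q.2 0) j k * (dd (ex j) (dd (ex k) f) q * g q) =
    g q * (A (q.2 0) j k * dd (ex j) (dd (ex k) f) q) := fun j k => by ring
  simp_rw [e1, e2]
  ring

lemma Lb_abs_le {n : ℕ} {δ : ℝ} (hδ : 0 < δ) {A} (hA : Ell n δ A) (u : X (n + 1) → ℝ) (q) {K : ℝ}
    (h1 : |dd et u q| ≤ K) (h2 : ∀ j k, |dd (ex j) (dd (ex k) u) q| ≤ K) :
    |Lb A u q| ≤ (1 + (n + 1) * ((n + 1) * δ⁻¹)) * K := by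
  unfold Lb
  refine (abs_add_le _ _).trans ?_
  have : |∑ j, ∑ k, A (q.2 0) j k * dd (ex j) (dd (ex k) u) q| ≤
      ∑ j : Fin (n + 1), ∑ k : Fin (n + 1), δ⁻¹ * K := by
    refine (Finset.abs_sum_le_sum_abs _ _).trans (Finset.sum_le_sum fun j _ => ?_)
    refine (Finset.abs_sum_le_sum_abs _ _).trans (Finset.sum_le_sum fun k _ => ?_)
    rw [abs_mul]
    have := (hA.em (q.2 0)).bound hδ j k
    have := h2 j k
    gcongr
  simp at this
  linarith

lemma ball_sub {m : ℕ} {f : X m → ℝ} {s : Set (X m)} (h : ∀ q, q ∉ s → f q = 0) :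
    ∫ q in s, f q = ∫ q, f q := setIntegral_eq_integral_of_forall_compl_eq_zero h

lemma cacc {n : ℕ} {ψ v : X (n + 1) → ℝ} (hψ : Sm ψ) (hv : Sm v) (k : Fin (n + 1)) :
    ∫ q, ψ q * (dd (ex k) v q) ^ 2 = - (∫ q, v q * dd (ex k) (dd (ex k) (fun q => ψ q * v q)) q)
      + 1 / 2 * ∫ q, dd (ex k) (dd (ex k) ψ) q * v q ^ 2 := by
  have I : ∀ {F G : X (n + 1) → ℝ}, Sm F → Sm G → ∫ q, dd (ex k) F q * G q =
    - ∫ q, F q * dd (ex k) G q := by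
    intro F G hF hG
    have := ibp (μ := (volume : Measure (X (n + 1)))) (c := fun _ => (1:ℝ)) (e := ex k) measurable_const (K := 1)
      (by simp) (by simp) hF hG
    simpa using this
  have h1 := I hv ((hψ.mul hv).dd (ex k))
  have h2 := I (hψ.dd (ex k)) (hv.mul hv)
  rw [dd_mul hv.diff hv.diff] at h2
  have e1 : ∫ q, dd (ex k) v q * dd (ex k) (fun q => ψ q * v q) q =
      ∫ q, (ψ q * (dd (ex k) v q) ^ 2 + 1 / 2 * (dd (ex k) ψ q * (dd (ex k) v q * v q + v q * dd (ex k) v q))) := by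
    rw [dd_mul hψ.diff hv.diff]
    congr 1; funext q; ring
  have i1 : Integrable fun q => ψ q * (dd (ex k) v q) ^ 2 := (hψ.mul (hv.dd _).sq).integrable
  have i2 : Integrable fun q => dd (ex k) ψ q * (dd (ex k) v q * v q + v q * dd (ex k) v q) :=
    ((hψ.dd _).mul (((hv.dd _).mul hv).add (hv.mul (hv.dd _)))).integrable
  rw [integral_add i1 (i2.const_mul _), integral_const_mul] at e1
  have e2 : ∫ q, dd (ex k) (dd (ex k) ψ) q * v q ^ 2 = ∫ q, dd (ex k) (dd (ex k) ψ) q * (v q * v q) := by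
    congr 1; funext q; ring
  rw [e2]
  linarith

set_option maxHeartbeats 2000000 in
lemma interior (n : ℕ) {δ : ℝ} (hδ : 0 < δ) {ρ : ℝ} (hρ : 0 < ρ) : ∃ C : ℝ, 0 < C ∧ ∀ A, Ell n δ A →
    ∀ v : X (n + 1) → ℝ, Sm v → ∫ q in Metric.ball 0 ρ, en v q ≤
      C * ((∫ q in Metric.ball 0 (ρ + 1), (Lb A v q) ^ 2) + ∫ q in Metric.ball 0 (ρ + 1), v q ^ 2) := by
  obtain ⟨C0, hC0, H0⟩ := global_L2 n hδ
  let χb : ContDiffBump (0 : X (n + 1)) := ⟨ρ, ρ + 1, hρ, by linarith⟩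
  set χ : X (n + 1) → ℝ := fun q => χb q with hχ
  have sχ : Sm χ := ⟨χb.contDiff, χb.hasCompactSupport⟩
  have χ1 : ∀ q ∈ Metric.ball (0 : X (n + 1)) ρ, χ q = 1 := fun q hq =>
    χb.one_of_mem_closedBall (Metric.ball_subset_closedBall hq)
  have χ0 : ∀ q, q ∉ Metric.ball (0 : X (n + 1)) (ρ + 1) → χ q = 0 := by
    intro q hq
    apply χb.zero_of_le_dist
    simpa using hq
  have χn : ∀ q, 0 ≤ χ q := fun q => χb.nonneg
  have χl : ∀ q, χ q ≤ 1 := fun q => χb.le_one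
  set ψ : X (n + 1) → ℝ := fun q => χ q * χ q with hψ
  have sψ : Sm ψ := sχ.mul sχ
  obtain ⟨K1, hK1, b1⟩ := Sm.bdd_fin (fun j : Fin (n + 1) => sχ.dd (ex j))
  obtain ⟨K2, hK2, b2⟩ := Sm.bdd_fin (fun j : Fin (n + 1) × Fin (n + 1) => (sψ.dd (ex j.2)).dd (ex j.1))
  obtain ⟨K4, hK4, b4⟩ := Sm.bdd_fin (fun j : Fin 1 => sψ.dd et)
  set m : ℝ := n + 1 with hm
  have hmp : 0 < m := by positivity
  set D : ℝ := δ⁻¹ with hD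
  have hDp : 0 < D := inv_pos.2 hδ
  set K := (1 + m * (m * D)) * (K2 + K4) with hK
  have hKp : 0 < K := by positivity
  set K3 := 3 * (16 * m ^ 3 * D ^ 2 * K1 ^ 2) with hK3
  have hK3p : 0 < K3 := by positivity
  set η := 1 / (2 * C0 * K3) with hη
  have hηp : 0 < η := by positivity
  set Cη := m * (1 / (4 * η) + K2 / 2) with hCη
  have hCηp : 0 < Cη := by positivity
  refine ⟨2 * C0 * (3 + (3 * K ^ 2 + K3 * Cη)), by positivity, ?_⟩
  intro A hA v hv
  set B := Metric.ball (0 : X (n + 1)) (ρ + 1) with hB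
  set F := ∫ q in B, (Lb A v q) ^ 2
  set V := ∫ q in B, v q ^ 2
  have hF0 : 0 ≤ F := integral_nonneg fun q => sq_nonneg _
  have hV0 : 0 ≤ V := integral_nonneg fun q => sq_nonneg _
  set W : X (n + 1) → ℝ := fun q => ψ q * v q with hW
  have sW : Sm W := sψ.mul hv
  have ψj : ∀ j q, dd (ex j) ψ q = 2 * χ q * dd (ex j) χ q := by
    intro j q
    rw [hψ, dd_mul sχ.diff sχ.diff]; ring
  have out : ∀ q, q ∉ B → ∀ j, dd (ex j) ψ q = 0 := fun q hq j => by
    rw [ψj, χ0 q hq]; ring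
  set S := ∑ k, ∫ q, ψ q * (dd (ex k) v q) ^ 2 with hS
  -- pointwise bound
  have pt : ∀ q, (Lb A W q) ^ 2 ≤ 3 * (Lb A v q) ^ 2 + 3 * K ^ 2 * v q ^ 2 +
      K3 * ∑ k, ψ q * (dd (ex k) v q) ^ 2 := by
    intro q
    have hL := Lb_mul A sψ hv q
    have hLψ : |Lb A ψ q| ≤ K := by
      refine Lb_abs_le hδ hA ψ q ((b4 0 q).trans (by linarith)) fun j k => (b2 (j, k) q).trans (by linarith)
    have hc : (∑ j, ∑ k, A (q.2 0) j k * (dd (ex j) ψ q * dd (ex k) v q + dd (ex k) ψ q * dd (ex j) v q)) ^ 2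
        ≤ (16 * m ^ 3 * D ^ 2 * K1 ^ 2) * ∑ k, ψ q * (dd (ex k) v q) ^ 2 := by
      refine (sq_sum2_le _).trans ?_
      have : ∀ j k, (A (q.2 0) j k * (dd (ex j) ψ q * dd (ex k) v q + dd (ex k) ψ q * dd (ex j) v q)) ^ 2
          ≤ 8 * D ^ 2 * K1 ^ 2 * (ψ q * (dd (ex k) v q) ^ 2 + ψ q * (dd (ex j) v q) ^ 2) := by
        intro j k
        rw [ψj, ψj, mul_pow]
        have hAb : (A (q.2 0) j k) ^ 2 ≤ D ^ 2 := by
          have h := (hA.em (q.2 0)).bound hδ j k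
          rw [← sq_abs]; gcongr
        have hj : (dd (ex j) χ q) ^ 2 ≤ K1 ^ 2 := by rw [← sq_abs]; gcongr; exact b1 j q
        have hk : (dd (ex k) χ q) ^ 2 ≤ K1 ^ 2 := by rw [← sq_abs]; gcongr; exact b1 k q
        calc _ ≤ D ^ 2 * (8 * (χ q) ^ 2 * ((dd (ex j) χ q) ^ 2 * (dd (ex k) v q) ^ 2 +
              (dd (ex k) χ q) ^ 2 * (dd (ex j) v q) ^ 2)) := by
              gcongr
              exact add_sq_le.trans (le_of_eq (by ring))
          _ ≤ D ^ 2 * (8 * (χ q) ^ 2 * (K1 ^ 2 * (dd (ex k) v q) ^ 2 +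
              K1 ^ 2 * (dd (ex j) v q) ^ 2)) := by gcongr
          _ = _ := by simp only [hψ]; ring
      calc _ ≤ ((n + 1 : ℕ) : ℝ) ^ 2 * ∑ j, ∑ k, 8 * D ^ 2 * K1 ^ 2 * (ψ q * (dd (ex k) v q) ^ 2 + ψ q * (dd (ex j) v q) ^ 2) := by
            gcongr with j _ k _
            exact this j k
        _ = _ := by
          simp only [← Finset.mul_sum, Finset.sum_add_distrib, Finset.sum_const, Finset.card_univ, Fintype.card_fin, nsmul_eq_mul]
          push_cast
          simp only [hm]
          ring
    rw [hL]
    have h1 : (ψ q * Lb A v q) ^ 2 ≤ (Lb A v q) ^ 2 := by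
      rw [mul_pow]
      have h0 : 0 ≤ ψ q := mul_nonneg (χn q) (χn q)
      have : ψ q ≤ 1 := mul_le_one₀ (χl q) (χn q) (χl q)
      have : ψ q ^ 2 ≤ 1 := pow_le_one₀ h0 this
      exact mul_le_of_le_one_left (sq_nonneg _) this
    have h2 : (v q * Lb A ψ q) ^ 2 ≤ K ^ 2 * v q ^ 2 := by
      rw [mul_pow, mul_comm]
      gcongr ?_ * _
      rw [← sq_abs]; gcongr
    refine (sq3_le _ _ _).trans ?_
    rw [hK3]
    linarith
  have iL : Integrable (fun q => (Lb A v q) ^ 2) := Lb_sq_int hδ hA hv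
  have iv : Integrable (fun q => v q ^ 2) := hv.sq.integrable
  have sS : Sm (fun q => ∑ k, ψ q * (dd (ex k) v q) ^ 2) := Sm.sum _ fun k => sψ.mul (hv.dd _).sq
  have hout : ∀ q, q ∉ B → (Lb A W q) ^ 2 = 0 := by
    intro q hq
    have hψ0 : ψ q = 0 := by simp [hψ, χ0 q hq]
    rw [Lb_mul A sψ hv q, hψ0]
    have : Lb A ψ q = 0 := by
      have h1 := Lb_mul A sχ sχ q
      have hz : ∀ e, dd e χ q = 0 := by
        intro e
        have : IsLocalMin χ q := Eventually.of_forall fun z => by rw [χ0 q hq]; exact χn z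
        unfold dd
        rw [this.fderiv_eq_zero]; simp
      rw [h1, χ0 q hq]
      simp [hz]
    rw [this]
    simp [out q hq]
  have LW : ∫ q, (Lb A W q) ^ 2 ≤ 3 * F + 3 * K ^ 2 * V + K3 * S := by
    rw [← ball_sub hout]
    have i1 : IntegrableOn (fun q => 3 * (Lb A v q) ^ 2 + 3 * K ^ 2 * v q ^ 2) B :=
      ((iL.const_mul 3).add (iv.const_mul (3 * K ^ 2))).integrableOn
    have i2 : IntegrableOn (fun q => K3 * ∑ k, ψ q * (dd (ex k) v q) ^ 2) B :=
      (sS.integrable.const_mul K3).integrableOn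
    have := integral_mono (Lb_sq_int hδ hA sW).integrableOn (i1.add i2) pt
    refine this.trans ?_
    rw [integral_add' i1 i2, integral_add (iL.const_mul 3).integrableOn
      (iv.const_mul (3 * K ^ 2)).integrableOn, integral_const_mul, integral_const_mul,
      integral_const_mul, ball_sub (f := fun q => ∑ k, ψ q * (dd (ex k) v q) ^ 2) (s := B) (fun q hq => by simp [hψ, χ0 q hq]),
      integral_finsetSum _ fun k _ => (sψ.mul (hv.dd _).sq).integrable]
  have Sb : S ≤ η * (∫ q, en W q) + Cη * V := by
    have each : ∀ k, ∫ q, ψ q * (dd (ex k) v q) ^ 2 ≤ η * (∫ q, (dd (ex k) (dd (ex k) W) q) ^ 2) +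
        (1 / (4 * η) + K2 / 2) * V := by
      intro k
      have hkk : ∀ q, q ∉ B → dd (ex k) (dd (ex k) W) q = 0 ∧ dd (ex k) (dd (ex k) ψ) q = 0 := by
        intro q hq
        have hz : ∀ e, dd e χ q = 0 := by
          intro e
          have : IsLocalMin χ q := Eventually.of_forall fun z => by rw [χ0 q hq]; exact χn z
          unfold dd
          rw [this.fderiv_eq_zero]; simp
        have h2 : dd (ex k) (dd (ex k) ψ) q = 0 := by
          rw [hψ, dd2_mul sχ.1 sχ.1, χ0 q hq]; simp [hz]
        refine ⟨?_, h2⟩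
        rw [hW, dd2_mul sψ.1 hv.1, h2, out q hq]
        simp [hψ, χ0 q hq]
      rw [cacc sψ hv k, ← ball_sub (s := B) (f := fun q => v q * dd (ex k) (dd (ex k) (fun q => ψ q * v q)) q)
        (fun q hq => by simp only [hW] at hkk; simp [(hkk q hq).1]),
        ← ball_sub (s := B) (f := fun q => dd (ex k) (dd (ex k) ψ) q * v q ^ 2)
        (fun q hq => by simp [(hkk q hq).2]),
        ← ball_sub (s := B) (f := fun q => (dd (ex k) (dd (ex k) W) q) ^ 2)
        (fun q hq => by simp [(hkk q hq).1]), ← integral_neg, ← integral_const_mul, ← integral_const_mul,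
        ← integral_const_mul, ← integral_add, ← integral_add]
      · refine integral_mono ?_ ?_ fun q => ?_
        · exact ((hv.mul ((sW.dd _).dd _)).integrable.neg.add ((((sψ.dd _).dd _).mul hv.sq).integrable.const_mul _)).integrableOn
        · exact ((((sW.dd _).dd _).sq.integrable.const_mul _).add (iv.const_mul _)).integrableOn
        · show -(v q * dd (ex k) (dd (ex k) W) q) + 1 / 2 * (dd (ex k) (dd (ex k) ψ) q * v q ^ 2) ≤
            η * (dd (ex k) (dd (ex k) W) q) ^ 2 + (1 / (4 * η) + K2 / 2) * v q ^ 2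
          have h1 : dd (ex k) (dd (ex k) ψ) q * v q ^ 2 ≤ K2 * v q ^ 2 := by
            gcongr
            exact (le_abs_self _).trans (b2 (k, k) q)
          have h2 : -(v q * dd (ex k) (dd (ex k) W) q) ≤ η * (dd (ex k) (dd (ex k) W) q) ^ 2 + 1 / (4 * η) * v q ^ 2 := by
            have : η * (dd (ex k) (dd (ex k) W) q) ^ 2 + 1 / (4 * η) * v q ^ 2 + v q * dd (ex k) (dd (ex k) W) q
              = η * (dd (ex k) (dd (ex k) W) q + v q / (2 * η)) ^ 2 := by
              field_simp; ring
            have h3 : 0 ≤ η * (dd (ex k) (dd (ex k) W) q + v q / (2 * η)) ^ 2 := by positivity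
            linarith
          linarith
      · exact (((sW.dd _).dd _).sq.integrable.const_mul _).integrableOn
      · exact (iv.const_mul _).integrableOn
      · exact (hv.mul ((sW.dd _).dd _)).integrable.neg.integrableOn
      · exact ((((sψ.dd _).dd _).mul hv.sq).integrable.const_mul _).integrableOn
    refine (Finset.sum_le_sum fun k _ => each k).trans ?_
    rw [Finset.sum_add_distrib, ← Finset.mul_sum, ← integral_finsetSum _ fun k _ => ((sW.dd _).dd _).sq.integrable (μ := volume)]
    simp only [Finset.sum_const, Finset.card_univ, Fintype.card_fin, nsmul_eq_mul]
    refine add_le_add ?_ (le_of_eq ?_)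
    · refine mul_le_mul_of_nonneg_left (integral_mono
        (Sm.sum _ fun k => ((sW.dd _).dd _).sq).integrable sW.en.integrable fun q => ?_) hηp.le
      unfold en H2
      have : ∑ k, (dd (ex k) (dd (ex k) W) q) ^ 2 ≤ ∑ j, ∑ k, (dd (ex j) (dd (ex k) W) q) ^ 2 :=
        Finset.sum_le_sum fun k _ => Finset.single_le_sum (f := fun l => (dd (ex k) (dd (ex l) W) q) ^ 2)
          (fun _ _ => sq_nonneg _) (Finset.mem_univ k)
      exact this.trans (le_add_of_nonneg_right (sq_nonneg _))
    · push_cast; simp only [hCη, hm]; ring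
  have hE := H0 A hA W sW
  have loc : ∫ q in Metric.ball 0 ρ, en v q ≤ ∫ q, en W q := by
    have : ∫ q in Metric.ball 0 ρ, en v q = ∫ q in Metric.ball 0 ρ, en W q := by
      refine setIntegral_congr_fun measurableSet_ball ?_
      have hvW : EqOn v W (Metric.ball 0 ρ) := fun q hq => by simp [hW, hψ, χ1 q hq]
      intro q hq
      have h1 : ∀ j k, dd (ex j) (dd (ex k) v) q = dd (ex j) (dd (ex k) W) q := fun j k =>
        dd_congr Metric.isOpen_ball (dd_congr Metric.isOpen_ball hvW _) _ hq
      have h2 := dd_congr Metric.isOpen_ball hvW et hq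
      unfold en H2
      simp only [h1, h2]
    rw [this]
    exact setIntegral_le_integral sW.en.integrable (Eventually.of_forall fun q => en_nonneg _ _)
  refine loc.trans ?_
  have h1 : ∫ q, en W q ≤ C0 * (3 * F + 3 * K ^ 2 * V + K3 * (η * (∫ q, en W q) + Cη * V)) := by
    refine hE.trans ?_
    gcongr
    exact LW.trans (by gcongr)
  have h2 : C0 * (K3 * η) = 1 / 2 := by rw [hη]; field_simp
  have h3 : C0 * (3 * F + 3 * K ^ 2 * V + K3 * (η * (∫ q, en W q) + Cη * V)) =
     C0 * (3 * F + (3 * K ^ 2 + K3 * Cη) * V) + 1 / 2 * ∫ q, en W q := by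
    rw [← h2]; ring
  rw [h3] at h1
  have h4 : C0 * (3 * F + (3 * K ^ 2 + K3 * Cη) * V) ≤ C0 * ((3 + (3 * K ^ 2 + K3 * Cη)) * (F + V)) := by
    gcongr
    have e : (3 + (3 * K ^ 2 + K3 * Cη)) * (F + V) = 3 * F + (3 * K ^ 2 + K3 * Cη) * V +
      ((3 * K ^ 2 + K3 * Cη) * F + 3 * V) := by ring
    rw [e]
    exact le_add_of_nonneg_right (by positivity)
  linarith

end KK
end

section
open MeasureTheory Set Filter Topology
namespace KK

/-- inclusion of the (t,x') space -/
noncomputable def io (n : ℕ) : X n →L[ℝ] X (n + 1) :=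
  LinearMap.toContinuousLinearMap
    { toFun := fun y => (y.1, Fin.cons 0 y.2)
      map_add' := by
        intro x y
        ext j
        · simp
        · refine Fin.cases ?_ (fun i => ?_) j <;> simp
      map_smul' := by
        intro c y
        ext j
        · simp
        · refine Fin.cases ?_ (fun i => ?_) j <;> simp }

lemma io_apply {n : ℕ} (y : X n) : io n y = (y.1, Fin.cons 0 y.2) := rfl

@[simp] lemma io_zero {n : ℕ} (y : X n) : (io n y).2 0 = 0 := by simp [io_apply]

lemma io_norm {n : ℕ} (y : X n) : ‖io n y‖ = ‖y‖ := by
  rw [io_apply, Prod.norm_def, Prod.norm_def]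
  congr 1
  apply le_antisymm
  · rw [pi_norm_le_iff_of_nonneg (norm_nonneg _)]
    intro j
    refine Fin.cases ?_ (fun i => ?_) j
    · simp
    · simpa using norm_le_pi_norm y.2 i
  · rw [pi_norm_le_iff_of_nonneg (norm_nonneg _)]
    intro j
    have := norm_le_pi_norm (Fin.cons 0 y.2 : Fin (n + 1) → ℝ) j.succ
    simpa using this

lemma io_et {n : ℕ} : io n et = et := by
  simp only [io_apply, et]
  ext j
  · simp
  · refine Fin.cases ?_ (fun i => ?_) j <;> simp

lemma io_ex {n : ℕ} (i : Fin n) : io n (ex i) = ex i.succ := by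
  simp only [io_apply, ex]
  ext j
  · simp
  · refine Fin.cases ?_ (fun l => ?_) j
    · simp
    · simp [Pi.single_apply]

/-- partial convolution -/
noncomputable def cv {n : ℕ} (k : X n → ℝ) (f : X (n + 1) → ℝ) : X (n + 1) → ℝ :=
  fun q => ∫ y, k y * f (q - io n y)

/-- projection -/
noncomputable def pr (n : ℕ) : X (n + 1) → X n := fun q => (q.1, fun j => q.2 j.succ)

lemma pr_io {n : ℕ} (y : X n) : pr n (io n y) = y := by simp [pr, io_apply]

lemma pr_cont {n : ℕ} : Continuous (pr n) := by unfold pr; fun_prop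

lemma cv_eq {n : ℕ} {k : X n → ℝ} {f : X (n + 1) → ℝ} (hk : Continuous k) (hf : Continuous f) :
    cv k f = convolution (fun q => k (pr n q)) f (ContinuousLinearMap.mul ℝ ℝ)
      (Measure.map (io n) volume) := by
  funext q
  unfold convolution cv
  rw [integral_map (io n).continuous.aemeasurable]
  · simp [pr_io]
  · have : Continuous fun t => (ContinuousLinearMap.mul ℝ ℝ) (k (pr n t)) (f (q - t)) := by
      have := (pr_cont (n := n))
      simp only [ContinuousLinearMap.mul_apply']
      fun_prop
    exact this.aestronglyMeasurable

lemma k_loc {n : ℕ} {k : X n → ℝ} (hk : Sm k) :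
    LocallyIntegrable (fun q => k (pr n q)) (Measure.map (io n) volume) := by
  refine Integrable.locallyIntegrable ?_
  refine (integrable_map_measure (g := fun q => k (pr n q)) ((hk.cont.comp pr_cont).aestronglyMeasurable)
    (io n).continuous.aemeasurable).2 ?_
  have : (fun q => k (pr n q)) ∘ (io n) = k := by funext y; simp [pr_io]
  rw [this]
  exact hk.integrable

lemma cv_sm {n : ℕ} {k : X n → ℝ} {u : X (n + 1) → ℝ} (hk : Sm k) (hu : Sm u) : Sm (cv k u) := by
  refine ⟨?_, ?_⟩
  · rw [cv_eq hk.cont hu.cont]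
    exact hu.2.contDiff_convolution_right _ (k_loc hk) hu.1
  · refine HasCompactSupport.intro
      (K := (fun p : X n × X (n + 1) => io n p.1 + p.2) '' (tsupport k ×ˢ tsupport u)) ?_ ?_
    · exact (hk.2.prod hu.2).image (by fun_prop)
    · intro q hq
      unfold cv
      refine integral_eq_zero_of_ae (Eventually.of_forall fun y => ?_)
      by_contra h
      have h1 : k y ≠ 0 := fun h0 => h (by simp [h0])
      have h2 : u (q - io n y) ≠ 0 := fun h0 => h (by simp [h0])
      exact hq ⟨(y, q - io n y), ⟨subset_tsupport _ h1, subset_tsupport _ h2⟩, by simp⟩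

lemma slice_sm {n : ℕ} {u : X (n + 1) → ℝ} (hu : Sm u) (q) : Sm (fun y : X n => u (q - io n y)) := by
  refine ⟨hu.1.comp (by fun_prop), ?_⟩
  refine HasCompactSupport.intro (K := (fun p => pr n (q - p)) '' tsupport u) ?_ ?_
  · exact hu.2.image (pr_cont.comp (by fun_prop))
  · intro y hy
    by_contra h
    exact hy ⟨q - io n y, subset_tsupport _ h, by simp [pr_io]⟩

lemma dd_cv {n : ℕ} {k : X n → ℝ} {u : X (n + 1) → ℝ} (hk : Sm k) (hu : Sm u) (e) :
    dd e (cv k u) = cv k (dd e u) := by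
  funext q
  obtain ⟨K, hK⟩ := (hu.dd e).bdd
  have h := hasDerivAt_integral_of_dominated_loc_of_deriv_le (μ := (volume : Measure (X n)))
    (F := fun (s : ℝ) y => k y * u (q - io n y + s • e)) (x₀ := 0)
    (F' := fun s y => k y * dd e u (q - io n y + s • e)) (s := univ) (bound := fun y => |k y| * K)
    univ_mem (Eventually.of_forall fun s => ?_) ?_ ?_ ?_ ?_ ?_
  · have h1 := dd_line (cv_sm hk hu).diff e q 0
    have h2 : (fun s : ℝ => ∫ y, k y * u (q - io n y + s • e)) = fun s => cv k u (q + s • e) := by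
      funext s
      unfold cv
      congr 1
      funext y
      congr 2
      abel
    rw [h2] at h
    have := h1.unique h.2
    simpa [cv] using this
  · exact Continuous.aestronglyMeasurable (by have := hk.cont; have := hu.cont; fun_prop)
  · simpa using (hk.mul (slice_sm hu q)).integrable (μ := volume)
  · exact Continuous.aestronglyMeasurable (by have := hk.cont; have := (hu.dd e).cont; fun_prop)
  · refine Eventually.of_forall fun y s _ => ?_
    rw [norm_mul, Real.norm_eq_abs, Real.norm_eq_abs]
    gcongr
    exact hK _
  · exact (hk.integrable (μ := volume)).abs.mul_const _
  · refine Eventually.of_forall fun y s _ => ?_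
    exact (dd_line hu.diff e (q - io n y) s).const_mul _

lemma cv_dd {n : ℕ} {k : X n → ℝ} {u : X (n + 1) → ℝ} (hk : Sm k) (hu : Sm u) (e) :
    dd (io n e) (cv k u) = cv (dd e k) u := by
  rw [dd_cv hk hu]
  funext q
  have h := ibp (μ := (volume : Measure (X n))) (c := fun _ => (1:ℝ)) (e := e) measurable_const
    (K := 1) (by simp) (by simp) hk (slice_sm hu q)
  simp only [one_mul] at h
  unfold cv
  rw [h, ← integral_neg]
  congr 1
  funext y
  have : dd e (fun y : X n => u (q - io n y)) y = - dd (io n e) u (q - io n y) := by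
    unfold dd
    have h1 : HasFDerivAt (fun y : X n => q - io n y) (-(io n)) y :=
      (io n).hasFDerivAt.const_sub q
    have := ((hu.diff (q - io n y)).hasFDerivAt.comp y h1)
    have h2 : (fun y : X n => u (q - io n y)) = u ∘ fun y => q - io n y := rfl
    rw [h2, this.fderiv]
    simp
  rw [this]; ring

lemma Lb_cv {n : ℕ} (A) {k : X n → ℝ} {u : X (n + 1) → ℝ} (hk : Sm k) (hu : Sm u) :
    Lb A (cv k u) = cv k (Lb A u) := by
  funext q
  have i : ∀ {w : X (n + 1) → ℝ}, Sm w → Integrable fun y => k y * w (q - io n y) := fun hw =>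
    (hk.mul (slice_sm hw q)).integrable
  unfold Lb
  simp_rw [dd_cv hk hu, dd_cv hk (hu.dd _)]
  unfold cv
  have e : ∀ y : X n, k y * (dd et u (q - io n y) + ∑ j, ∑ l, A ((q - io n y).2 0) j l *
      dd (ex j) (dd (ex l) u) (q - io n y)) = k y * dd et u (q - io n y) + ∑ j, ∑ l, A (q.2 0) j l *
      (k y * dd (ex j) (dd (ex l) u) (q - io n y)) := by
    intro y
    have : (q - io n y).2 0 = q.2 0 := by simp
    rw [this, mul_add, Finset.mul_sum]
    congr 1
    refine Finset.sum_congr rfl fun j _ => ?_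
    rw [Finset.mul_sum]
    exact Finset.sum_congr rfl fun l _ => by ring
  simp_rw [e]
  rw [integral_add (i (hu.dd _)) (integrable_finsetSum _ fun j _ => integrable_finsetSum _ fun l _ =>
    (i ((hu.dd _).dd _)).const_mul _), integral_finsetSum _ fun j _ => integrable_finsetSum _ fun l _ =>
    (i ((hu.dd _).dd _)).const_mul _]
  congr 1
  refine Finset.sum_congr rfl fun j _ => ?_
  rw [integral_finsetSum _ fun l _ => (i ((hu.dd _).dd _)).const_mul _]
  exact Finset.sum_congr rfl fun l _ => (integral_const_mul _ _).symm

lemma avg_pt {Y : Type*} [MeasurableSpace Y] {μ : Measure Y} {k g : Y → ℝ} (hk : Integrable k μ)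
    (hg : AEStronglyMeasurable g μ) {K : ℝ} (hK : ∀ y, |g y| ≤ K) :
    (∫ y, k y * g y ∂μ) ^ 2 ≤ (∫ y, |k y| ∂μ) * ∫ y, |k y| * g y ^ 2 ∂μ := by
  have hs : ∀ y, Real.sqrt |k y| ^ 2 = |k y| := fun y => Real.sq_sqrt (abs_nonneg _)
  have hs2 : ∀ y, Real.sqrt |k y| * Real.sqrt |k y| = |k y| := fun y =>
    Real.mul_self_sqrt (abs_nonneg _)
  have i1 : Integrable (fun y => |k y| * g y ^ 2) μ := by
    have : Integrable (fun y => g y ^ 2 * |k y|) μ := by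
      refine hk.abs.bdd_mul (c := K ^ 2) (hg.pow 2) (Eventually.of_forall fun y => ?_)
      rw [Real.norm_of_nonneg (sq_nonneg _), ← sq_abs]
      gcongr; exact hK y
    simpa [mul_comm] using this
  have i2 : Integrable (fun y => |k y| * |g y|) μ := by
    have : Integrable (fun y => |g y| * |k y|) μ := by
      refine hk.abs.bdd_mul (c := K) hg.norm (Eventually.of_forall fun y => ?_)
      simpa using hK y
    simpa [mul_comm] using this
  have h := cs (μ := μ) (F := fun y => Real.sqrt |k y|) (G := fun y => Real.sqrt |k y| * |g y|)
    (by simpa [hs] using hk.abs) (by simpa [mul_pow, hs] using i1)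
    (by simpa [← mul_assoc, hs2] using i2)
  simp only [← mul_assoc, hs2, mul_pow, hs, sq_abs] at h
  refine le_trans ?_ h
  have h3 : |∫ y, k y * g y ∂μ| ≤ ∫ y, |k y| * |g y| ∂μ := by
    refine (abs_integral_le_integral_abs).trans (le_of_eq ?_)
    simp_rw [abs_mul]
  rw [← sq_abs]
  gcongr

lemma avg_L2 {Z Y : Type*} [MeasurableSpace Y] [MeasurableSpace Z] {ν : Measure Z}
    [IsFiniteMeasure ν] {μ : Measure Y} [SFinite μ] {k : Y → ℝ} (hk : Integrable k μ)
    {G : Z → Y → ℝ} (hG : Measurable (Function.uncurry G)) {K : ℝ} (hK : ∀ q y, |G q y| ≤ K)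
    {M : ℝ} (hM : ∀ y, k y ≠ 0 → ∫ q, G q y ^ 2 ∂ν ≤ M) :
    ∫ q, (∫ y, k y * G q y ∂μ) ^ 2 ∂ν ≤ (∫ y, |k y| ∂μ) ^ 2 * M := by
  have hprod : Integrable (fun z : Z × Y => |k z.2| * G z.1 z.2 ^ 2) (ν.prod μ) := by
    have h1 : Integrable (fun z : Z × Y => |k z.2|) (ν.prod μ) := by
      have := (integrable_const (μ := ν) (1:ℝ)).mul_prod hk.abs
      simpa using this
    have : Integrable (fun z : Z × Y => G z.1 z.2 ^ 2 * |k z.2|) (ν.prod μ) := by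
      refine h1.bdd_mul (c := K ^ 2) (hG.pow_const 2).aestronglyMeasurable
        (Eventually.of_forall fun y => ?_)
      rw [Real.norm_of_nonneg (sq_nonneg _), ← sq_abs]
      have := hK y.1 y.2
      gcongr
    simpa [mul_comm] using this
  have h2 := hprod.integral_prod_left
  have h3 : ∀ q, (∫ y, k y * G q y ∂μ) ^ 2 ≤ (∫ y, |k y| ∂μ) * ∫ y, |k y| * G q y ^ 2 ∂μ := fun q =>
    avg_pt hk (hG.comp measurable_prodMk_left).aestronglyMeasurable (hK q)
  have h4 : ∫ q, (∫ y, k y * G q y ∂μ) ^ 2 ∂ν ≤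
      ∫ q, (∫ y, |k y| ∂μ) * ∫ y, |k y| * G q y ^ 2 ∂μ ∂ν :=
    integral_mono_of_nonneg (Eventually.of_forall fun q => sq_nonneg _) (h2.const_mul _)
      (Eventually.of_forall h3)
  refine h4.trans ?_
  rw [integral_const_mul, integral_integral_swap hprod, pow_two, mul_assoc]
  have h0 : 0 ≤ ∫ y, |k y| ∂μ := integral_nonneg fun y => abs_nonneg _
  gcongr
  rw [← integral_mul_const]
  refine integral_mono_of_nonneg (Eventually.of_forall fun y => integral_nonneg fun q => by positivity)
    (hk.abs.mul_const _) (Eventually.of_forall fun y => ?_)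
  simp only
  rw [integral_const_mul]
  by_cases hy : k y = 0
  · simp [hy]
  · gcongr; exact hM y hy

lemma ball_fin {m : ℕ} (q : X m) (ρ : ℝ) : volume (Metric.ball q ρ) < ⊤ := measure_ball_lt_top

instance {m : ℕ} (q : X m) (ρ : ℝ) : IsFiniteMeasure (volume.restrict (Metric.ball q ρ)) :=
  ⟨by simpa using ball_fin q ρ⟩

lemma transl {m : ℕ} {g : X m → ℝ} (h0 : ∀ q, 0 ≤ g q) {h : X m} {ρ r : ℝ} (hr : ‖h‖ ≤ r)
    (hi : IntegrableOn g (Metric.ball 0 (ρ + r))) :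
    ∫ q in Metric.ball 0 ρ, g (q + h) ≤ ∫ q in Metric.ball 0 (ρ + r), g q := by
  have h1 := (measurePreserving_add_right (volume : Measure (X m)) h).setIntegral_preimage_emb
    (MeasurableEquiv.addRight h).measurableEmbedding g (Metric.ball h ρ)
  have h2 : (fun q => q + h) ⁻¹' (Metric.ball h ρ) = Metric.ball 0 ρ := by
    ext q; simp [dist_eq_norm]
  rw [h2] at h1
  rw [h1]
  refine setIntegral_mono_set hi (Eventually.of_forall h0) ?_
  refine (Metric.ball_subset_ball' ?_).eventuallyLE
  simp; linarith

/-- bounded measurable -/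
def BM {α : Type*} [MeasurableSpace α] (f : α → ℝ) : Prop := Measurable f ∧ ∃ K, ∀ q, |f q| ≤ K

lemma Sm.bm {m : ℕ} {f : X m → ℝ} (hf : Sm f) : BM f := ⟨hf.cont.measurable, hf.bdd⟩

lemma BM.sq_int {α : Type*} [MeasurableSpace α] {f : α → ℝ} (hf : BM f) {ν : Measure α} [IsFiniteMeasure ν] :
    Integrable (fun q => f q ^ 2) ν := by
  obtain ⟨h1, K, hK⟩ := hf
  refine Integrable.of_bound (C := K ^ 2) (h1.pow_const 2).aestronglyMeasurable (Eventually.of_forall fun y => ?_)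
  rw [Real.norm_of_nonneg (sq_nonneg _), ← sq_abs]
  have := hK y
  gcongr

lemma cv_L2 {n : ℕ} {k : X n → ℝ} (hk : Sm k) (hk1 : ∀ y, k y ≠ 0 → ‖y‖ ≤ 1) {f : X (n + 1) → ℝ}
    (hf : BM f) (ρ : ℝ) : ∫ q in Metric.ball 0 ρ, (cv k f q) ^ 2 ≤
      (∫ y, |k y|) ^ 2 * ∫ q in Metric.ball 0 (ρ + 1), f q ^ 2 := by
  obtain ⟨K, hK⟩ := hf.2
  refine avg_L2 (hk.integrable (μ := volume)) (G := fun q y => f (q - io n y)) (K := K) ?_ (fun q y => hK _) fun y hy => ?_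
  · exact hf.1.comp (by fun_prop)
  · have := transl (g := fun q => f q ^ 2) (fun q => sq_nonneg _) (h := - io n y) (ρ := ρ) (r := 1)
      (by rw [norm_neg, io_norm]; exact hk1 y hy) hf.sq_int
    simpa [sub_eq_add_neg] using this

lemma diff_L2 {m : ℕ} {f : X m → ℝ} (hf : Sm f) {h : X m} (hh : ‖h‖ ≤ 1) (ρ : ℝ) :
    ∫ q in Metric.ball 0 ρ, (f (q + h) - f q) ^ 2 ≤ ∫ q in Metric.ball 0 (ρ + 1), (dd h f q) ^ 2 := by
  have e : ∀ q, f (q + h) - f q = ∫ s in Ioc (0:ℝ) 1, (1:ℝ) * dd h f (q + s • h) := by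
    intro q
    have h1 : Continuous (dd h f) := (hf.dd h).cont
    have := intervalIntegral.integral_eq_sub_of_hasDerivAt (a := 0) (b := 1)
      (fun s _ => dd_line hf.diff h q s) ((by fun_prop : Continuous fun s : ℝ => dd h f (q + s • h)).intervalIntegrable _ _)
    simp only [one_mul]
    rw [← intervalIntegral.integral_of_le zero_le_one, this]
    simp
  simp_rw [e]
  obtain ⟨K, hK⟩ := (hf.dd h).bdd
  have hm : Measurable (Function.uncurry fun (q : X m) (s : ℝ) => dd h f (q + s • h)) := by
    have h1 : Continuous (dd h f) := (hf.dd h).cont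
    exact Continuous.measurable (by unfold Function.uncurry; fun_prop)
  have hk : Integrable (indicator (Ioc (0:ℝ) 1) fun _ => (1:ℝ)) :=
    (integrable_indicator_iff measurableSet_Ioc).2 (by simp)
  have := avg_L2 (ν := volume.restrict (Metric.ball (0 : X m) ρ)) (μ := volume) hk
    (G := fun q s => dd h f (q + s • h)) hm (fun q y => hK _)
    (M := ∫ q in Metric.ball 0 (ρ + 1), (dd h f q) ^ 2) ?_
  · have e1 : (∫ y : ℝ, |indicator (Ioc (0:ℝ) 1) (fun _ => (1:ℝ)) y|) = 1 := by
      have : (fun y : ℝ => |indicator (Ioc (0:ℝ) 1) (fun _ => (1:ℝ)) y|) = indicator (Ioc (0:ℝ) 1) (fun _ => (1:ℝ)) := by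
        funext y; by_cases hy : y ∈ Ioc (0:ℝ) 1 <;> simp [hy]
      rw [this, integral_indicator measurableSet_Ioc]
      simp
    rw [e1] at this
    simp only [one_pow, one_mul] at this
    refine le_trans (le_of_eq ?_) this
    congr 1
    funext q
    congr 1
    rw [← integral_indicator measurableSet_Ioc]
    congr 1
    funext s
    by_cases hy : s ∈ Ioc (0:ℝ) 1 <;> simp [hy]
  · intro s hs
    have hs : s ∈ Ioc (0:ℝ) 1 := by by_contra h; exact hs (by simp [h])
    refine transl (g := fun q => dd h f q ^ 2) (fun q => sq_nonneg _) (h := s • h) (ρ := ρ) (r := 1) ?_ (hf.dd h).bm.sq_int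
    rw [norm_smul, Real.norm_of_nonneg hs.1.le]
    nlinarith [hs.1, hs.2, norm_nonneg h]

end KK
end

section
open MeasureTheory Set Filter Topology
namespace KK

lemma dd_smul {E : Type*} [NormedAddCommGroup E] [NormedSpace ℝ E] (c : ℝ) (e : E) (f : E → ℝ) (q : E) :
    dd (c • e) f q = c * dd e f q := by simp [dd]

lemma dd_neg {E : Type*} [NormedAddCommGroup E] [NormedSpace ℝ E] (e : E) (f : E → ℝ) (q : E) :
    dd (-e) f q = - dd e f q := by simp [dd]

lemma dd_shift {E : Type*} [NormedAddCommGroup E] [NormedSpace ℝ E] (e h : E) (f : E → ℝ) (q : E) :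
    dd e (fun q => f (q + h)) q = dd e f (q + h) := by simp [dd, fderiv_comp_add_right]

lemma Sm.shift {m : ℕ} {f : X m → ℝ} (hf : Sm f) (h : X m) : Sm (fun q => f (q + h)) :=
  ⟨hf.1.comp (by fun_prop), hf.2.comp_homeomorph (Homeomorph.addRight h)⟩

lemma dd_vec {m : ℕ} (z : Fin m → ℝ) (f : X m → ℝ) (q) :
    dd (0, z) f q = ∑ j, z j * dd (ex j) f q := by
  unfold dd
  have : ((0, z) : X m) = ∑ j, z j • ex j := by
    ext j
    · simp [ex, Prod.fst_sum]
    · simp [ex, Prod.snd_sum, Finset.sum_apply, Pi.single_apply]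
  rw [this, map_sum]
  simp

lemma dd2_vec_sq {m : ℕ} {f : X m → ℝ} (hf : Sm f) {z : Fin m → ℝ} {ε : ℝ} (hε : 0 ≤ ε) (hz : ∀ j, |z j| ≤ ε) (q) :
    (dd (0, z) (dd (0, z) f) q) ^ 2 ≤ (m : ℝ) ^ 2 * ε ^ 4 * H2 f q := by
  have e : dd (0, z) (dd (0, z) f) q = ∑ j, ∑ l, z j * z l * dd (ex j) (dd (ex l) f) q := by
    rw [dd_vec]
    refine Finset.sum_congr rfl fun j _ => ?_
    rw [dd_comm hf.1, dd_vec, Finset.mul_sum]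
    refine Finset.sum_congr rfl fun l _ => ?_
    rw [dd_comm hf.1 (ex l) (ex j)]
    ring
  rw [e, H2, mul_assoc, Finset.mul_sum (a := ε ^ 4)]
  refine (sq_sum2_le _).trans ?_
  gcongr with j _
  rw [Finset.mul_sum]
  gcongr with l _
  rw [mul_pow]
  gcongr
  have h1 : |z j * z l| ≤ ε * ε := by
    rw [abs_mul]; exact mul_le_mul (hz j) (hz l) (abs_nonneg _) hε
  calc (z j * z l) ^ 2 = |z j * z l| ^ 2 := (sq_abs _).symm
    _ ≤ (ε * ε) ^ 2 := by gcongr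
    _ = ε ^ 4 := by ring

lemma bm_of_sm_sq_int {m : ℕ} {f : X m → ℝ} (hf : Sm f) (ρ : ℝ) :
    IntegrableOn (fun q => f q ^ 2) (Metric.ball 0 ρ) := hf.bm.sq_int

lemma ball_mono_int {m : ℕ} {g : X m → ℝ} (hg : Integrable g) (h0 : ∀ q, 0 ≤ g q) {ρ r : ℝ} (h : ρ ≤ r) :
    ∫ q in Metric.ball 0 ρ, g q ≤ ∫ q in Metric.ball 0 r, g q :=
  setIntegral_mono_set hg.integrableOn (Eventually.of_forall h0) (Metric.ball_subset_ball h).eventuallyLE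

lemma int_sq3 {α : Type*} [MeasurableSpace α] {ν : Measure α} {f A B C : α → ℝ}
    (hA : Integrable (fun q => A q ^ 2) ν) (hB : Integrable (fun q => B q ^ 2) ν) (hC : Integrable (fun q => C q ^ 2) ν)
    (h : ∀ q, f q = A q + B q + C q) :
    ∫ q, f q ^ 2 ∂ν ≤ 3 * (∫ q, A q ^ 2 ∂ν) + 3 * (∫ q, B q ^ 2 ∂ν) + 3 * ∫ q, C q ^ 2 ∂ν := by
  have hAB : Integrable (fun q => 3 * A q ^ 2 + 3 * B q ^ 2) ν := (hA.const_mul _).add (hB.const_mul _)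
  rw [← integral_const_mul, ← integral_const_mul, ← integral_const_mul, ← integral_add (hA.const_mul _) (hB.const_mul _),
    ← integral_add hAB (hC.const_mul _)]
  refine integral_mono_of_nonneg (Eventually.of_forall fun q => sq_nonneg _)
    (((hA.const_mul _).add (hB.const_mul _)).add (hC.const_mul _)) (Eventually.of_forall fun q => ?_)
  simp only [h]
  exact sq3_le _ _ _

lemma small_pt {m : ℕ} {u : X m → ℝ} (hu : Sm u) {ε : ℝ} (h0 : 0 ≤ ε) (h1 : ε ≤ 1) {y : X m} (hy : ‖y‖ ≤ ε) (ρ : ℝ) :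
    ∫ q in Metric.ball 0 ρ, (u (q - y) + u (q + y) - 2 * u q) ^ 2 ≤
      (6 + 3 * (m : ℝ) ^ 2) * ε ^ 2 * ∫ q in Metric.ball 0 (ρ + 2), en u q := by
  set a : X m := (y.1, 0) with ha
  set b : X m := (0, y.2) with hb
  have hab : y = a + b := by simp [ha, hb]
  have hna : ‖a‖ ≤ 1 := by
    refine le_trans ?_ (hy.trans h1)
    simp [ha, Prod.norm_def]
  have hnb : ‖b‖ ≤ 1 := by
    refine le_trans ?_ (hy.trans h1)
    simp [hb, Prod.norm_def]
  have hy1 : |y.1| ≤ ε := (norm_fst_le y).trans hy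
  have hy2 : ∀ j, |y.2 j| ≤ ε := fun j => (norm_le_pi_norm y.2 j).trans ((norm_snd_le y).trans hy)
  set E := ∫ q in Metric.ball 0 (ρ + 2), en u q with hE
  have hT : ∀ σ : ℝ, |σ| ≤ ε → ∀ c : X m, ‖c‖ ≤ 1 → ‖(σ, (0 : Fin m → ℝ))‖ ≤ 1 →
      ∫ q in Metric.ball 0 ρ, (u (q + c + (σ, 0)) - u (q + c)) ^ 2 ≤ ε ^ 2 * E := by
    intro σ hσ c hc hσ1
    have t1 := transl (g := fun q => (u (q + (σ, 0)) - u q) ^ 2) (fun q => sq_nonneg _) (h := c) (ρ := ρ) hc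
      (bm_of_sm_sq_int ((hu.shift _).sub hu) _)
    refine t1.trans ?_
    refine (diff_L2 hu hσ1 _).trans ?_
    rw [show ρ + 1 + 1 = ρ + 2 by ring, hE, ← integral_const_mul]
    refine integral_mono (bm_of_sm_sq_int (hu.dd _) _) (hu.en.integrable.integrableOn.const_mul _) fun q => ?_
    have : ((σ, 0) : X m) = σ • et := by simp [et]
    simp only
    rw [this, dd_smul, mul_pow]
    have h2 : σ ^ 2 ≤ ε ^ 2 := by rw [← sq_abs]; gcongr
    have h3 : dd et u q ^ 2 ≤ en u q := le_add_of_nonneg_left (H2_nonneg _ _)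
    gcongr
  have hA := hT (-y.1) (by simpa using hy1) (-b) (by simpa using hnb) (by simpa [ha, Prod.norm_def] using hna)
  have hB := hT y.1 hy1 b hnb (by simpa [ha, Prod.norm_def] using hna)
  have hC : ∫ q in Metric.ball 0 ρ, (u (q + -b + b) - u (q + -b) - (u (q + b) - u q)) ^ 2 ≤ (m : ℝ) ^ 2 * ε ^ 2 * E := by
    have hg := (hu.shift b).sub hu
    refine (diff_L2 hg (h := -b) (by simpa using hnb) ρ).trans ?_
    have e1 : ∀ q, dd (-b) (fun q => u (q + b) - u q) q ^ 2 = (dd b u (q + b) - dd b u q) ^ 2 := by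
      intro q
      rw [dd_neg, neg_sq, dd_sub (hu.shift b).diff hu.diff]
      simp only [dd_shift]
    simp_rw [e1]
    refine (diff_L2 (hu.dd b) hnb _).trans ?_
    rw [show ρ + 1 + 1 = ρ + 2 by ring, hE, ← integral_const_mul]
    refine integral_mono (bm_of_sm_sq_int ((hu.dd _).dd _) _) (hu.en.integrable.integrableOn.const_mul _) fun q => ?_
    refine (dd2_vec_sq hu h0 hy2 q).trans ?_
    have h3 : H2 u q ≤ en u q := le_add_of_nonneg_right (sq_nonneg _)
    have h4 : ε ^ 4 ≤ ε ^ 2 := pow_le_pow_of_le_one h0 h1 (by norm_num)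
    have := H2_nonneg u q
    gcongr
  have i1 := bm_of_sm_sq_int ((((hu.shift (-y.1, 0)).shift (-b)).sub (hu.shift (-b)))) ρ
  have i2 := bm_of_sm_sq_int ((((hu.shift (y.1, 0)).shift b).sub (hu.shift b))) ρ
  have hg := (hu.shift b).sub hu
  have i3 := bm_of_sm_sq_int ((hg.shift (-b)).sub hg) ρ
  have := int_sq3 (f := fun q => u (q - y) + u (q + y) - 2 * u q) i1 i2 (i3.congr (Eventually.of_forall fun q => (neg_sq _).symm)) ?_
  · simp only [neg_sq] at this
    have e : (6 + 3 * (m : ℝ) ^ 2) * ε ^ 2 * E = 3 * (ε ^ 2 * E) + 3 * (ε ^ 2 * E) + 3 * ((m : ℝ) ^ 2 * ε ^ 2 * E) := by ring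
    rw [e]
    exact this.trans (by gcongr)
  · intro q
    have e1 : q + -b + (-y.1, 0) = q - y := by
      ext j <;> simp [hb, sub_eq_add_neg]
    have e2 : q + b + (y.1, 0) = q + y := by
      ext j <;> simp [hb]
    simp only [e1, e2, neg_add_cancel_right]
    ring

/-- an even mollifier -/
structure Ker {n : ℕ} (ε : ℝ) (k : X n → ℝ) : Prop where
  sm : Sm k
  even : ∀ y, k (-y) = k y
  nn : ∀ y, 0 ≤ k y
  one : ∫ y, k y = 1
  supp : ∀ y, k y ≠ 0 → ‖y‖ ≤ ε

lemma exists_ker (n : ℕ) {ε : ℝ} (hε : 0 < ε) : ∃ k : X n → ℝ, Ker ε k := by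
  let f : ContDiffBump (0 : X n) := ⟨ε / 2, ε, by linarith, by linarith⟩
  refine ⟨f.normed volume, ⟨f.contDiff_normed, f.hasCompactSupport_normed⟩, fun y => ?_, fun y => f.nonneg_normed y,
    f.integral_normed, fun y hy => ?_⟩
  · exact f.normed_neg _
  · have : y ∈ Function.support (f.normed volume) := hy
    rw [f.support_normed_eq] at this
    rw [mem_ball_zero_iff] at this
    exact this.le

lemma Ker.abs_one {n : ℕ} {ε : ℝ} {k : X n → ℝ} (hk : Ker ε k) : ∫ y, |k y| = 1 := by
  rw [← hk.one]; congr 1; funext y; exact abs_of_nonneg (hk.nn y)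

lemma small {n : ℕ} {u : X (n + 1) → ℝ} (hu : Sm u) {ε : ℝ} (h0 : 0 ≤ ε) (h1 : ε ≤ 1) {k : X n → ℝ} (hk : Ker ε k)
    (ρ : ℝ) : ∫ q in Metric.ball 0 ρ, (u q - cv k u q) ^ 2 ≤
      (6 + 3 * ((n : ℝ) + 1) ^ 2) * ε ^ 2 * ∫ q in Metric.ball 0 (ρ + 2), en u q := by
  obtain ⟨K, hK⟩ := hu.bdd
  have hc := hu.cont
  have key : ∀ q, u q - cv k u q = (-1/2) * ∫ y, k y * (u (q - io n y) + u (q + io n y) - 2 * u q) := by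
    intro q
    have j1 := (hk.sm.mul (slice_sm hu q)).integrable (μ := volume)
    have e1 : cv k u q = ∫ y, k y * u (q + io n y) := by
      unfold cv
      rw [← integral_neg_eq_self]
      simp [hk.even]
    have j2 : Integrable (fun y => k y * u (q + io n y)) := by
      have := j1.comp_neg
      simpa [hk.even] using this
    have e2 : ∫ y, k y * (2 * u q) = 2 * u q := by rw [integral_mul_const, hk.one, one_mul]
    have e3 : ∫ y, k y * (u (q - io n y) + u (q + io n y) - 2 * u q) =
        cv k u q + cv k u q - 2 * u q := by
      have j3 : Integrable (fun y => k y * u (q - io n y) + k y * u (q + io n y)) := j1.add j2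
      have e4 : cv k u q + cv k u q - 2 * u q = (∫ y, k y * u (q - io n y)) + (∫ y, k y * u (q + io n y)) -
        ∫ y, k y * (2 * u q) := by rw [e2, ← e1]; rfl
      rw [e4, ← integral_add j1 j2, ← integral_sub j3 ((hk.sm.integrable (μ := volume)).mul_const _)]
      congr 1
      funext y
      ring
    rw [e3]; ring
  have main := avg_L2 (ν := volume.restrict (Metric.ball (0 : X (n + 1)) ρ)) (hk.sm.integrable (μ := volume))
    (G := fun q y => u (q - io n y) + u (q + io n y) - 2 * u q) (K := 4 * K) ?_ ?_
    (M := (6 + 3 * ((n : ℝ) + 1) ^ 2) * ε ^ 2 * ∫ q in Metric.ball 0 (ρ + 2), en u q) ?_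
  · simp_rw [key, mul_pow]
    rw [integral_const_mul]
    rw [hk.abs_one, one_pow, one_mul] at main
    have : 0 ≤ ∫ q in Metric.ball 0 ρ, (∫ y, k y * (u (q - io n y) + u (q + io n y) - 2 * u q)) ^ 2 :=
      integral_nonneg fun q => sq_nonneg _
    linarith
  · exact Continuous.measurable (by unfold Function.uncurry; fun_prop)
  · intro q y
    have a1 := abs_le.1 (hK (q - io n y))
    have a2 := abs_le.1 (hK (q + io n y))
    have a3 := abs_le.1 (hK q)
    rw [abs_le]
    constructor <;> linarith [a1.1, a1.2, a2.1, a2.2, a3.1, a3.2]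
  · intro y hy
    have := small_pt hu h0 h1 (y := io n y) (by rw [io_norm]; exact hk.supp y hy) ρ
    push_cast at this
    exact this

end KK
end

section
open MeasureTheory Set Filter Topology
namespace KK

lemma sob_aux {a b α β : ℝ → ℝ} (ha : Continuous a) (hb : Continuous b) (hα : Continuous α) (hβ : Continuous β)
    (h1 : ∀ s ∈ Icc (0:ℝ) 1, |α s| ≤ 6) (h2 : ∀ s ∈ Icc (0:ℝ) 1, |β s| ≤ 6) {c : ℝ}
    (hc : |c| = |∫ s in (0:ℝ)..1, (a s * α s + b s * β s)|) :
    c ^ 2 ≤ 72 * ∫ s in Icc (0:ℝ) 1, (a s ^ 2 + b s ^ 2) := by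
  rw [← sq_abs, hc, sq_abs, intervalIntegral.integral_of_le zero_le_one, ← integral_Icc_eq_integral_Ioc]
  have hcont : Continuous fun s => a s * α s + b s * β s := by fun_prop
  have h := cs (μ := volume.restrict (Icc (0:ℝ) 1)) (F := fun _ => (1:ℝ)) (G := fun s => a s * α s + b s * β s)
    (by simp) ((hcont.pow 2).continuousOn.integrableOn_Icc)
    (by simp only [one_mul]; exact hcont.continuousOn.integrableOn_Icc)
  simp only [one_mul, one_pow, integral_const, MeasurableSet.univ, measureReal_restrict_apply, univ_inter,
    Real.volume_real_Icc, smul_eq_mul] at h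
  norm_num at h
  refine h.trans ?_
  rw [← integral_const_mul]
  refine setIntegral_mono_on ((hcont.pow 2).continuousOn.integrableOn_Icc)
    (Continuous.integrableOn_Icc (by fun_prop)) measurableSet_Icc fun s hs => ?_
  have e1 : α s ^ 2 ≤ 36 := by rw [← sq_abs]; nlinarith [h1 s hs, abs_nonneg (α s)]
  have e2 : β s ^ 2 ≤ 36 := by rw [← sq_abs]; nlinarith [h2 s hs, abs_nonneg (β s)]
  have e3 : (a s * α s + b s * β s) ^ 2 ≤ 2 * ((a s * α s) ^ 2 + (b s * β s) ^ 2) := add_sq_le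
  have e4 : (a s * α s) ^ 2 ≤ a s ^ 2 * 36 := by rw [mul_pow]; gcongr
  have e5 : (b s * β s) ^ 2 ≤ b s ^ 2 * 36 := by rw [mul_pow]; gcongr
  linarith

lemma line_cont {m : ℕ} {f : X m → ℝ} (hf : Sm f) (e q : X m) : Continuous fun s : ℝ => f (q + s • e) := by have := hf.cont; fun_prop

lemma sob1 {m : ℕ} {f : X m → ℝ} (hf : Sm f) (e q : X m) : f q ^ 2 ≤ 72 * ∫ s in Icc (0:ℝ) 1, (f (q + s • e) ^ 2 + dd e f (q + s • e) ^ 2) := by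
  refine sob_aux (α := fun _ => -1) (β := fun s => 1 - s) (line_cont hf e q) (line_cont (hf.dd e) e q) (by fun_prop) (by fun_prop)
    (fun s _ => by norm_num) (fun s hs => by rw [abs_le]; constructor <;> linarith [hs.1, hs.2]) ?_
  have := intervalIntegral.integral_eq_sub_of_hasDerivAt (a := 0) (b := 1)
    (f := fun s : ℝ => f (q + s • e) * (1 - s)) (f' := fun s : ℝ => f (q + s • e) * (-1) + dd e f (q + s • e) * (1 - s))
    (fun s _ => ?_) (Continuous.intervalIntegrable ?_ _ _)
  · rw [this]; simp
  · have := (dd_line hf.diff e q s).mul ((hasDerivAt_id s).const_sub 1)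
    refine this.congr_deriv ?_
    simp; ring
  · have h1 := line_cont hf e q
    have h2 := line_cont (hf.dd e) e q
    exact (h1.mul continuous_const).add (h2.mul (by fun_prop))

lemma sob2_aux {m : ℕ} {f : X m → ℝ} (hf : Sm f) (e q : X m) {ψ ψ' ψ'' : ℝ → ℝ} (d1 : ∀ s, HasDerivAt ψ (ψ' s) s) (d2 : ∀ s, HasDerivAt ψ' (ψ'' s) s)
    (c1 : Continuous ψ'') : ∫ s in (0:ℝ)..1, (f (q + s • e) * (- ψ'' s) + dd e (dd e f) (q + s • e) * ψ s) =
    (dd e f (q + e) * ψ 1 - f (q + e) * ψ' 1) - (dd e f q * ψ 0 - f q * ψ' 0) := by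
  have := intervalIntegral.integral_eq_sub_of_hasDerivAt (a := 0) (b := 1)
    (f := fun s : ℝ => dd e f (q + s • e) * ψ s - f (q + s • e) * ψ' s)
    (f' := fun s => f (q + s • e) * (- ψ'' s) + dd e (dd e f) (q + s • e) * ψ s)
    (fun s _ => ?_) (Continuous.intervalIntegrable ?_ _ _)
  · rw [this]; simp
  · have := ((dd_line (hf.dd e).diff e q s).mul (d1 s)).sub ((dd_line hf.diff e q s).mul (d2 s))
    refine this.congr_deriv ?_
    ring
  · have h1 := line_cont hf e q
    have h2 := line_cont ((hf.dd e).dd e) e q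
    have h3 : Continuous ψ := continuous_iff_continuousAt.2 fun s => (d1 s).continuousAt
    exact (h1.mul c1.neg).add (h2.mul h3)

lemma sob2 {m : ℕ} {f : X m → ℝ} (hf : Sm f) (e q : X m) : f q ^ 2 ≤ 72 * ∫ s in Icc (0:ℝ) 1, (f (q + s • e) ^ 2 + dd e (dd e f) (q + s • e) ^ 2) := by
  refine sob_aux (α := fun s => -(6 * s - 4)) (β := fun s => s * (1 - s) ^ 2) (line_cont hf e q) (line_cont ((hf.dd e).dd e) e q) (by fun_prop) (by fun_prop)
    (fun s hs => by rw [abs_le]; constructor <;> linarith [hs.1, hs.2])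
    (fun s hs => ?_) ?_
  · have h1 := mul_le_one₀ hs.2 (sq_nonneg (1 - s)) (by nlinarith [hs.1, hs.2])
    have h2 := mul_nonneg hs.1 (sq_nonneg (1 - s))
    rw [abs_of_nonneg h2]; linarith
  · rw [sob2_aux hf e q (ψ := fun s => s * (1 - s) ^ 2) (ψ' := fun s => (1 - s) ^ 2 - 2 * s * (1 - s))
      (ψ'' := fun s => 6 * s - 4) (fun s => ?_) (fun s => ?_) (by fun_prop)]
    · simp
    · have h := (hasDerivAt_id s).mul (((hasDerivAt_id s).const_sub 1).pow 2)
      refine h.congr_deriv ?_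
      simp; ring
    · have h := (((hasDerivAt_id s).const_sub 1).pow 2).sub (((hasDerivAt_id s).const_mul 2).mul ((hasDerivAt_id s).const_sub 1))
      refine h.congr_deriv ?_
      simp; ring

lemma sob3 {m : ℕ} {f : X m → ℝ} (hf : Sm f) (e q : X m) : dd e f q ^ 2 ≤ 72 * ∫ s in Icc (0:ℝ) 1, (f (q + s • e) ^ 2 + dd e (dd e f) (q + s • e) ^ 2) := by
  refine sob_aux (α := fun s => -(12 * s - 6)) (β := fun s => (1 + 2 * s) * (1 - s) ^ 2) (line_cont hf e q) (line_cont ((hf.dd e).dd e) e q) (by fun_prop) (by fun_prop)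
    (fun s hs => by rw [abs_le]; constructor <;> linarith [hs.1, hs.2])
    (fun s hs => ?_) ?_
  · have h0 : (1 - s) ^ 2 ≤ 1 := by nlinarith [hs.1, hs.2]
    have h1 : (1 + 2 * s) * (1 - s) ^ 2 ≤ 3 * 1 :=
      mul_le_mul (by linarith [hs.2]) h0 (sq_nonneg _) (by norm_num)
    have h2 := mul_nonneg (by linarith [hs.1] : 0 ≤ 1 + 2 * s) (sq_nonneg (1 - s))
    rw [abs_of_nonneg h2]; linarith
  · rw [sob2_aux hf e q (ψ := fun s => (1 + 2 * s) * (1 - s) ^ 2) (ψ' := fun s => 2 * (1 - s) ^ 2 - (1 + 2 * s) * (2 * (1 - s)))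
      (ψ'' := fun s => 12 * s - 6) (fun s => ?_) (fun s => ?_) (by fun_prop)]
    · simp
    · have h := (((hasDerivAt_id s).const_mul 2).const_add 1).mul (((hasDerivAt_id s).const_sub 1).pow 2)
      refine h.congr_deriv ?_
      simp; ring
    · have h := ((((hasDerivAt_id s).const_sub 1).pow 2).const_mul 2).sub
        ((((hasDerivAt_id s).const_mul 2).const_add 1).mul (((hasDerivAt_id s).const_sub 1).const_mul 2))
      refine h.congr_deriv ?_
      simp; ring

end KK
end

section
open MeasureTheory Set Filter Topology
namespace KK

abbrev Op (n : ℕ) := Option (Fin n × Fin n)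

/-- operators acting on functions -/
noncomputable def opw {n : ℕ} : Op n → (X (n + 1) → ℝ) → X (n + 1) → ℝ
  | none, w => dd et w
  | some (i, j), w => dd (ex i.succ) (dd (ex j.succ) w)

/-- operators acting on kernels -/
noncomputable def opk {n : ℕ} : Op n → (X n → ℝ) → X n → ℝ
  | none, w => dd et w
  | some (i, j), w => dd (ex i) (dd (ex j) w)

lemma Sm.opw {n : ℕ} {w : X (n + 1) → ℝ} (hw : Sm w) (o : Op n) : Sm (opw o w) := by
  rcases o with _ | ⟨i, j⟩
  · exact hw.dd _
  · exact (hw.dd _).dd _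

lemma Sm.opk {n : ℕ} {w : X n → ℝ} (hw : Sm w) (o : Op n) : Sm (opk o w) := by
  rcases o with _ | ⟨i, j⟩
  · exact hw.dd _
  · exact (hw.dd _).dd _

lemma opw_cv {n : ℕ} {k : X n → ℝ} {u : X (n + 1) → ℝ} (hk : Sm k) (hu : Sm u) (o : Op n) :
    opw o (cv k u) = cv (opk o k) u := by
  rcases o with _ | ⟨i, j⟩
  · simp only [opw, opk]
    rw [← cv_dd hk hu, io_et]
  · simp only [opw, opk]
    rw [← cv_dd (hk.dd _) hu, ← cv_dd hk hu, io_ex, io_ex]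

lemma dd_supp {m : ℕ} {k : X m → ℝ} (h : ∀ y, k y ≠ 0 → ‖y‖ ≤ 1) (e : X m) : ∀ y, dd e k y ≠ 0 → ‖y‖ ≤ 1 := by
  intro y hy
  by_contra hc
  push Not at hc
  apply hy
  have hs : IsOpen {y : X m | 1 < ‖y‖} := isOpen_lt continuous_const continuous_norm
  have : EqOn k (fun _ => 0) {y : X m | 1 < ‖y‖} := by
    intro z hz
    by_contra hk
    exact absurd (h z hk) (not_le.2 hz)
  rw [dd_congr hs this e hc]
  simp [dd]

lemma opk_supp {n : ℕ} {k : X n → ℝ} (h : ∀ y, k y ≠ 0 → ‖y‖ ≤ 1) (o : Op n) : ∀ y, opk o k y ≠ 0 → ‖y‖ ≤ 1 := by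
  rcases o with _ | ⟨i, j⟩
  · exact dd_supp h _
  · exact dd_supp (dd_supp h _) _

/-- sums of energies of derivatives -/
noncomputable def T {n : ℕ} : ℕ → (X (n + 1) → ℝ) → X (n + 1) → ℝ
  | 0, w => en w
  | m + 1, w => fun q => T m w q + ∑ o, T m (opw o w) q

lemma Sm.T {n : ℕ} (m : ℕ) : ∀ {w : X (n + 1) → ℝ}, Sm w → Sm (T m w) := by
  induction m with
  | zero => intro w hw; exact hw.en
  | succ m ih => intro w hw; exact (ih hw).add (Sm.sum _ fun o => ih (hw.opw o))

lemma T_nonneg {n : ℕ} (m : ℕ) : ∀ (w : X (n + 1) → ℝ) q, 0 ≤ T m w q := by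
  induction m with
  | zero => intro w q; exact en_nonneg w q
  | succ m ih => intro w q; exact add_nonneg (ih _ _) (Finset.sum_nonneg fun o _ => ih _ _)

lemma T_op {n : ℕ} (m : ℕ) (w : X (n + 1) → ℝ) (o : Op n) (q) : T m w q + T m (opw o w) q ≤ T (m + 1) w q := by
  have := Finset.single_le_sum (f := fun o => T m (opw o w) q) (fun o _ => T_nonneg m _ q) (Finset.mem_univ o)
  simp only [T]
  linarith

/-- line average -/
noncomputable def J {m : ℕ} (e : X m) (F : X m → ℝ) (q : X m) : ℝ := ∫ s in Icc (0:ℝ) 1, F (q + s • e)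

lemma J_int {m : ℕ} {F : X m → ℝ} (hF : Sm F) (e q : X m) : IntegrableOn (fun s : ℝ => F (q + s • e)) (Icc (0:ℝ) 1) :=
  (line_cont hF e q).continuousOn.integrableOn_Icc

lemma J_add {m : ℕ} {F G : X m → ℝ} (hF : Sm F) (hG : Sm G) (e q : X m) :
    J e (fun q => F q + G q) q = J e F q + J e G q := integral_add (J_int hF e q) (J_int hG e q)

lemma J_sum {m : ℕ} {ι : Type*} (s : Finset ι) {F : ι → X m → ℝ} (hF : ∀ i, Sm (F i)) (e q : X m) :
    J e (fun q => ∑ i ∈ s, F i q) q = ∑ i ∈ s, J e (F i) q := integral_finsetSum _ fun i _ => J_int (hF i) e q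

lemma J_mono {m : ℕ} {F G : X m → ℝ} (hF : Sm F) (hG : Sm G) (h : ∀ q, F q ≤ G q) (e q : X m) :
    J e F q ≤ J e G q := integral_mono (J_int hF e q) (J_int hG e q) fun _ => h _

lemma dd_comm22 {m : ℕ} {w : X m → ℝ} (hw : Sm w) (a b c d : X m) :
    dd a (dd b (dd c (dd d w))) = dd c (dd d (dd a (dd b w))) := by
  rw [dd_comm ((hw.dd d)).1 b c, dd_comm hw.1 b d, dd_comm ((hw.dd b).dd d).1 a c, dd_comm (hw.dd b).1 a d]

lemma en_step {n : ℕ} {w : X (n + 1) → ℝ} (hw : Sm w) (i : Fin n) (q) :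
    en w q ≤ 72 * J (ex i.succ) (T 1 w) q := by
  set e : X (n + 1) := ex i.succ
  have h1 : ∀ a b : X (n + 1), dd a (dd b w) q ^ 2 ≤ 72 * J e (fun q => dd a (dd b w) q ^ 2 + dd a (dd b (dd e (dd e w))) q ^ 2) q := by
    intro a b
    have := sob2 ((hw.dd b).dd a) e q
    rw [dd_comm22 hw] at this
    exact this
  have h2 : dd et w q ^ 2 ≤ 72 * J e (fun q => dd et w q ^ 2 + dd et (dd e (dd e w)) q ^ 2) q := by
    have := sob2 (hw.dd et) e q
    rw [dd_comm hw.1, dd_comm (hw.dd _).1] at this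
    exact this
  have s1 : ∀ a b : X (n + 1), Sm (fun q => dd a (dd b w) q ^ 2 + dd a (dd b (dd e (dd e w))) q ^ 2) := fun a b =>
    ((hw.dd b).dd a).sq.add ((((hw.dd e).dd e).dd b).dd a).sq
  have s2 : Sm (fun q => dd et w q ^ 2 + dd et (dd e (dd e w)) q ^ 2) := (hw.dd et).sq.add (((hw.dd e).dd e).dd et).sq
  have : en w q ≤ 72 * J e (fun q => (∑ j, ∑ k, (dd (ex j) (dd (ex k) w) q ^ 2 + dd (ex j) (dd (ex k) (dd e (dd e w))) q ^ 2)) +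
      (dd et w q ^ 2 + dd et (dd e (dd e w)) q ^ 2)) q := by
    rw [J_add (Sm.sum _ fun j => Sm.sum _ fun k => s1 _ _) s2, J_sum _ (fun j => Sm.sum _ fun k => s1 _ _)]
    have e1 : ∀ j, J e (fun q => ∑ k, (dd (ex j) (dd (ex k) w) q ^ 2 + dd (ex j) (dd (ex k) (dd e (dd e w))) q ^ 2)) q =
      ∑ k, J e (fun q => (dd (ex j) (dd (ex k) w) q ^ 2 + dd (ex j) (dd (ex k) (dd e (dd e w))) q ^ 2)) q := fun j =>
      J_sum _ (fun k => s1 _ _) e q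
    simp only [e1]
    rw [mul_add, Finset.mul_sum]
    unfold en H2
    refine add_le_add (Finset.sum_le_sum fun j _ => ?_) h2
    rw [Finset.mul_sum]
    exact Finset.sum_le_sum fun k _ => h1 _ _
  refine this.trans ?_
  refine mul_le_mul_of_nonneg_left (J_mono ((Sm.sum _ fun j => Sm.sum _ fun k => s1 _ _).add s2) (hw.T 1) (fun q => ?_) e q) (by norm_num)
  refine le_trans (le_of_eq ?_) (T_op 0 w (some (i, i)) q)
  simp only [T, en, H2, opw, Finset.sum_add_distrib]
  ring

lemma T_step {n : ℕ} (i : Fin n) (m : ℕ) : ∀ {w : X (n + 1) → ℝ}, Sm w → ∀ q,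
    T m w q ≤ 72 * J (ex i.succ) (T (m + 1) w) q := by
  induction m with
  | zero => intro w hw q; exact en_step hw i q
  | succ m ih =>
    intro w hw q
    have : T (m + 1 + 1) w = fun q => T (m + 1) w q + ∑ o, T (m + 1) (opw o w) q := rfl
    rw [this, J_add (hw.T _) (Sm.sum _ fun o => (hw.opw o).T _), J_sum _ (fun o => (hw.opw o).T _), mul_add, Finset.mul_sum]
    exact add_le_add (ih hw q) (Finset.sum_le_sum fun o _ => ih (hw.opw o) q)

end KK
end

section
open MeasureTheory Set Filter Topology
open scoped ENNReal
namespace KK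

lemma ex_norm {m : ℕ} (i : Fin m) : ‖(ex i : X m)‖ ≤ 1 := by
  simp [ex, Prod.norm_def, Pi.norm_single]

lemma et_norm {m : ℕ} : ‖(et : X m)‖ ≤ 1 := by
  simp [et, Prod.norm_def]

lemma shift_ball {m : ℕ} {e q : X m} (he : ‖e‖ ≤ 1) {ρ s : ℝ} (hq : q ∈ Metric.ball 0 ρ) (hs : s ∈ Icc (0:ℝ) 1) :
    q + s • e ∈ Metric.ball 0 (ρ + 1) := by
  rw [mem_ball_zero_iff] at *
  have : ‖s • e‖ ≤ 1 := by
    rw [norm_smul, Real.norm_of_nonneg hs.1]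
    exact mul_le_one₀ hs.2 (norm_nonneg _) he
  linarith [norm_add_le q (s • e)]

lemma add_ex {m : ℕ} (t : ℝ) (x : Fin m → ℝ) (i : Fin m) (s : ℝ) :
    ((t, x) : X m) + s • ex i = (t, Function.update x i (x i + s)) := by
  ext j
  · simp [ex]
  · by_cases h : j = i
    · subst h; simp [ex]
    · simp [ex, h]

/-- localized version -/
noncomputable def loc {m : ℕ} (ρ : ℝ) (F : X m → ℝ) (q : X m) : ℝ≥0∞ :=
  indicator (Metric.ball 0 ρ) (fun q => ENNReal.ofReal (F q)) q

lemma loc_meas {m : ℕ} {F : X m → ℝ} (hF : Sm F) (ρ : ℝ) : Measurable (loc ρ F) :=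
  (hF.cont.measurable.ennreal_ofReal).indicator Metric.isOpen_ball.measurableSet

lemma loc_le {m : ℕ} {F : X m → ℝ} (ρ : ℝ) (q) : loc ρ F q ≤ ENNReal.ofReal (F q) := indicator_le_self _ _ _

lemma loc_eq {m : ℕ} {F : X m → ℝ} {ρ : ℝ} {q} (h : q ∈ Metric.ball 0 ρ) : loc ρ F q = ENNReal.ofReal (F q) :=
  indicator_of_mem h _

lemma J_loc {m : ℕ} {F : X m → ℝ} (hF : Sm F) (h0 : ∀ q, 0 ≤ F q) {e q : X m} (he : ‖e‖ ≤ 1) {ρ : ℝ} (hq : q ∈ Metric.ball 0 ρ) :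
    ENNReal.ofReal (J e F q) = ∫⁻ s in Icc (0:ℝ) 1, loc (ρ + 1) F (q + s • e) := by
  unfold J
  rw [ofReal_integral_eq_lintegral_ofReal (J_int hF e q) (Eventually.of_forall fun s => h0 _)]
  refine setLIntegral_congr_fun measurableSet_Icc fun s hs => ?_
  exact (loc_eq (shift_ball he hq hs)).symm

lemma of72 {a b : ℝ} (h : a ≤ 72 * b) : ENNReal.ofReal a ≤ 72 * ENNReal.ofReal b := by
  refine (ENNReal.ofReal_le_ofReal h).trans (le_of_eq ?_)
  rw [ENNReal.ofReal_mul (by norm_num)]; norm_num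

lemma line_le {m : ℕ} {F : X m → ℝ≥0∞} (t : ℝ) (x : Fin m → ℝ) (i : Fin m) :
    ∫⁻ s in Icc (0:ℝ) 1, F ((t, x) + s • ex i) ≤ ∫⁻ ξ : ℝ, F (t, Function.update x i ξ) := by
  refine (setLIntegral_le_lintegral _ _).trans ?_
  simp_rw [add_ex]
  rw [lintegral_add_left_eq_self (fun ξ => F (t, Function.update x i ξ)) (x i)]

lemma loc_step {n : ℕ} {w : X (n + 1) → ℝ} (hw : Sm w) (i : Fin n) (m : ℕ) (ρ : ℝ) (t : ℝ) (x : Fin (n + 1) → ℝ) :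
    loc ρ (T m w) (t, x) ≤ 72 * ∫⁻ ξ : ℝ, loc (ρ + 1) (T (m + 1) w) (t, Function.update x i.succ ξ) := by
  by_cases hq : ((t, x) : X (n + 1)) ∈ Metric.ball 0 ρ
  · rw [loc_eq hq]
    refine (of72 (T_step i m hw (t, x))).trans ?_
    rw [J_loc (hw.T _) (T_nonneg _ _) (ex_norm _) hq]
    exact mul_le_mul_right (line_le t x i.succ) _
  · simp [loc, hq]

lemma marg {n : ℕ} {w : X (n + 1) → ℝ} (hw : Sm w) (t : ℝ) (s : Finset (Fin (n + 1))) : 0 ∉ s → ∀ (m : ℕ) (ρ : ℝ) (x : Fin (n + 1) → ℝ),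
    loc ρ (T m w) (t, x) ≤ 72 ^ s.card * lmarginal (fun _ => (volume : Measure ℝ)) s
      (fun x => loc (ρ + s.card) (T (m + s.card) w) (t, x)) x := by
  classical
  induction s using Finset.induction with
  | empty => intro _ m ρ x; simp
  | insert i s hi ih =>
    intro h0 m ρ x
    have hs0 : 0 ∉ s := fun h => h0 (Finset.mem_insert_of_mem h)
    obtain ⟨j, rfl⟩ := Fin.exists_succ_eq.2 (fun h : i = 0 => h0 (by rw [h]; exact Finset.mem_insert_self _ _))
    have hm : Measurable fun x => loc (ρ + (insert j.succ s).card) (T (m + (insert j.succ s).card) w) (t, x) :=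
      (loc_meas (hw.T _) _).comp measurable_prodMk_left
    rw [lmarginal_insert _ hm hi, Finset.card_insert_of_notMem hi]
    refine (loc_step hw j m ρ t x).trans ?_
    rw [pow_succ', mul_assoc]
    refine mul_le_mul_right ?_ _
    rw [← lintegral_const_mul' _ _ (by simp)]
    refine lintegral_mono fun ξ => ?_
    refine (ih hs0 (m + 1) (ρ + 1) _).trans (le_of_eq ?_)
    push_cast
    rw [show ρ + 1 + (s.card : ℝ) = ρ + (s.card + 1) by ring, show m + 1 + s.card = m + (s.card + 1) by ring]

/-- marginal in the tangential variables -/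
noncomputable def Bm {n : ℕ} (m : ℕ) (ρ : ℝ) (w : X (n + 1) → ℝ) (q : X (n + 1)) : ℝ≥0∞ :=
  lmarginal (fun _ => (volume : Measure ℝ)) (Finset.univ.erase 0) (fun x => loc (ρ + n) (T (m + n) w) (q.1, x)) q.2

lemma Bm_bound {n : ℕ} {w : X (n + 1) → ℝ} (hw : Sm w) (m : ℕ) (ρ : ℝ) (q) : loc ρ (T m w) q ≤ 72 ^ n * Bm m ρ w q := by
  have := marg hw q.1 (Finset.univ.erase 0) (by simp) m ρ q.2
  simpa [Bm, Finset.card_erase_of_mem] using this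

lemma Bm_int {n : ℕ} {w : X (n + 1) → ℝ} (hw : Sm w) (m : ℕ) (ρ : ℝ) (t : ℝ) (x : Fin (n + 1) → ℝ) :
    ∫⁻ ξ, Bm m ρ w (t, Function.update x 0 ξ) = ∫⁻ x, loc (ρ + n) (T (m + n) w) (t, x) := by
  have hm : Measurable fun x => loc (ρ + n) (T (m + n) w) (t, x) :=
    (loc_meas (hw.T _) _).comp measurable_prodMk_left
  unfold Bm
  have := lmarginal_erase (μ := fun _ => (volume : Measure ℝ)) _ hm (Finset.mem_univ (0 : Fin (n + 1))) x
  simp only [lmarginal_univ] at this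
  rw [← this]
  rfl

lemma Bm_tan {n : ℕ} {w : X (n + 1) → ℝ} (m : ℕ) (ρ : ℝ) (q : X (n + 1)) (i : Fin n) (s : ℝ) :
    Bm m ρ w (q + s • ex i.succ) = Bm m ρ w q := by
  obtain ⟨t, x⟩ := q
  rw [add_ex]
  unfold Bm
  exact lmarginal_update_of_mem _ (by simp) _ _ _

/-- slab bound -/
noncomputable def slab {n : ℕ} (ρ : ℝ) (w : X (n + 1) → ℝ) (t : ℝ) : ℝ≥0∞ :=
  72 * (73 * 72 ^ n) * ∫⁻ x, loc (ρ + 2 + n) (T (1 + n) w) (t, x)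

lemma slab_core {n : ℕ} {w F G : X (n + 1) → ℝ} (hw : Sm w) (hG : Sm G) (hG0 : ∀ q, 0 ≤ G q)
    (h1 : ∀ q, F q ≤ 72 * J (ex 0) G q) {ρ : ℝ}
    (h2 : ∀ q ∈ Metric.ball 0 (ρ + 1), ENNReal.ofReal (G q) ≤ 73 * 72 ^ n * Bm 1 (ρ + 2) w q) :
    ∀ q ∈ Metric.ball 0 ρ, ENNReal.ofReal (F q) ≤ slab ρ w q.1 := by
  intro q hq
  refine (of72 (h1 q)).trans ?_
  rw [J_loc hG hG0 (ex_norm _) hq]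
  unfold slab
  rw [mul_assoc]
  refine mul_le_mul_right ?_ _
  have h3 : ∀ q, loc (ρ + 1) G q ≤ 73 * 72 ^ n * Bm 1 (ρ + 2) w q := by
    intro q
    by_cases hq : q ∈ Metric.ball 0 (ρ + 1)
    · rw [loc_eq hq]; exact h2 q hq
    · simp [loc, hq]
  refine (lintegral_mono fun s => h3 _).trans ?_
  obtain ⟨t, x⟩ := q
  refine (line_le (F := fun q => 73 * 72 ^ n * Bm 1 (ρ + 2) w q) t x 0).trans ?_
  rw [lintegral_const_mul' _ _ (by finiteness), Bm_int hw]

lemma T1_B {n : ℕ} {w : X (n + 1) → ℝ} (hw : Sm w) {ρ : ℝ} {q} (hq : q ∈ Metric.ball 0 (ρ + 1)) :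
    ENNReal.ofReal (T 1 w q) ≤ 72 ^ n * Bm 1 (ρ + 2) w q := by
  rw [← loc_eq (F := T 1 w) (Metric.ball_subset_ball (by linarith : ρ + 1 ≤ ρ + 2) hq)]
  exact Bm_bound hw _ _ _

/-- operators with slab bounds -/
structure Good {n : ℕ} (Θ : (X (n + 1) → ℝ) → X (n + 1) → ℝ) : Prop where
  sm : ∀ {w}, Sm w → Sm (Θ w)
  comm : ∀ {w}, Sm w → dd et (Θ w) = Θ (dd et w)
  slab : ∀ {w}, Sm w → ∀ ρ, ∀ q ∈ Metric.ball 0 ρ, ENNReal.ofReal (Θ w q ^ 2) ≤ slab ρ w q.1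

lemma slab_op {n : ℕ} {w : X (n + 1) → ℝ} (hw : Sm w) (o : Op n) (h : ∀ q, opw o w q ^ 2 ≤ en w q)
    (hc : dd (ex 0) (dd (ex 0) (opw o w)) = opw o (dd (ex 0) (dd (ex 0) w))) (h' : ∀ q, opw o (dd (ex 0) (dd (ex 0) w)) q ^ 2 ≤ en (opw o w) q) (ρ : ℝ) :
    ∀ q ∈ Metric.ball 0 ρ, ENNReal.ofReal (opw o w q ^ 2) ≤ slab ρ w q.1 := by
  refine slab_core hw (hw.T 1) (T_nonneg _ _) (fun q => ?_) (fun q hq => ?_)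
  · refine (sob2 (hw.opw o) (ex 0) q).trans ?_
    refine mul_le_mul_of_nonneg_left ?_ (by norm_num)
    refine J_mono ((hw.opw o).sq.add (((hw.opw o).dd _).dd _).sq) (hw.T 1) (fun q => ?_) _ q
    refine le_trans ?_ (T_op 0 w o q)
    rw [hc]
    exact add_le_add (h q) (h' q)
  · refine (T1_B hw hq).trans ?_
    rw [mul_assoc]
    refine le_mul_of_one_le_left (zero_le) (by norm_num)

lemma en_dd {m : ℕ} (w : X m → ℝ) (j k : Fin m) (q) : dd (ex j) (dd (ex k) w) q ^ 2 ≤ en w q :=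
  (entry_le_H2 w q j k).trans (le_add_of_nonneg_right (sq_nonneg _))

lemma good_op {n : ℕ} (o : Op n) : Good (opw o) := by
  refine ⟨fun hw => hw.opw o, fun {w} hw => ?_, fun {w} hw ρ => slab_op hw o ?_ ?_ ?_ ρ⟩
  · rcases o with _ | ⟨i, j⟩
    · rfl
    · simp only [opw]
      rw [dd_comm (hw.dd _).1, dd_comm hw.1]
  · rcases o with _ | ⟨i, j⟩
    · exact fun q => le_add_of_nonneg_left (H2_nonneg _ _)
    · exact en_dd w _ _
  · rcases o with _ | ⟨i, j⟩
    · simp only [opw]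
      rw [dd_comm hw.1, dd_comm (hw.dd _).1]
    · exact dd_comm22 hw _ _ _ _
  · rcases o with _ | ⟨i, j⟩
    · simp only [opw]
      rw [dd_comm (hw.dd _).1, dd_comm hw.1]
      exact en_dd _ _ _
    · simp only [opw]
      rw [dd_comm22 hw]
      exact en_dd _ _ _

lemma good_mix {n : ℕ} (i : Fin n) : Good (n := n) (fun w => dd (ex 0) (dd (ex i.succ) w)) := by
  refine ⟨fun hw => (hw.dd _).dd _, fun {w} hw => ?_, fun {w} hw ρ => ?_⟩
  · rw [dd_comm (hw.dd _).1, dd_comm hw.1]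
  set e : X (n + 1) := ex i.succ
  set g := dd (ex 0) (dd e w)
  have hg : Sm g := (hw.dd _).dd _
  set z := dd (ex 0) (dd (ex 0) w)
  have hz : Sm z := (hw.dd _).dd _
  have hgz : dd (ex 0) g = dd e z := by
    simp only [g, z]
    rw [dd_comm hw.1 _ e, dd_comm (hw.dd _).1 _ e]
  refine slab_core hw (hg.sq.add (hg.dd (ex 0)).sq) (fun q => by positivity) (fun q => sob1 hg (ex 0) q) (fun q hq => ?_)
  rw [hgz]
  have a1 : ENNReal.ofReal (g q ^ 2) ≤ 72 ^ n * Bm 1 (ρ + 2) w q := by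
    refine le_trans (ENNReal.ofReal_le_ofReal ?_) (T1_B hw hq)
    refine (en_dd w 0 i.succ q).trans ?_
    exact (le_add_of_nonneg_right (T_nonneg 0 _ _)).trans (T_op 0 w none q)
  have a2 : ENNReal.ofReal (dd e z q ^ 2) ≤ 72 * (72 ^ n * Bm 1 (ρ + 2) w q) := by
    have := sob3 hz e q
    have hJ : dd e z q ^ 2 ≤ 72 * J e (T 1 w) q := by
      refine this.trans (mul_le_mul_of_nonneg_left ?_ (by norm_num))
      refine J_mono (hz.sq.add ((hz.dd e).dd e).sq) (hw.T 1) (fun q => ?_) e q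
      refine le_trans ?_ (T_op 0 w (some (i, i)) q)
      refine add_le_add (en_dd _ _ _ _) ?_
      simp only [z]
      rw [dd_comm22 hw]
      exact en_dd _ _ _ _
    refine (of72 hJ).trans ?_
    rw [J_loc (hw.T 1) (T_nonneg _ _) (ex_norm _) hq]
    refine mul_le_mul_right ?_ _
    have : ∀ s : ℝ, loc (ρ + 1 + 1) (T 1 w) (q + s • e) ≤ 72 ^ n * Bm 1 (ρ + 2) w q := by
      intro s
      rw [← Bm_tan 1 (ρ + 2) q i s, show ρ + 1 + 1 = ρ + 2 by ring]
      exact Bm_bound hw _ _ _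
    refine (lintegral_mono fun s => this s).trans ?_
    simp
  rw [ENNReal.ofReal_add (sq_nonneg _) (sq_nonneg _)]
  refine (add_le_add a1 a2).trans (le_of_eq ?_)
  ring

lemma Good.sup {n : ℕ} {Θ : (X (n + 1) → ℝ) → X (n + 1) → ℝ} (hΘ : Good Θ) {w} (hw : Sm w) (ρ : ℝ) {q} (hq : q ∈ Metric.ball 0 ρ) :
    Θ w q ^ 2 ≤ 72 * (72 * (73 * 72 ^ n)) * ∫ q in Metric.ball 0 (ρ + 3 + n), T (2 + n) w q := by
  have h0 : 0 ≤ ∫ q in Metric.ball 0 (ρ + 3 + n), T (2 + n) w q := integral_nonneg fun _ => T_nonneg _ _ _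
  rw [← ENNReal.ofReal_le_ofReal_iff (by positivity)]
  have hg := hΘ.sm hw
  refine (of72 (sob1 hg et q)).trans ?_
  have hgs := hg.sq.add (hg.dd et).sq
  have := J_loc hgs (fun q => by positivity) et_norm hq
  unfold J at this
  rw [this]
  rw [mul_assoc, ENNReal.ofReal_mul (by norm_num), ENNReal.ofReal_mul (by positivity)]
  have e1 : ENNReal.ofReal 72 = 72 := by norm_num
  have e2 : ENNReal.ofReal (72 * (73 * 72 ^ n)) = 72 * (73 * 72 ^ n) := by
    rw [ENNReal.ofReal_mul (by norm_num), ENNReal.ofReal_mul (by norm_num), ENNReal.ofReal_pow (by norm_num)]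
    norm_num
  rw [e1, e2]
  refine mul_le_mul_right ?_ _
  have h3 : ∀ q, loc (ρ + 1) (fun q => Θ w q ^ 2 + dd et (Θ w) q ^ 2) q ≤
      72 * (73 * 72 ^ n) * ∫⁻ x, loc (ρ + 3 + n) (T (2 + n) w) (q.1, x) := by
    intro q
    by_cases hq : q ∈ Metric.ball 0 (ρ + 1)
    · rw [loc_eq hq, ENNReal.ofReal_add (sq_nonneg _) (sq_nonneg _), hΘ.comm hw]
      refine (add_le_add (hΘ.slab hw _ q hq) (hΘ.slab (hw.dd et) _ q hq)).trans ?_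
      unfold KK.slab
      rw [← mul_add, ← lintegral_add_left (by exact (loc_meas (hw.T _) _).comp measurable_prodMk_left)]
      refine mul_le_mul_right (lintegral_mono fun x => ?_) _
      simp only
      rw [show ρ + 1 + 2 + (n : ℝ) = ρ + 3 + n by ring]
      by_cases hx : ((q.1, x) : X (n + 1)) ∈ Metric.ball 0 (ρ + 3 + n)
      · rw [loc_eq hx, loc_eq hx, loc_eq hx, ← ENNReal.ofReal_add (T_nonneg _ _ _) (T_nonneg _ _ _)]
        refine ENNReal.ofReal_le_ofReal ?_
        rw [show 2 + n = 1 + n + 1 by ring]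
        exact T_op (1 + n) w none _
      · simp [loc, hx]
    · simp [loc, hq]
  refine (lintegral_mono fun s => h3 _).trans ?_
  refine (setLIntegral_le_lintegral _ _).trans ?_
  have e3 : ∀ s : ℝ, (q + s • (et : X (n + 1))).1 = q.1 + s := by intro s; simp [et]
  simp only [e3]
  rw [lintegral_add_left_eq_self (fun t => 72 * (73 * 72 ^ n) * ∫⁻ x, loc (ρ + 3 + n) (T (2 + n) w) (t, x)) q.1]
  rw [lintegral_const_mul' _ _ (by finiteness)]
  refine mul_le_mul_right (le_of_eq ?_) _
  rw [ofReal_integral_eq_lintegral_ofReal (hw.T _).integrable.integrableOn (Eventually.of_forall fun _ => T_nonneg _ _ _)]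
  have hm := (loc_meas (hw.T (2 + n)) (ρ + 3 + n))
  have := lintegral_prod (μ := (volume : Measure ℝ)) (ν := (volume : Measure (Fin (n + 1) → ℝ))) _ hm.aemeasurable
  rw [← this]
  unfold loc
  rw [← Measure.volume_eq_prod, lintegral_indicator Metric.isOpen_ball.measurableSet]

end KK
end

section
open MeasureTheory Set Filter Topology
namespace KK

lemma Lb_bm {n : ℕ} {δ : ℝ} (hδ : 0 < δ) {A} (hA : Ell n δ A) {u : X (n + 1) → ℝ} (hu : Sm u) : BM (Lb A u) := by
  refine ⟨Lb_meas hA hu, ?_⟩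
  obtain ⟨K1, h1⟩ := (hu.dd et).bdd
  obtain ⟨K2, -, h2⟩ := Sm.bdd_fin (f := fun (i : Fin (n+1) × Fin (n+1)) => dd (ex i.1) (dd (ex i.2) u))
    (fun i => (hu.dd _).dd _)
  exact ⟨_, fun q => Lb_abs_le hδ hA u q (K := max K1 K2) ((h1 q).trans (le_max_left _ _))
    fun j k => (h2 (j, k) q).trans (le_max_right _ _)⟩

lemma int_en {m : ℕ} {u : X m → ℝ} (hu : Sm u) (s : Set (X m)) : ∫ q in s, en u q =
    (∑ j, ∑ k, ∫ q in s, dd (ex j) (dd (ex k) u) q ^ 2) + ∫ q in s, dd et u q ^ 2 := by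
  have h : ∀ j k, Integrable (fun q => dd (ex j) (dd (ex k) u) q ^ 2) (volume.restrict s) :=
    fun j k => (((hu.dd _).dd _).sq.integrable (μ := volume)).integrableOn
  unfold en H2
  rw [integral_add (integrable_finsetSum _ fun j _ => integrable_finsetSum _ fun k _ => h j k)
    (((hu.dd _).sq.integrable (μ := volume)).integrableOn), integral_finsetSum _ (fun j _ => integrable_finsetSum _ fun k _ => h j k)]
  congr 1
  refine Finset.sum_congr rfl fun j _ => ?_
  rw [integral_finsetSum _ (fun k _ => h j k)]

lemma en_cv_L2 {n : ℕ} {k : X n → ℝ} (hk : Sm k) (hk1 : ∀ y, k y ≠ 0 → ‖y‖ ≤ 1) {u : X (n + 1) → ℝ}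
    (hu : Sm u) (ρ : ℝ) : ∫ q in Metric.ball 0 ρ, en (cv k u) q ≤
      (∫ y, |k y|) ^ 2 * ∫ q in Metric.ball 0 (ρ + 1), en u q := by
  rw [int_en hu, int_en (cv_sm hk hu), mul_add, Finset.mul_sum]
  refine add_le_add (Finset.sum_le_sum fun i _ => ?_) ?_
  · rw [Finset.mul_sum]
    refine Finset.sum_le_sum fun j _ => ?_
    rw [dd_cv hk hu, dd_cv hk (hu.dd _)]
    exact cv_L2 hk hk1 ((hu.dd _).dd _).bm ρ
  · rw [dd_cv hk hu]
    exact cv_L2 hk hk1 (hu.dd _).bm ρ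

lemma opw_sq_le {n : ℕ} (o : Op n) (w : X (n + 1) → ℝ) (q) : opw o w q ^ 2 ≤ en w q := by
  rcases o with _ | ⟨i, j⟩
  · simp only [opw, en]; linarith [H2_nonneg w q]
  · exact en_dd w _ _ q

lemma chain (n : ℕ) {δ : ℝ} (hδ : 0 < δ) (m : ℕ) : ∀ ρ : ℝ, 0 < ρ → ∃ C1 : ℝ, 0 < C1 ∧ ∀ k : X n → ℝ, Sm k →
    (∀ y, k y ≠ 0 → ‖y‖ ≤ 1) → ∃ C2 : ℝ, 0 ≤ C2 ∧ ∀ A, Ell n δ A → ∀ u : X (n + 1) → ℝ, Sm u →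
    ∫ q in Metric.ball 0 ρ, T m (cv k u) q ≤ C1 * (∫ q in Metric.ball 0 (ρ + m), en (cv k u) q) +
      C2 * ∫ q in Metric.ball 0 (ρ + m + 2), (Lb A u q) ^ 2 := by
  induction m with
  | zero =>
    intro ρ hρ
    refine ⟨1, one_pos, fun k hk hk1 => ⟨0, le_rfl, fun A hA u hu => ?_⟩⟩
    simp [T]
  | succ m ih =>
    intro ρ hρ
    obtain ⟨C1, hC1, h⟩ := ih ρ hρ
    obtain ⟨Ci, hCi, hi⟩ := interior n hδ (ρ := ρ + m) (by positivity)
    refine ⟨C1 + Fintype.card (Op n) * (C1 * Ci), by positivity, fun k hk hk1 => ?_⟩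
    obtain ⟨C2, hC2, h2⟩ := h k hk hk1
    choose D hD hD2 using fun o => h (opk o k) (hk.opk o) (opk_supp hk1 o)
    refine ⟨C2 + ∑ o, (C1 * Ci * (∫ y, |opk o k y|) ^ 2 + D o), ?_, fun A hA u hu => ?_⟩
    · have : 0 ≤ ∑ o, (C1 * Ci * (∫ y, |opk o k y|) ^ 2 + D o) :=
        Finset.sum_nonneg fun o _ => add_nonneg (by positivity) (hD o)
      linarith
    have hv := cv_sm hk hu
    have hLi := Lb_sq_int hδ hA hu
    set E' := ∫ q in Metric.ball 0 (ρ + ((m + 1 : ℕ) : ℝ)), en (cv k u) q with hE'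
    set F' := ∫ q in Metric.ball 0 (ρ + ((m + 1 : ℕ) : ℝ) + 2), (Lb A u q) ^ 2 with hF'
    have hF0 : ∫ q in Metric.ball 0 (ρ + m + 2), (Lb A u q) ^ 2 ≤ F' :=
      ball_mono_int hLi (fun q => sq_nonneg _) (by push_cast; linarith)
    have hE0 : ∫ q in Metric.ball 0 (ρ + m), en (cv k u) q ≤ E' :=
      ball_mono_int hv.en.integrable (fun q => en_nonneg _ _) (by push_cast; linarith)
    have ho : ∀ o, ∫ q in Metric.ball 0 ρ, T m (opw o (cv k u)) q ≤ C1 * Ci * E' + (C1 * Ci * (∫ y, |opk o k y|) ^ 2 + D o) * F' := by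
      intro o
      rw [opw_cv hk hu]
      have a1 := hD2 o A hA u hu
      have a2 := hi A hA (cv (opk o k) u) (cv_sm (hk.opk o) hu)
      have a3 : ∫ q in Metric.ball 0 (ρ + m + 1), (Lb A (cv (opk o k) u) q) ^ 2 ≤ (∫ y, |opk o k y|) ^ 2 * F' := by
        rw [Lb_cv A (hk.opk o) hu]
        have := cv_L2 (hk.opk o) (opk_supp hk1 o) (Lb_bm hδ hA hu) (ρ + m + 1)
        rw [show ρ + m + 1 + 1 = ρ + m + 2 by ring] at this
        refine this.trans ?_
        gcongr
      have a4 : ∫ q in Metric.ball 0 (ρ + m + 1), (cv (opk o k) u q) ^ 2 ≤ E' := by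
        rw [← opw_cv hk hu, hE', show ρ + ((m + 1 : ℕ) : ℝ) = ρ + m + 1 by push_cast; ring]
        exact integral_mono (hv.opw o).sq.integrable.integrableOn hv.en.integrable.integrableOn
          (fun q => opw_sq_le o _ q)
      have a5 : D o * ∫ q in Metric.ball 0 (ρ + m + 2), (Lb A u q) ^ 2 ≤ D o * F' := mul_le_mul_of_nonneg_left hF0 (hD o)
      have a6 := mul_le_mul_of_nonneg_left (a2.trans (mul_le_mul_of_nonneg_left (add_le_add a3 a4) hCi.le)) hC1.le
      calc _ ≤ _ := a1
        _ ≤ _ := add_le_add a6 a5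
        _ = _ := by ring
    have b1 := h2 A hA u hu
    have b2 : ∫ q in Metric.ball 0 ρ, T (m + 1) (cv k u) q = (∫ q in Metric.ball 0 ρ, T m (cv k u) q) +
        ∑ o, ∫ q in Metric.ball 0 ρ, T m (opw o (cv k u)) q := by
      simp only [T]
      rw [integral_add (hv.T m).integrable.integrableOn (integrable_finsetSum _ fun o _ => ((hv.opw o).T m).integrable.integrableOn),
        integral_finsetSum _ (fun o _ => ((hv.opw o).T m).integrable.integrableOn)]
    rw [b2]
    have b3 := Finset.sum_le_sum (s := Finset.univ) (fun o _ => ho o)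
    rw [Finset.sum_add_distrib] at b3
    simp only [Finset.sum_const, nsmul_eq_mul, Finset.card_univ] at b3
    have b4 : C1 * (∫ q in Metric.ball 0 (ρ + m), en (cv k u) q) ≤ C1 * E' := mul_le_mul_of_nonneg_left hE0 hC1.le
    have b5 : C2 * (∫ q in Metric.ball 0 (ρ + m + 2), (Lb A u q) ^ 2) ≤ C2 * F' := mul_le_mul_of_nonneg_left hF0 hC2
    rw [add_mul, add_mul, Finset.sum_mul]
    linarith

lemma mat_bound {n : ℕ} {δ : ℝ} (hδ : 0 < δ) {M : Fin (n+1) → Fin (n+1) → ℝ} (hM : EM δ M) (x : Fin (n+1) → Fin (n+1) → ℝ)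
    {t L G : ℝ} (hG : ∀ j k, ¬ (j = 0 ∧ k = 0) → x j k ^ 2 ≤ G) (ht : t ^ 2 ≤ G) (hL : L = t + ∑ j, ∑ k, M j k * x j k) :
    ∑ j, ∑ k, x j k ^ 2 ≤ ((n:ℝ) + 1) ^ 2 * (1 + 3 * δ⁻¹ ^ 2 * (1 + (((n:ℝ) + 1) ^ 2) ^ 2 * δ⁻¹ ^ 2)) * (G + L ^ 2) := by
  have hG0 : 0 ≤ G := (sq_nonneg t).trans ht
  set P := ((n:ℝ) + 1) ^ 2 with hP
  set y : Fin (n+1) → Fin (n+1) → ℝ := fun j k => if j = 0 ∧ k = 0 then 0 else M j k * x j k with hy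
  have e1 : ∑ j, ∑ k, M j k * x j k = M 0 0 * x 0 0 + ∑ j, ∑ k, y j k := by
    have : ∀ j k, M j k * x j k = (if j = 0 then (if k = 0 then M 0 0 * x 0 0 else 0) else 0) + y j k := by
      intro j k
      simp only [hy]
      by_cases h1 : j = 0 <;> by_cases h2 : k = 0 <;> simp [h1, h2]
    rw [Finset.sum_congr rfl fun j _ => Finset.sum_congr rfl fun k _ => this j k]
    simp_rw [Finset.sum_add_distrib]
    have e0 : ∀ j : Fin (n+1), (∑ k : Fin (n+1), if j = 0 then (if k = 0 then M 0 0 * x 0 0 else 0) else 0) = if j = 0 then M 0 0 * x 0 0 else 0 := by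
      intro j; split_ifs <;> simp
    simp_rw [e0]
    simp
  have hb : ∀ j k, y j k ^ 2 ≤ δ⁻¹ ^ 2 * G := by
    intro j k
    simp only [hy]
    split_ifs with h
    · simp; positivity
    · rw [mul_pow, ← sq_abs (M j k)]
      have := hM.bound hδ j k
      have := hG j k h
      gcongr
  have hs := sq_sum2_le y
  have hs2 : ∑ j, ∑ k, y j k ^ 2 ≤ P * (δ⁻¹ ^ 2 * G) := by
    refine (Finset.sum_le_sum fun j _ => Finset.sum_le_sum fun k _ => hb j k).trans (le_of_eq ?_)
    simp [hP]; ring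
  have hs3 : (∑ j, ∑ k, y j k) ^ 2 ≤ P ^ 2 * δ⁻¹ ^ 2 * G := by
    refine hs.trans ?_
    push_cast
    rw [← hP]
    calc _ ≤ P * (P * (δ⁻¹ ^ 2 * G)) := by gcongr
      _ = _ := by ring
  have h00 : x 0 0 ^ 2 ≤ δ⁻¹ ^ 2 * (3 * L ^ 2 + 3 * G + 3 * (P ^ 2 * δ⁻¹ ^ 2 * G)) := by
    have h1 : M 0 0 * x 0 0 = L + (-t) + (- ∑ j, ∑ k, y j k) := by rw [hL, e1]; ring
    have h2 : (M 0 0 * x 0 0) ^ 2 ≤ 3 * L ^ 2 + 3 * G + 3 * (P ^ 2 * δ⁻¹ ^ 2 * G) := by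
      rw [h1]
      refine (sq3_le _ _ _).trans ?_
      rw [neg_sq, neg_sq]
      linarith
    have h3 := (hM.diag 0).1
    have h4 : δ ^ 2 * x 0 0 ^ 2 ≤ (M 0 0 * x 0 0) ^ 2 := by
      rw [mul_pow]; gcongr
    calc x 0 0 ^ 2 = δ⁻¹ ^ 2 * (δ ^ 2 * x 0 0 ^ 2) := by field_simp
      _ ≤ _ := by gcongr; exact h4.trans h2
  have hall : ∀ j k, x j k ^ 2 ≤ (1 + 3 * δ⁻¹ ^ 2 * (1 + P ^ 2 * δ⁻¹ ^ 2)) * (G + L ^ 2) := by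
    intro j k
    by_cases h : j = 0 ∧ k = 0
    · rw [h.1, h.2]
      refine h00.trans ?_
      have : 0 ≤ G + L ^ 2 + δ⁻¹ ^ 2 * (3 * (P ^ 2 * δ⁻¹ ^ 2 * L ^ 2)) := by positivity
      linarith
    · refine (hG j k h).trans ?_
      have : 0 ≤ L ^ 2 + 3 * δ⁻¹ ^ 2 * (1 + P ^ 2 * δ⁻¹ ^ 2) * (G + L ^ 2) := by positivity
      linarith
  refine (Finset.sum_le_sum fun j _ => Finset.sum_le_sum fun k _ => hall j k).trans (le_of_eq ?_)
  simp [hP]; ring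

lemma cv_sup (n : ℕ) {δ : ℝ} (hδ : 0 < δ) : ∃ C1 : ℝ, 0 < C1 ∧ ∀ (ε : ℝ) (k : X n → ℝ), ε ≤ 1 → Ker ε k →
    ∃ C2 : ℝ, 0 ≤ C2 ∧ ∀ A, Ell n δ A → ∀ u : X (n + 1) → ℝ, Sm u → ∀ q ∈ Metric.ball (0 : X (n+1)) 1,
    H2 (cv k u) q ≤ C1 * (∫ q in Metric.ball 0 (2 * n + 10), en u q) +
      C2 * (∫ q in Metric.ball 0 (2 * n + 10), (Lb A u q) ^ 2) + C1 * (cv k (Lb A u) q) ^ 2 := by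
  obtain ⟨C1, hC1, h⟩ := chain n hδ (2 + n) (1 + 3 + n) (by positivity)
  set P := ((n:ℝ) + 1) ^ 2 * (1 + 3 * δ⁻¹ ^ 2 * (1 + (((n:ℝ) + 1) ^ 2) ^ 2 * δ⁻¹ ^ 2)) with hP
  have hP0 : 0 < P := by positivity
  set Z : ℝ := 72*(72*(73*72^n)) with hZ
  have hZ0 : 0 < Z := by positivity
  refine ⟨P * (Z * C1) + P, by positivity, fun ε k hε hk => ?_⟩
  have hk1 : ∀ y, k y ≠ 0 → ‖y‖ ≤ 1 := fun y hy => (hk.supp y hy).trans hε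
  obtain ⟨C2, hC2, h2⟩ := h k hk.sm hk1
  refine ⟨P * (Z * C2), by positivity, fun A hA u hu q hq => ?_⟩
  have hv := cv_sm hk.sm hu
  set E := ∫ q in Metric.ball 0 (2 * n + 10), en u q with hE
  set F := ∫ q in Metric.ball 0 (2 * n + 10), (Lb A u q) ^ 2 with hF
  have hE0 : 0 ≤ E := integral_nonneg fun q => en_nonneg _ _
  have a1 : ∫ q in Metric.ball 0 (1 + 3 + n), T (2 + n) (cv k u) q ≤ C1 * E + C2 * F := by
    refine (h2 A hA u hu).trans (add_le_add ?_ ?_)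
    · refine mul_le_mul_of_nonneg_left ?_ hC1.le
      refine (en_cv_L2 hk.sm hk1 hu _).trans ?_
      rw [hk.abs_one]
      simp only [one_pow, one_mul]
      exact ball_mono_int hu.en.integrable (fun q => en_nonneg _ _) (by push_cast; linarith)
    · refine mul_le_mul_of_nonneg_left ?_ hC2
      exact ball_mono_int (Lb_sq_int hδ hA hu) (fun q => sq_nonneg _) (by push_cast; linarith)
  have a2 : ∀ {Θ : (X (n + 1) → ℝ) → X (n + 1) → ℝ}, Good Θ → Θ (cv k u) q ^ 2 ≤ Z * (C1 * E + C2 * F) := fun hΘ =>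
    (hΘ.sup hv 1 hq).trans (mul_le_mul_of_nonneg_left a1 hZ0.le)
  have a3 := mat_bound hδ (hA.em (q.2 0)) (fun j k' => dd (ex j) (dd (ex k') (cv k u)) q) (t := dd et (cv k u) q)
    (L := Lb A (cv k u) q) (G := Z * (C1 * E + C2 * F)) (fun j k' hjk => ?_) (a2 (good_op none)) rfl
  · rw [Lb_cv A hk.sm hu] at a3
    rw [← hP] at a3
    unfold H2
    refine a3.trans ?_
    have b1 : 0 ≤ P * E := by positivity
    have b2 : 0 ≤ P * (Z * C1) * cv k (Lb A u) q ^ 2 := by positivity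
    linarith
  · refine Fin.cases ?_ (fun i => ?_) j (motive := fun j => ¬ (j = 0 ∧ k' = 0) → dd (ex j) (dd (ex k') (cv k u)) q ^ 2 ≤ _) hjk
    · refine Fin.cases (fun h => absurd ⟨rfl, rfl⟩ h) (fun i _ => ?_) k'
      exact a2 (good_mix i)
    · intro _
      refine Fin.cases ?_ (fun i' => ?_) k'
      · rw [dd_comm hv.1]; exact a2 (good_mix i)
      · exact a2 (good_op (some (i, i')))

lemma H2_sub {m : ℕ} {u v : X m → ℝ} (hu : Sm u) (hv : Sm v) (q) : H2 u q ≤ 2 * H2 v q + 2 * H2 (fun q => u q - v q) q := by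
  unfold H2
  simp_rw [Finset.mul_sum]
  rw [← Finset.sum_add_distrib]
  refine Finset.sum_le_sum fun j _ => ?_
  rw [← Finset.sum_add_distrib]
  refine Finset.sum_le_sum fun k _ => ?_
  have h1 : dd (ex k) (fun q => u q - v q) = fun q => dd (ex k) u q - dd (ex k) v q := by
    exact dd_sub hu.diff hv.diff _
  rw [h1, dd_sub (hu.dd _).diff (hv.dd _).diff]
  nlinarith [sq_nonneg (2 * dd (ex j) (dd (ex k) v) q - dd (ex j) (dd (ex k) u) q)]

lemma V0 (n : ℕ) {δ : ℝ} (hδ : 0 < δ) : ∃ C0 : ℝ, 0 < C0 ∧ ∀ κ > 0, ∃ C2 : ℝ, 0 ≤ C2 ∧ ∀ A, Ell n δ A →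
    ∀ u : X (n + 1) → ℝ, Sm u → ∀ E F : ℝ, E = (∫ q in Metric.ball 0 (2 * n + 10), en u q) →
      F = (∫ q in Metric.ball 0 (2 * n + 10), (Lb A u q) ^ 2) →
    ∫ q in Metric.ball (0 : X (n+1)) 1 ∩ {q | C0 * E + C2 * F < H2 u q}, H2 u q ≤ κ * E + C2 * F := by
  obtain ⟨C1, hC1, h⟩ := cv_sup n hδ
  obtain ⟨Ci, hCi, hi⟩ := interior n hδ (ρ := 1) one_pos
  set P : ℝ := 6 + 3 * ((n : ℝ) + 1) ^ 2 with hP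
  have hP0 : 0 < P := by positivity
  refine ⟨4 * C1, by positivity, fun κ hκ => ?_⟩
  obtain ⟨ε, hε0, hε1, hε⟩ : ∃ ε : ℝ, 0 < ε ∧ ε ≤ 1 ∧ 4 * (Ci * (P * ε ^ 2)) ≤ κ := by
    refine ⟨min 1 (κ / (4 * Ci * P)), by positivity, min_le_left _ _, ?_⟩
    set ε := min 1 (κ / (4 * Ci * P))
    have e0 : 0 < ε := by positivity
    have e1 : ε ≤ 1 := min_le_left _ _
    have e2 : ε ≤ κ / (4 * Ci * P) := min_le_right _ _
    rw [le_div_iff₀ (by positivity)] at e2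
    have : ε ^ 2 ≤ ε := by nlinarith
    calc 4 * (Ci * (P * ε ^ 2)) ≤ 4 * (Ci * (P * ε)) := by gcongr
      _ ≤ κ := by linarith
  obtain ⟨k, hk⟩ := exists_ker n hε0
  have hk1 : ∀ y, k y ≠ 0 → ‖y‖ ≤ 1 := fun y hy => (hk.supp y hy).trans hε1
  obtain ⟨C2, hC2, h2⟩ := h ε k hε1 hk
  refine ⟨4 * C2 + 4 * C1 + 16 * Ci, by positivity, fun A hA u hu E F hE hF => ?_⟩
  have hE0 : 0 ≤ E := hE ▸ integral_nonneg fun q => en_nonneg _ _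
  have hF0 : 0 ≤ F := hF ▸ integral_nonneg fun q => sq_nonneg _
  have hL := Lb_bm hδ hA hu
  have hv := cv_sm hk.sm hu
  have hw := hu.sub hv
  set w : X (n+1) → ℝ := fun q => u q - cv k u q with hwd
  have hLv : BM (cv k (Lb A u)) := by rw [← Lb_cv A hk.sm hu]; exact Lb_bm hδ hA hv
  have hmono : ∀ {ρ : ℝ}, ρ ≤ 2 * n + 10 → ∫ q in Metric.ball 0 ρ, (Lb A u q) ^ 2 ≤ F := fun hρ =>
    hF ▸ ball_mono_int (Lb_sq_int hδ hA hu) (fun q => sq_nonneg _) hρ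
  have hnn : (0:ℝ) ≤ n := Nat.cast_nonneg n
  have hcvF : ∀ {ρ : ℝ}, ρ + 1 ≤ 2 * n + 10 → ∫ q in Metric.ball 0 ρ, (cv k (Lb A u) q) ^ 2 ≤ F := fun {ρ} hρ => by
    have := cv_L2 hk.sm hk1 hL ρ
    rw [hk.abs_one] at this
    simp only [one_pow, one_mul] at this
    exact this.trans (hmono hρ)
  have hwL : ∫ q in Metric.ball 0 (1 + 1), (Lb A w q) ^ 2 ≤ 4 * F := by
    have e : ∀ q, Lb A w q = Lb A u q - cv k (Lb A u) q := by
      intro q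
      rw [← Lb_cv A hk.sm hu]
      unfold Lb
      have h1 : ∀ j, dd (ex j) w = fun q => dd (ex j) u q - dd (ex j) (cv k u) q := fun j => by
        exact dd_sub hu.diff hv.diff _
      simp_rw [h1, dd_sub (hu.dd _).diff (hv.dd _).diff, mul_sub, Finset.sum_sub_distrib]
      rw [hwd, dd_sub hu.diff hv.diff]
      ring
    have i1 : IntegrableOn (fun q => 2 * Lb A u q ^ 2) (Metric.ball 0 (1 + 1)) := hL.sq_int.const_mul 2
    have i2 : IntegrableOn (fun q => 2 * cv k (Lb A u) q ^ 2) (Metric.ball 0 (1 + 1)) := hLv.sq_int.const_mul 2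
    have i12 : IntegrableOn (fun q => 2 * Lb A u q ^ 2 + 2 * cv k (Lb A u) q ^ 2) (Metric.ball 0 (1 + 1)) := i1.add i2
    have := integral_mono_of_nonneg (μ := volume.restrict (Metric.ball (0 : X (n+1)) (1 + 1))) (f := fun q => Lb A w q ^ 2) (g := fun q => 2 * Lb A u q ^ 2 + 2 * cv k (Lb A u) q ^ 2)
      (Eventually.of_forall fun q => sq_nonneg _) i12 (Eventually.of_forall fun q => by
        simp only [e]
        nlinarith [sq_nonneg (Lb A u q + cv k (Lb A u) q)])
    rw [integral_add i1 i2, integral_const_mul, integral_const_mul] at this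
    have b1 := hmono (ρ := 1 + 1) (by linarith)
    have b2 := hcvF (ρ := 1 + 1) (by linarith)
    linarith
  have hws : ∫ q in Metric.ball 0 (1 + 1), (w q) ^ 2 ≤ P * ε ^ 2 * E := by
    refine (small hu hε0.le hε1 hk (1 + 1)).trans ?_
    rw [← hP, hE]
    refine mul_le_mul_of_nonneg_left ?_ (by positivity)
    exact ball_mono_int hu.en.integrable (fun q => en_nonneg _ _) (by linarith)
  have hwH : ∫ q in Metric.ball 0 1, H2 w q ≤ Ci * (4 * F + P * ε ^ 2 * E) := by
    refine le_trans ?_ ((hi A hA w hw).trans (mul_le_mul_of_nonneg_left (add_le_add hwL hws) hCi.le))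
    exact integral_mono hw.H2.integrable.integrableOn hw.en.integrable.integrableOn
      (fun q => by simp only [en]; linarith [sq_nonneg (dd et w q)])
  have hpt : ∀ q ∈ Metric.ball (0 : X (n+1)) 1 ∩ {q | 4 * C1 * E + (4 * C2 + 4 * C1 + 16 * Ci) * F < H2 u q},
      H2 u q ≤ 4 * C1 * cv k (Lb A u) q ^ 2 + 4 * H2 w q := by
    rintro q ⟨hq1, hq2⟩
    have b1 := h2 A hA u hu q hq1
    rw [← hE, ← hF] at b1
    have b2 := H2_sub hu hv q
    have b3 : 4 * C1 * E + (4 * C2 + 4 * C1 + 16 * Ci) * F < H2 u q := hq2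
    have b4 : 0 ≤ (4 * C1 + 16 * Ci) * F := by positivity
    rw [← hwd] at b2
    linarith
  have hms : MeasurableSet (Metric.ball (0 : X (n+1)) 1 ∩ {q | 4 * C1 * E + (4 * C2 + 4 * C1 + 16 * Ci) * F < H2 u q}) :=
    Metric.isOpen_ball.measurableSet.inter (isOpen_lt continuous_const hu.H2.cont).measurableSet
  have i1 : IntegrableOn (fun q => 4 * C1 * cv k (Lb A u) q ^ 2) (Metric.ball 0 1) := hLv.sq_int.const_mul _
  have i2 : IntegrableOn (fun q => 4 * H2 w q) (Metric.ball 0 1) := (hw.H2.integrable.const_mul _).integrableOn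
  have i3 : IntegrableOn (fun q => 4 * C1 * cv k (Lb A u) q ^ 2 + 4 * H2 w q) (Metric.ball 0 1) := i1.add i2
  calc _ ≤ ∫ q in Metric.ball (0 : X (n+1)) 1 ∩ {q | 4 * C1 * E + (4 * C2 + 4 * C1 + 16 * Ci) * F < H2 u q}, (4 * C1 * cv k (Lb A u) q ^ 2 + 4 * H2 w q) :=
        setIntegral_mono_on hu.H2.integrable.integrableOn (i3.mono_set inter_subset_left) hms hpt
    _ ≤ ∫ q in Metric.ball (0 : X (n+1)) 1, (4 * C1 * cv k (Lb A u) q ^ 2 + 4 * H2 w q) :=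
        setIntegral_mono_set i3 (Eventually.of_forall fun q => by
          have := H2_nonneg w q
          have : 0 ≤ 4 * C1 * cv k (Lb A u) q ^ 2 := by positivity
          simp only [Pi.zero_apply]
          linarith) inter_subset_left.eventuallyLE
    _ = 4 * C1 * (∫ q in Metric.ball (0 : X (n+1)) 1, cv k (Lb A u) q ^ 2) + 4 * ∫ q in Metric.ball (0 : X (n+1)) 1, H2 w q := by
        rw [integral_add i1 i2, integral_const_mul, integral_const_mul]
    _ ≤ 4 * C1 * F + 4 * (Ci * (4 * F + P * ε ^ 2 * E)) := by
        gcongr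
        exact hcvF (by linarith)
    _ = 4 * (Ci * (P * ε ^ 2)) * E + (4 * C1 + 16 * Ci) * F := by ring
    _ ≤ κ * E + (4 * C2 + 4 * C1 + 16 * Ci) * F := by
        have : 0 ≤ 4 * C2 * F := by positivity
        have := mul_le_mul_of_nonneg_right hε hE0
        linarith

end KK
end

section
open MeasureTheory Set Filter Topology
namespace KK

/-- general operator -/
noncomputable def Lg {n : ℕ} (a : X (n+1) → Fin (n + 1) → Fin (n + 1) → ℝ) (u : X (n + 1) → ℝ) : X (n + 1) → ℝ :=
  fun q => dd et u q + ∑ j, ∑ k, a q j k * dd (ex j) (dd (ex k) u) q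

/-- general elliptic coefficients -/
structure El (n : ℕ) (δ : ℝ) (a : X (n+1) → Fin (n + 1) → Fin (n + 1) → ℝ) : Prop where
  meas : ∀ j k, Measurable fun q => a q j k
  em : ∀ q, EM δ (a q)

lemma El.frz {n : ℕ} {δ : ℝ} {a} (ha : El n δ a) (q) : Ell n δ (fun _ => a q) := ⟨fun _ _ => measurable_const, fun _ => ha.em q⟩

lemma Lg_bm {n : ℕ} {δ : ℝ} (hδ : 0 < δ) {a} (ha : El n δ a) {u : X (n + 1) → ℝ} (hu : Sm u) : BM (Lg a u) := by
  constructor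
  · unfold Lg
    refine ((hu.dd _).cont.measurable).add ?_
    refine Finset.measurable_sum _ fun j _ => Finset.measurable_sum _ fun k _ => ?_
    exact Measurable.mul (ha.meas j k) ((hu.dd _).dd _).cont.measurable
  obtain ⟨K1, h1⟩ := (hu.dd et).bdd
  obtain ⟨K2, -, h2⟩ := Sm.bdd_fin (f := fun (i : Fin (n+1) × Fin (n+1)) => dd (ex i.1) (dd (ex i.2) u))
    (fun i => (hu.dd _).dd _)
  exact ⟨_, fun q => Lb_abs_le hδ (ha.frz q) u q (K := max K1 K2) ((h1 q).trans (le_max_left _ _))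
    fun j k => (h2 (j, k) q).trans (le_max_right _ _)⟩

lemma Lg_sq_le {n : ℕ} {δ : ℝ} (hδ : 0 < δ) {a} (ha : El n δ a) (u : X (n + 1) → ℝ) (q) :
    (Lg a u q) ^ 2 ≤ (2 + 2 * (n + 1 : ℝ) ^ 2 * δ⁻¹ ^ 2) * en u q := Lb_sq_le hδ (ha.frz q) u q

lemma sum_sq_le {m : ℕ} (M x : Fin m → Fin m → ℝ) {b : ℝ} (hM : ∀ j k, |M j k| ≤ b) :
    (∑ j, ∑ k, M j k * x j k) ^ 2 ≤ (m:ℝ) ^ 2 * (b ^ 2 * ∑ j, ∑ k, x j k ^ 2) := by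
  refine (sq_sum2_le _).trans (mul_le_mul_of_nonneg_left ?_ (sq_nonneg _))
  simp_rw [Finset.mul_sum]
  refine Finset.sum_le_sum fun j _ => Finset.sum_le_sum fun k _ => ?_
  rw [mul_pow, ← sq_abs (M j k)]
  have := hM j k
  gcongr

lemma en_le {n : ℕ} {δ : ℝ} (hδ : 0 < δ) {a} (ha : El n δ a) (u : X (n + 1) → ℝ) (q) :
    en u q ≤ (3 + 2 * (n + 1 : ℝ) ^ 2 * δ⁻¹ ^ 2) * (H2 u q + Lg a u q ^ 2) := by
  have h := sum_sq_le (a q) (fun j k => dd (ex j) (dd (ex k) u) q) (fun j k => (ha.em q).bound hδ j k)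
  have e : dd et u q = Lg a u q - ∑ j, ∑ k, a q j k * dd (ex j) (dd (ex k) u) q := by unfold Lg; ring
  set z := ∑ j, ∑ k, a q j k * dd (ex j) (dd (ex k) u) q
  have h3 : z ^ 2 ≤ (n + 1 : ℝ) ^ 2 * (δ⁻¹ ^ 2 * H2 u q) := by push_cast at h; exact h
  have h4 := H2_nonneg u q
  unfold en
  rw [e]
  have h5 : 0 ≤ (n + 1 : ℝ) ^ 2 * δ⁻¹ ^ 2 * (Lg a u q) ^ 2 := by positivity
  nlinarith [sq_nonneg (Lg a u q + z), sq_nonneg (Lg a u q)]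

lemma trunc {H T σ b B : ℝ} (hH : 0 ≤ H) (hT : 0 < T) (hσ : 1 < σ) (hb : 0 ≤ b) (hB : b ≤ B) :
    b ^ 2 * H ≤ B * T * b + B ^ 2 * T ^ (1 - σ) * H ^ σ := by
  have hB0 : 0 ≤ B := hb.trans hB
  have p1 : 0 ≤ T ^ (1 - σ) := Real.rpow_nonneg hT.le _
  have p2 : 0 ≤ H ^ σ := Real.rpow_nonneg hH _
  rcases le_total H T with h | h
  · have : b ^ 2 * H ≤ B * T * b := by
      calc b ^ 2 * H = b * b * H := by ring
        _ ≤ B * b * T := by gcongr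
        _ = _ := by ring
    have : 0 ≤ B ^ 2 * T ^ (1 - σ) * H ^ σ := by positivity
    linarith
  · have hHp : 0 < H := hT.trans_le h
    have e : H = H ^ (1 - σ) * H ^ σ := by rw [← Real.rpow_add hHp]; simp
    have h2 : H ^ (1 - σ) ≤ T ^ (1 - σ) := Real.rpow_le_rpow_of_nonpos hT h (by linarith)
    have : b ^ 2 * H ≤ B ^ 2 * T ^ (1 - σ) * H ^ σ := by
      calc b ^ 2 * H = b ^ 2 * (H ^ (1 - σ) * H ^ σ) := by rw [← e]
        _ ≤ B ^ 2 * (T ^ (1 - σ) * H ^ σ) := by gcongr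
        _ = _ := by ring
    have : 0 ≤ B * T * b := by positivity
    linarith

lemma le_one_rpow {H σ : ℝ} (hH : 0 ≤ H) (hσ : 1 < σ) : H ≤ 1 + H ^ σ := by
  have := trunc hH one_pos hσ zero_le_one le_rfl
  simpa using this

lemma Sm.rpow_int {m : ℕ} {H : X m → ℝ} (hH : Sm H) {σ : ℝ} (hσ : 1 < σ) :
    Integrable (fun q => H q ^ σ) := by
  have hc : Continuous (fun q => H q ^ σ) := hH.cont.rpow_const fun q => Or.inr (by linarith)
  exact hc.integrable_of_hasCompactSupport (hH.2.comp_left (g := fun x : ℝ => x ^ σ) (Real.zero_rpow (by linarith)))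

lemma Lb_le_Lg {n : ℕ} {δ : ℝ} {a A} {u : X (n + 1) → ℝ} {q} {b : ℝ}
    (hb : ∀ j k, |A (q.2 0) j k - a q j k| ≤ b) :
    (Lb A u q) ^ 2 ≤ 2 * Lg a u q ^ 2 + 2 * (n + 1 : ℝ) ^ 2 * (b ^ 2 * H2 u q) := by
  have h := sum_sq_le (fun j k => A (q.2 0) j k - a q j k) (fun j k => dd (ex j) (dd (ex k) u) q) hb
  have e : Lb A u q = Lg a u q + ∑ j, ∑ k, (A (q.2 0) j k - a q j k) * dd (ex j) (dd (ex k) u) q := by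
    unfold Lg Lb
    simp_rw [sub_mul, Finset.sum_sub_distrib]
    ring
  set z := ∑ j, ∑ k, (A (q.2 0) j k - a q j k) * dd (ex j) (dd (ex k) u) q
  have h3 : z ^ 2 ≤ (n + 1 : ℝ) ^ 2 * (b ^ 2 * H2 u q) := by push_cast at h; exact h
  rw [e]
  nlinarith [sq_nonneg (Lg a u q - z)]

lemma V1 (n : ℕ) {δ : ℝ} (hδ : 0 < δ) {σ : ℝ} (hσ : 1 < σ) {C1 : ℝ} (hC1 : 0 ≤ C1) :
    ∃ N : ℝ, 1 ≤ N ∧ ∀ κ > 0, ∃ c : ℝ, 0 < c ∧ ∀ a, El n δ a → ∀ A, Ell n δ A → ∀ β : X (n+1) → ℝ, Measurable β →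
    (∀ q, 0 ≤ β q ∧ β q ≤ 2 * δ⁻¹) → (∀ q j k, |A (q.2 0) j k - a q j k| ≤ β q) → ∀ u, Sm u →
    (∫ q in Metric.ball (0 : X (n+1)) (2 * n + 10), β q ≤ c) → (∫ q in Metric.ball (0 : X (n+1)) (2 * n + 10), H2 u q ^ σ ≤ C1) →
    (∫ q in Metric.ball (0 : X (n+1)) (2 * n + 10), Lg a u q ^ 2 ≤ c) →
    ∫ q in Metric.ball (0 : X (n+1)) 1 ∩ {q | N < H2 u q}, H2 u q ≤ κ := by
  obtain ⟨C0, hC0, h⟩ := V0 n hδ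
  set Bl := Metric.ball (0 : X (n+1)) (2 * n + 10) with hBl
  set Ce := (3 + 2 * (n + 1 : ℝ) ^ 2 * δ⁻¹ ^ 2) with hCe
  have hCe0 : 0 < Ce := by positivity
  set E0 := Ce * (volume.real Bl + C1 + 1) with hE0
  have hE0p : 0 < E0 := by positivity
  refine ⟨C0 * E0 + 1, by have := mul_pos hC0 hE0p; linarith, fun κ hκ => ?_⟩
  obtain ⟨C2, hC2, h2⟩ := h (κ / (2 * E0)) (by positivity)
  set B := 2 * δ⁻¹ with hB
  have hB0 : 0 < B := by positivity
  set P := 2 * (n + 1 : ℝ) ^ 2 with hP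
  have hP0 : 0 < P := by positivity
  -- choose T
  obtain ⟨η, hη0, hη1, hη2⟩ : ∃ η : ℝ, 0 < η ∧ C2 * η ≤ 1 ∧ C2 * η ≤ κ / 2 := by
    refine ⟨min 1 (κ / 2) / (C2 + 1), by positivity, ?_, ?_⟩
    · rw [mul_div_assoc', div_le_one (by positivity)]
      have := min_le_left 1 (κ / 2)
      nlinarith
    · rw [mul_div_assoc', div_le_iff₀ (by positivity)]
      have := min_le_right 1 (κ / 2)
      nlinarith
  obtain ⟨T, hT0, hT⟩ : ∃ T : ℝ, 0 < T ∧ P * (B ^ 2 * T ^ (1 - σ) * C1) ≤ η / 2 := by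
    have := (tendsto_rpow_neg_atTop (y := σ - 1) (by linarith)).const_mul (P * B ^ 2 * C1)
    rw [mul_zero] at this
    obtain ⟨T, hT1, hT2⟩ := ((this.eventually (gt_mem_nhds (half_pos hη0))).and (eventually_gt_atTop 0)).exists
    refine ⟨T, hT2, ?_⟩
    rw [show 1 - σ = -(σ - 1) by ring]
    have : P * B ^ 2 * C1 * T ^ (-(σ - 1)) < η / 2 := hT1
    linarith
  set D := 2 + P * (B * T) with hD
  have hD0 : 0 < D := by positivity
  refine ⟨min 1 (η / 2 / D), by positivity, fun a ha A hA β hβm hβ hβA u hu i1 i2 i3 => ?_⟩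
  set c := min 1 (η / 2 / D) with hc
  have hc1 : c ≤ 1 := min_le_left _ _
  have hc2 : D * c ≤ η / 2 := by
    have : c ≤ η / 2 / D := min_le_right _ _
    rw [le_div_iff₀ hD0] at this
    linarith
  have g1 : IntegrableOn (fun q => Lg a u q ^ 2) Bl := (Lg_bm hδ ha hu).sq_int
  have g2 : IntegrableOn (fun q => H2 u q ^ σ) Bl := (hu.H2.rpow_int hσ).integrableOn
  have g3 : IntegrableOn β Bl := Integrable.of_bound (C := B) hβm.aestronglyMeasurable (Eventually.of_forall fun q => by
    rw [Real.norm_of_nonneg (hβ q).1]; exact (hβ q).2)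
  have g4 : IntegrableOn (fun q => H2 u q) Bl := hu.H2.integrable.integrableOn
  have hE : ∫ q in Bl, en u q ≤ E0 := by
    have j1 : IntegrableOn (fun q => 1 + H2 u q ^ σ) Bl := (integrable_const (1:ℝ)).add g2
    have j2 : IntegrableOn (fun q => 1 + H2 u q ^ σ + Lg a u q ^ 2) Bl := j1.add g1
    calc _ ≤ ∫ q in Bl, Ce * (1 + H2 u q ^ σ + Lg a u q ^ 2) := by
          refine integral_mono hu.en.integrable.integrableOn (j2.const_mul Ce) fun q => ?_
          refine (en_le hδ ha u q).trans (mul_le_mul_of_nonneg_left ?_ hCe0.le)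
          have := le_one_rpow (H2_nonneg u q) hσ
          linarith
      _ = Ce * ((volume.real Bl + ∫ q in Bl, H2 u q ^ σ) + ∫ q in Bl, Lg a u q ^ 2) := by
          rw [integral_const_mul, integral_add j1 g1, integral_add (integrable_const (1:ℝ)) g2]
          simp
      _ ≤ E0 := by rw [hE0]; gcongr; linarith
  have hF : ∫ q in Bl, Lb A u q ^ 2 ≤ η := by
    have k1 : IntegrableOn (fun q => 2 * Lg a u q ^ 2) Bl := g1.const_mul 2
    have k2 : IntegrableOn (fun q => P * (B * T * β q)) Bl := (g3.const_mul _).const_mul _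
    have k3 : IntegrableOn (fun q => P * (B ^ 2 * T ^ (1 - σ) * H2 u q ^ σ)) Bl := (g2.const_mul _).const_mul _
    have k12 : IntegrableOn (fun q => 2 * Lg a u q ^ 2 + P * (B * T * β q)) Bl := k1.add k2
    have k123 : IntegrableOn (fun q => 2 * Lg a u q ^ 2 + P * (B * T * β q) + P * (B ^ 2 * T ^ (1 - σ) * H2 u q ^ σ)) Bl := k12.add k3
    calc _ ≤ ∫ q in Bl, (2 * Lg a u q ^ 2 + P * (B * T * β q) + P * (B ^ 2 * T ^ (1 - σ) * H2 u q ^ σ)) := by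
          refine integral_mono (Lb_bm hδ hA hu).sq_int k123 fun q => ?_
          refine (Lb_le_Lg (δ := δ) (a := a) (hβA q)).trans ?_
          have := mul_le_mul_of_nonneg_left (trunc (H2_nonneg u q) hT0 hσ (hβ q).1 (hβ q).2) hP0.le
          linarith
      _ = 2 * (∫ q in Bl, Lg a u q ^ 2) + P * (B * T * ∫ q in Bl, β q) + P * (B ^ 2 * T ^ (1 - σ) * ∫ q in Bl, H2 u q ^ σ) := by
          rw [integral_add k12 k3, integral_add k1 k2]
          simp only [integral_const_mul]
      _ ≤ 2 * c + P * (B * T * c) + P * (B ^ 2 * T ^ (1 - σ) * C1) := by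
          have := Real.rpow_nonneg hT0.le (1 - σ)
          gcongr
      _ ≤ η := by
          have : D * c = 2 * c + P * (B * T * c) := by rw [hD]; ring
          linarith
  have hF0 : 0 ≤ ∫ q in Bl, Lb A u q ^ 2 := integral_nonneg fun q => sq_nonneg _
  have hE0' : 0 ≤ ∫ q in Bl, en u q := integral_nonneg fun q => en_nonneg _ _
  have key := h2 A hA u hu _ _ rfl rfl
  have m1 : C2 * ∫ q in Bl, Lb A u q ^ 2 ≤ C2 * η := mul_le_mul_of_nonneg_left hF hC2
  have m2 : C0 * (∫ q in Bl, en u q) ≤ C0 * E0 := mul_le_mul_of_nonneg_left hE hC0.le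
  have m3 : κ / (2 * E0) * (∫ q in Bl, en u q) ≤ κ / 2 := by
    calc _ ≤ κ / (2 * E0) * E0 := by gcongr
      _ = κ / 2 := by field_simp
  refine le_trans ?_ (key.trans (by linarith))
  refine setIntegral_mono_set hu.H2.integrable.integrableOn (Eventually.of_forall fun q => H2_nonneg u q) (LE.le.eventuallyLE ?_)
  refine inter_subset_inter_right _ fun q hq => ?_
  have : C0 * E0 + 1 < H2 u q := hq
  simp only [mem_setOf_eq]
  linarith

end KK
end

section
open MeasureTheory Set Filter Topology
open scoped ENNReal
namespace KK

/-- parabolic cylinders -/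
def C {m : ℕ} (r : ℝ) (z : X m) : Set (X m) := Metric.ball z.1 (r ^ 2) ×ˢ Metric.ball z.2 r

lemma C_open {m : ℕ} (r : ℝ) (z : X m) : IsOpen (C r z) := Metric.isOpen_ball.prod Metric.isOpen_ball

lemma C_ms {m : ℕ} (r : ℝ) (z : X m) : MeasurableSet (C r z) := (C_open r z).measurableSet

lemma C_self {m : ℕ} {r : ℝ} (hr : 0 < r) (z : X m) : z ∈ C r z :=
  ⟨Metric.mem_ball_self (by positivity), Metric.mem_ball_self hr⟩

lemma C_vol {m : ℕ} {r : ℝ} (hr : 0 < r) (z : X m) : volume (C r z) = ENNReal.ofReal (2 ^ (m + 1) * r ^ (m + 2)) := by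
  unfold C
  rw [Measure.volume_eq_prod, Measure.prod_prod, Real.volume_ball, Real.volume_pi_ball _ hr, ← ENNReal.ofReal_mul (by positivity)]
  congr 1
  simp
  ring

lemma C_vol_mul {m : ℕ} {r K : ℝ} (hr : 0 < r) (hK : 0 < K) (z w : X m) :
    volume (C (K * r) z) = ENNReal.ofReal (K ^ (m + 2)) * volume (C r w) := by
  rw [C_vol (by positivity), C_vol hr, ← ENNReal.ofReal_mul (by positivity)]
  congr 1; ring

lemma half {α : Type*} [MeasurableSpace α] {μ : Measure α} {φ : α → ℝ} (hm : Measurable φ) {t : ℝ} (ht : 0 < t) {S : Set α} (hS : MeasurableSet S)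
    (hfin : μ S ≠ ⊤) (h : ENNReal.ofReal t * μ S ≤ ∫⁻ q in S, ENNReal.ofReal (φ q) ∂μ) :
    ENNReal.ofReal t * μ S ≤ 2 * ∫⁻ q in S ∩ {q | t / 2 < φ q}, ENNReal.ofReal (φ q) ∂μ := by
  have hA : MeasurableSet {q | t / 2 < φ q} := measurableSet_lt measurable_const hm
  have h1 : ∫⁻ q in S, ENNReal.ofReal (φ q) ∂μ = (∫⁻ q in S ∩ {q | t / 2 < φ q}, ENNReal.ofReal (φ q) ∂μ) +
      ∫⁻ q in S \ {q | t / 2 < φ q}, ENNReal.ofReal (φ q) ∂μ := (lintegral_inter_add_diff _ S hA).symm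
  have h2 : ∫⁻ q in S \ {q | t / 2 < φ q}, ENNReal.ofReal (φ q) ∂μ ≤ ENNReal.ofReal (t / 2) * μ S := by
    calc _ ≤ ∫⁻ q in S \ {q | t / 2 < φ q}, ENNReal.ofReal (t / 2) ∂μ := by
          refine setLIntegral_mono' (hS.diff hA) fun q hq => ENNReal.ofReal_le_ofReal ?_
          exact not_lt.1 hq.2
      _ = ENNReal.ofReal (t / 2) * μ (S \ {q | t / 2 < φ q}) := setLIntegral_const _ _
      _ ≤ _ := by gcongr; exact diff_subset
  set I := ∫⁻ q in S ∩ {q | t / 2 < φ q}, ENNReal.ofReal (φ q) ∂μ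
  set D := ENNReal.ofReal (t / 2) * μ S with hD
  have hDf : D ≠ ⊤ := ENNReal.mul_ne_top ENNReal.ofReal_ne_top hfin
  have e : ENNReal.ofReal t * μ S = D + D := by
    rw [hD, ← add_mul, ← ENNReal.ofReal_add (by positivity) (by positivity)]; congr 2; ring
  rw [e] at h ⊢
  have h3 : D + D ≤ I + D := h.trans (h1 ▸ add_le_add le_rfl h2)
  have h4 : D ≤ I := (ENNReal.add_le_add_iff_right hDf).1 h3
  rw [two_mul]
  exact add_le_add h4 h4

/-- the data of the good-lambda argument -/
structure RVdata (m : ℕ) (σ M N κ c1 : ℝ) (G Φ : X m → ℝ) : Prop where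
  gc : Continuous G
  gn : ∀ q, 0 ≤ G q
  fm : Measurable Φ
  fn : ∀ q, 0 ≤ Φ q
  gi : ∫⁻ q, ENNReal.ofReal (G q ^ σ) ≠ ⊤
  fi : ∫⁻ q, ENNReal.ofReal (Φ q) ≠ ⊤
  H : ∀ (z : X m) (r l : ℝ), 0 < r → 0 < l →
    ∫⁻ q in C (M * r) z, ENNReal.ofReal (G q ^ σ) ≤ ENNReal.ofReal (l ^ σ) * volume (C (M * r) z) →
    ∫⁻ q in C (M * r) z, ENNReal.ofReal (Φ q) ≤ ENNReal.ofReal (c1 * l) * volume (C (M * r) z) →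
    ∫⁻ q in C r z ∩ {q | N * l < G q}, ENNReal.ofReal (G q) ≤ ENNReal.ofReal (κ * l) * volume (C r z)

/-- bad radii -/
def bad {m : ℕ} (σ M c1 l : ℝ) (G Φ : X m → ℝ) (z : X m) : Set ℝ := {r | 0 < r ∧
  (ENNReal.ofReal (l ^ σ) * volume (C (M * r) z) ≤ ∫⁻ q in C (M * r) z, ENNReal.ofReal (G q ^ σ) ∨
   ENNReal.ofReal (c1 * l) * volume (C (M * r) z) ≤ ∫⁻ q in C (M * r) z, ENNReal.ofReal (Φ q))}

lemma bad_bound {t r V : ℝ} (ht : 0 < t) (hr : r ≤ V) {W J : ℝ≥0∞} (hW : W = ENNReal.ofReal V) (hJ : J ≠ ⊤)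
    (h : ENNReal.ofReal t * W ≤ J) : r ≤ J.toReal / t := by
  rw [hW, ← ENNReal.ofReal_mul ht.le, ENNReal.ofReal_le_iff_le_toReal hJ] at h
  rw [le_div_iff₀ ht]
  nlinarith

lemma haltRad {m : ℕ} {σ M N κ c1 : ℝ} {G Φ : X m → ℝ} (D : RVdata m σ M N κ c1 G Φ) (hσ : 1 < σ) (hM : 1 ≤ M) (hc : 0 < c1)
    {l : ℝ} (hl : 0 < l) : ∃ R : ℝ, ∀ z, l < G z → ∃ r ∈ bad σ M c1 l G Φ z, r ≤ R ∧ ∀ r', 2 * r ≤ r' → r' ∉ bad σ M c1 l G Φ z := by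
  have hlσ : 0 < l ^ σ := Real.rpow_pos_of_pos hl _
  have hcl : 0 < c1 * l := mul_pos hc hl
  set R := 1 + (∫⁻ q, ENNReal.ofReal (G q ^ σ)).toReal / l ^ σ + (∫⁻ q, ENNReal.ofReal (Φ q)).toReal / (c1 * l) with hR
  have n1 : 0 ≤ (∫⁻ q, ENNReal.ofReal (G q ^ σ)).toReal / l ^ σ := by positivity
  have n2 : 0 ≤ (∫⁻ q, ENNReal.ofReal (Φ q)).toReal / (c1 * l) := by positivity
  have hb : ∀ z, ∀ r ∈ bad σ M c1 l G Φ z, r ≤ R := by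
    rintro z r ⟨hr, h⟩
    by_cases h1 : r ≤ 1
    · linarith
    push Not at h1
    have hV : r ≤ 2 ^ (m + 1) * (M * r) ^ (m + 2) := by
      have hMr : 1 ≤ M * r := by nlinarith
      calc r ≤ M * r := by nlinarith
        _ = (M * r) ^ 1 := (pow_one _).symm
        _ ≤ (M * r) ^ (m + 2) := pow_le_pow_right₀ hMr (by omega)
        _ ≤ 2 ^ (m + 1) * (M * r) ^ (m + 2) := le_mul_of_one_le_left (by positivity) (one_le_pow₀ (by norm_num))
    have hW := C_vol (m := m) (r := M * r) (by positivity) z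
    rcases h with h | h
    · have := bad_bound hlσ hV hW D.gi (h.trans (setLIntegral_le_lintegral _ _))
      linarith
    · have := bad_bound hcl hV hW D.fi (h.trans (setLIntegral_le_lintegral _ _))
      linarith
  refine ⟨R, fun z hz => ?_⟩
  have hne : (bad σ M c1 l G Φ z).Nonempty := by
    have ho : IsOpen {q | l < G q} := isOpen_lt continuous_const D.gc
    obtain ⟨ε, hε, hsub⟩ := Metric.isOpen_iff.1 ho z hz
    set ρ := min 1 ε with hρ
    have hρ0 : 0 < ρ := by positivity
    have hCs : C ρ z ⊆ {q | l < G q} := by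
      refine Subset.trans ?_ hsub
      rintro q ⟨h1, h2⟩
      rw [Metric.mem_ball] at *
      have hρ1 : ρ ≤ 1 := min_le_left _ _
      have hρ2 : ρ ≤ ε := min_le_right _ _
      rw [Prod.dist_eq]
      refine max_lt (h1.trans_le ?_) (h2.trans_le hρ2)
      nlinarith
    have e : M * (ρ / M) = ρ := by field_simp
    refine ⟨ρ / M, by positivity, Or.inl ?_⟩
    rw [e, ← setLIntegral_const]
    refine setLIntegral_mono' (C_ms _ _) fun q hq => ENNReal.ofReal_le_ofReal ?_
    exact Real.rpow_le_rpow hl.le (hCs hq).le (by linarith)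
  have hbd : BddAbove (bad σ M c1 l G Φ z) := ⟨R, fun r hr => hb z r hr⟩
  obtain ⟨r0, hr0⟩ := hne
  have hs : 0 < sSup (bad σ M c1 l G Φ z) := hr0.1.trans_le (le_csSup hbd hr0)
  obtain ⟨r, hr, hr2⟩ := exists_lt_of_lt_csSup ⟨r0, hr0⟩ (half_lt_self hs)
  refine ⟨r, hr, hb z r hr, fun r' hr' hmem => ?_⟩
  have := le_csSup hbd hmem
  linarith

lemma bad_vol {m : ℕ} {σ M N κ c1 : ℝ} {G Φ : X m → ℝ} (D : RVdata m σ M N κ c1 G Φ) (hσ : 1 < σ) (hM : 1 ≤ M) (hc : 0 < c1)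
    {l : ℝ} (hl : 0 < l) {z : X m} {r : ℝ} (hr : r ∈ bad σ M c1 l G Φ z) :
    ENNReal.ofReal l * volume (C (M * r) z) ≤
      ENNReal.ofReal (2 * l ^ (1 - σ)) * (∫⁻ q in C (M * r) z, {q | l / 2 < G q}.indicator (fun q => ENNReal.ofReal (G q ^ σ)) q) +
      ENNReal.ofReal (2 / c1) * (∫⁻ q in C (M * r) z, {q | c1 * l / 2 < Φ q}.indicator (fun q => ENNReal.ofReal (Φ q)) q) := by
  have hlσ : 0 < l ^ σ := Real.rpow_pos_of_pos hl _
  have hl1 : 0 < l ^ (1 - σ) := Real.rpow_pos_of_pos hl _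
  have hcl : 0 < c1 * l := mul_pos hc hl
  have hfin : volume (C (M * r) z) ≠ ⊤ := by
    rw [C_vol (mul_pos (by linarith) hr.1)]; exact ENNReal.ofReal_ne_top
  have hA : MeasurableSet {q | l / 2 < G q} := measurableSet_lt measurable_const D.gc.measurable
  have hB : MeasurableSet {q | c1 * l / 2 < Φ q} := measurableSet_lt measurable_const D.fm
  rw [setLIntegral_indicator hA, setLIntegral_indicator hB]
  rcases hr.2 with h | h
  · refine le_trans ?_ le_self_add
    have h1 := half (μ := volume) ((D.gc.measurable.pow_const σ)) hlσ (C_ms _ _) hfin h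
    have hsub : C (M * r) z ∩ {q | l ^ σ / 2 < G q ^ σ} ⊆ {q | l / 2 < G q} ∩ C (M * r) z := by
      rintro q ⟨hq1, hq2⟩
      refine ⟨?_, hq1⟩
      by_contra hn
      simp only [mem_setOf_eq, not_lt] at hn hq2
      have h3 : G q ^ σ ≤ (l / 2) ^ σ := Real.rpow_le_rpow (D.gn q) hn (by linarith)
      rw [Real.div_rpow hl.le (by norm_num)] at h3
      have h4 : (2:ℝ) ≤ 2 ^ σ := by
        calc (2:ℝ) = 2 ^ (1:ℝ) := (Real.rpow_one 2).symm
          _ ≤ 2 ^ σ := Real.rpow_le_rpow_of_exponent_le (by norm_num) hσ.le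
      have h5 : l ^ σ / 2 ^ σ ≤ l ^ σ / 2 := by gcongr
      linarith
    calc ENNReal.ofReal l * volume (C (M * r) z) = ENNReal.ofReal (l ^ (1 - σ)) * (ENNReal.ofReal (l ^ σ) * volume (C (M * r) z)) := by
          rw [← mul_assoc, ← ENNReal.ofReal_mul hl1.le, ← Real.rpow_add hl]; simp
      _ ≤ ENNReal.ofReal (l ^ (1 - σ)) * (2 * ∫⁻ q in {q | l / 2 < G q} ∩ C (M * r) z, ENNReal.ofReal (G q ^ σ)) := by
          exact mul_le_mul_right (h1.trans (mul_le_mul_right (lintegral_mono_set hsub) _)) _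
      _ = _ := by
          rw [ENNReal.ofReal_mul (by norm_num)]
          simp only [ENNReal.ofReal_ofNat]
          ring
  · refine le_trans ?_ le_add_self
    have h1 := half (μ := volume) D.fm hcl (C_ms _ _) hfin h
    rw [inter_comm] at h1
    calc ENNReal.ofReal l * volume (C (M * r) z) = ENNReal.ofReal c1⁻¹ * (ENNReal.ofReal (c1 * l) * volume (C (M * r) z)) := by
          rw [← mul_assoc, ← ENNReal.ofReal_mul (by positivity)]; congr 2; field_simp
      _ ≤ ENNReal.ofReal c1⁻¹ * (2 * ∫⁻ q in {q | c1 * l / 2 < Φ q} ∩ C (M * r) z, ENNReal.ofReal (Φ q)) := mul_le_mul_right h1 _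
      _ = _ := by
          rw [show 2 / c1 = 2 * c1⁻¹ from div_eq_mul_inv _ _, ENNReal.ofReal_mul (by norm_num)]
          simp only [ENNReal.ofReal_ofNat]
          ring

lemma glam {m : ℕ} {σ M N κ c1 : ℝ} {G Φ : X m → ℝ} (D : RVdata m σ M N κ c1 G Φ) (hσ : 1 < σ) (hM : 1 ≤ M) (hN : 1 ≤ N) (hκ : 0 < κ) (hc : 0 < c1)
    {l : ℝ} (hl : 0 < l) : ∫⁻ q in {q | N * l < G q}, ENNReal.ofReal (G q) ≤ ENNReal.ofReal (κ * 3 ^ (m + 2)) *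
      (ENNReal.ofReal (2 * l ^ (1 - σ)) * (∫⁻ q in {q | l / 2 < G q}, ENNReal.ofReal (G q ^ σ)) +
      ENNReal.ofReal (2 / c1) * (∫⁻ q in {q | c1 * l / 2 < Φ q}, ENNReal.ofReal (Φ q))) := by
  obtain ⟨R, hR⟩ := haltRad D hσ hM hc hl
  choose! r hr1 hr2 hr3 using hR
  set t : Set (X m) := {z | N * l < G z} with ht
  have htl : ∀ z ∈ t, l < G z := fun z hz => lt_of_le_of_lt (by nlinarith) hz
  have hpos : ∀ z ∈ t, 0 < r z := fun z hz => (hr1 z (htl z hz)).1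
  have hM0 : 0 < M := by linarith
  obtain ⟨u, hut, hdis, hcov⟩ := Vitali.exists_disjoint_subfamily_covering_enlargement (fun z => C (M * r z) z) t r 2 (by norm_num)
    (fun z hz => (hpos z hz).le) R (fun z hz => hr2 z (htl z hz)) (fun z hz => ⟨z, C_self (mul_pos hM0 (hpos z hz)) z⟩)
  have hcnt : u.Countable := hdis.countable_of_isOpen (fun z _ => C_open _ _) (fun z hz => ⟨z, C_self (mul_pos hM0 (hpos z (hut hz))) z⟩)
  have hsub : t ⊆ ⋃ b : u, (C (3 * (M * r b)) (b : X m) ∩ t) := by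
    intro z hz
    obtain ⟨b, hb, ⟨w, hw1, hw2⟩, hle⟩ := hcov z hz
    refine mem_iUnion.2 ⟨⟨b, hb⟩, ?_, hz⟩
    have p1 := hpos z hz
    have p2 := hpos b (hut hb)
    obtain ⟨a1, a2⟩ := hw1
    obtain ⟨b1, b2⟩ := hw2
    rw [Metric.mem_ball] at a1 a2 b1 b2
    have hMr : M * r z ≤ 2 * (M * r b) := by nlinarith
    have p3 : 0 < M * r z := by positivity
    refine ⟨?_, ?_⟩
    · rw [Metric.mem_ball]
      have := dist_triangle_left z.1 b.1 w.1
      have : (M * r z) ^ 2 ≤ (2 * (M * r b)) ^ 2 := by gcongr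
      nlinarith [sq_nonneg (M * r b)]
    · rw [Metric.mem_ball]
      have := dist_triangle_left z.2 b.2 w.2
      simp only
      linarith
  have hone : ∀ b ∈ u, ∫⁻ q in C (3 * (M * r b)) b ∩ t, ENNReal.ofReal (G q) ≤ ENNReal.ofReal (κ * 3 ^ (m + 2)) *
      (ENNReal.ofReal (2 * l ^ (1 - σ)) * (∫⁻ q in C (M * r b) b, {q | l / 2 < G q}.indicator (fun q => ENNReal.ofReal (G q ^ σ)) q) +
      ENNReal.ofReal (2 / c1) * (∫⁻ q in C (M * r b) b, {q | c1 * l / 2 < Φ q}.indicator (fun q => ENNReal.ofReal (Φ q)) q)) := by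
    intro b hb
    have hbt := htl b (hut hb)
    have p2 := hpos b (hut hb)
    have hnb := hr3 b hbt (3 * (M * r b)) (by nlinarith)
    have hnb2 : ¬ (_ ∨ _) := fun h => hnb ⟨by positivity, h⟩
    push Not at hnb2
    have h1 := D.H b (3 * (M * r b)) l (by positivity) hl hnb2.1.le hnb2.2.le
    have h2 := bad_vol D hσ hM hc hl (hr1 b hbt)
    refine h1.trans ?_
    rw [C_vol_mul (by positivity) (by norm_num) b b]
    calc _ = ENNReal.ofReal (κ * 3 ^ (m + 2)) * (ENNReal.ofReal l * volume (C (M * r b) b)) := by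
          rw [← mul_assoc, ← mul_assoc, ← ENNReal.ofReal_mul (by positivity), ← ENNReal.ofReal_mul (by positivity)]
          congr 2; ring
      _ ≤ _ := mul_le_mul_right h2 _
  have : Countable u := hcnt.to_subtype
  have hsum : ∀ f : X m → ℝ≥0∞, ∑' b : u, ∫⁻ q in C (M * r b) (b : X m), f q ≤ ∫⁻ q, f q := by
    intro f
    rw [← lintegral_biUnion hcnt (fun b _ => C_ms _ _) hdis]
    exact setLIntegral_le_lintegral _ _
  have hA : MeasurableSet {q | l / 2 < G q} := measurableSet_lt measurable_const D.gc.measurable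
  have hB : MeasurableSet {q | c1 * l / 2 < Φ q} := measurableSet_lt measurable_const D.fm
  calc _ ≤ ∫⁻ q in ⋃ b : u, (C (3 * (M * r b)) (b : X m) ∩ t), ENNReal.ofReal (G q) := lintegral_mono_set hsub
    _ ≤ ∑' b : u, ∫⁻ q in C (3 * (M * r b)) (b : X m) ∩ t, ENNReal.ofReal (G q) := lintegral_iUnion_le _ _
    _ ≤ _ := ENNReal.tsum_le_tsum fun b => hone b b.2
    _ = _ := by rw [ENNReal.tsum_mul_left, ENNReal.tsum_add, ENNReal.tsum_mul_left, ENNReal.tsum_mul_left]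
    _ ≤ _ := by
      refine mul_le_mul_right (add_le_add (mul_le_mul_right ?_ _) (mul_le_mul_right ?_ _)) _
      · exact (hsum _).trans (le_of_eq (lintegral_indicator hA _))
      · exact (hsum _).trans (le_of_eq (lintegral_indicator hB _))

lemma lc {m : ℕ} {G : X m → ℝ} (hm : Measurable G) (h0 : ∀ q, 0 ≤ G q) {a b k : ℝ} (ha : 0 < a) (hb : 0 < b) (hk : 0 < k) :
    ∫⁻ t in Ioi (0:ℝ), (∫⁻ q in {q | t < k * G q}, ENNReal.ofReal (G q ^ a)) * ENNReal.ofReal (t ^ (b - 1)) =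
      ENNReal.ofReal (k ^ b / b) * ∫⁻ q, ENNReal.ofReal (G q ^ (a + b)) := by
  set μ : Measure (X m) := volume.withDensity (fun q => ENNReal.ofReal (G q ^ a)) with hμ
  have hd : Measurable (fun q => ENNReal.ofReal (G q ^ a)) := (hm.pow_const a).ennreal_ofReal
  have h1 := lintegral_rpow_eq_lintegral_meas_lt_mul μ (f := fun q => k * G q)
    (Eventually.of_forall fun q => mul_nonneg hk.le (h0 q)) (hm.const_mul k).aemeasurable hb
  have h2 : ∀ t, μ {q | t < k * G q} = ∫⁻ q in {q | t < k * G q}, ENNReal.ofReal (G q ^ a) := fun t =>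
    withDensity_apply _ (measurableSet_lt measurable_const (hm.const_mul k))
  simp_rw [h2] at h1
  rw [hμ, lintegral_withDensity_eq_lintegral_mul _ hd (((hm.const_mul k).pow_const b).ennreal_ofReal)] at h1
  have h3 : ∫⁻ q, ((fun q => ENNReal.ofReal (G q ^ a)) * fun q => ENNReal.ofReal ((k * G q) ^ b)) q =
      ENNReal.ofReal (k ^ b) * ∫⁻ q, ENNReal.ofReal (G q ^ (a + b)) := by
    rw [← lintegral_const_mul _ ((hm.pow_const _).ennreal_ofReal)]
    congr 1; funext q
    simp only [Pi.mul_apply]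
    rw [Real.mul_rpow hk.le (h0 q), ← ENNReal.ofReal_mul (Real.rpow_nonneg (h0 q) _), ← ENNReal.ofReal_mul (Real.rpow_nonneg hk.le _),
      Real.rpow_add_of_nonneg (h0 q) ha.le hb.le]
    congr 1; ring
  rw [h3] at h1
  have h4 : ENNReal.ofReal b⁻¹ * _ = ENNReal.ofReal b⁻¹ * _ := congrArg (fun x => ENNReal.ofReal b⁻¹ * x) h1
  rw [← mul_assoc, ← mul_assoc, ← ENNReal.ofReal_mul (by positivity), ← ENNReal.ofReal_mul (by positivity), inv_mul_cancel₀ hb.ne',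
    ENNReal.ofReal_one, one_mul] at h4
  rw [← h4]
  congr 2; field_simp

lemma RV (m : ℕ) {σ P M N : ℝ} (hσ : 1 < σ) (hP : σ < P) (hM : 1 ≤ M) (hN : 1 ≤ N) : ∃ κ : ℝ, 0 < κ ∧ ∀ c1 > 0, ∃ K : ℝ, 0 < K ∧
    ∀ G Φ : X m → ℝ, RVdata m σ M N κ c1 G Φ → ∫⁻ q, ENNReal.ofReal (G q ^ P) ≠ ⊤ →
    ∫⁻ q, ENNReal.ofReal (G q ^ P) ≤ ENNReal.ofReal K * ∫⁻ q, ENNReal.ofReal (Φ q ^ P) := by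
  have hN0 : 0 < N := by linarith
  set α := (1 / N) ^ (P - 1) / (P - 1) with hα
  have hP1 : 0 < P - 1 := by linarith
  have hPs : 0 < P - σ := by linarith
  have hα0 : 0 < α := by positivity
  set γ : ℝ := 3 ^ (m + 2) * (2 * (2 ^ (P - σ) / (P - σ))) with hγ
  have hγ0 : 0 < γ := by positivity
  set κ := α / 2 / γ with hκd
  have hκ : 0 < κ := by positivity
  refine ⟨κ, hκ, fun c1 hc => ?_⟩
  set B := κ * 3 ^ (m + 2) * ((2 / c1) * ((2 / c1) ^ (P - 1) / (P - 1))) with hB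
  have hB0 : 0 < B := by positivity
  refine ⟨2 / α * B, by positivity, fun G Φ D hfin => ?_⟩
  set Y := ∫⁻ q, ENNReal.ofReal (G q ^ P) with hY
  set Z := ∫⁻ q, ENNReal.ofReal (Φ q ^ P) with hZ
  have e1 := lc D.gc.measurable D.gn one_pos hP1 (one_div_pos.2 hN0)
  have e2 := lc D.gc.measurable D.gn (a := σ) (by linarith) hPs (k := 2) (by norm_num)
  have e3 := lc D.fm D.fn one_pos hP1 (k := 2 / c1) (by positivity)
  simp only [Real.rpow_one, add_sub_cancel] at e1 e2 e3
  rw [← hY, ← hα] at e1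
  rw [← hY] at e2
  rw [← hZ] at e3
  have hanti : Measurable fun t : ℝ => ∫⁻ q in {q | t < 2 * G q}, ENNReal.ofReal (G q ^ σ) := by
    refine Antitone.measurable fun s t hst => lintegral_mono_set fun q hq => ?_
    exact lt_of_le_of_lt hst hq
  have hanti3 : Measurable fun t : ℝ => ∫⁻ q in {q | t < 2 / c1 * Φ q}, ENNReal.ofReal (Φ q) := by
    refine Antitone.measurable fun s t hst => lintegral_mono_set fun q hq => ?_
    exact lt_of_le_of_lt hst hq
  have hpw : ∀ p : ℝ, Measurable fun t : ℝ => ENNReal.ofReal (t ^ p) := fun p => (measurable_id.pow_const p).ennreal_ofReal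
  have key : ENNReal.ofReal α * Y ≤ ENNReal.ofReal (κ * 3 ^ (m + 2)) * (2 * (ENNReal.ofReal (2 ^ (P - σ) / (P - σ)) * Y) +
      ENNReal.ofReal (2 / c1) * (ENNReal.ofReal ((2 / c1) ^ (P - 1) / (P - 1)) * Z)) := by
    have hm2 : Measurable fun t : ℝ => (∫⁻ q in {q | t < 2 * G q}, ENNReal.ofReal (G q ^ σ)) * ENNReal.ofReal (t ^ (P - σ - 1)) :=
      hanti.mul (hpw _)
    have hm3 : Measurable fun t : ℝ => (∫⁻ q in {q | t < 2 / c1 * Φ q}, ENNReal.ofReal (Φ q)) * ENNReal.ofReal (t ^ (P - 1 - 1)) :=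
      hanti3.mul (hpw _)
    have hm2c : Measurable fun t : ℝ => 2 * ((∫⁻ q in {q | t < 2 * G q}, ENNReal.ofReal (G q ^ σ)) * ENNReal.ofReal (t ^ (P - σ - 1))) :=
      hm2.const_mul _
    have hm5 : Measurable fun t : ℝ => 2 * ((∫⁻ q in {q | t < 2 * G q}, ENNReal.ofReal (G q ^ σ)) * ENNReal.ofReal (t ^ (P - σ - 1))) +
        ENNReal.ofReal (2 / c1) * ((∫⁻ q in {q | t < 2 / c1 * Φ q}, ENNReal.ofReal (Φ q)) * ENNReal.ofReal (t ^ (P - 1 - 1))) :=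
      hm2c.add (hm3.const_mul _)
    rw [← e1, ← e2, ← e3, ← lintegral_const_mul _ hm2, ← lintegral_const_mul _ hm3, ← lintegral_add_left hm2c,
      ← lintegral_const_mul _ hm5]
    refine setLIntegral_mono' measurableSet_Ioi fun t ht => ?_
    have ht : 0 < t := ht
    have g := glam D hσ hM hN hκ hc ht
    have s1 : {q | t < 1 / N * G q} = {q | N * t < G q} := by
      ext q; simp only [mem_setOf_eq]; rw [one_div, lt_inv_mul_iff₀ hN0]
    have s2 : {q | t < 2 * G q} = {q | t / 2 < G q} := by
      ext q; simp only [mem_setOf_eq]; rw [div_lt_iff₀ (by norm_num), mul_comm]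
    have s3 : {q | t < 2 / c1 * Φ q} = {q | c1 * t / 2 < Φ q} := by
      ext q; simp only [mem_setOf_eq]
      rw [div_lt_iff₀ (by norm_num), div_mul_eq_mul_div, lt_div_iff₀ hc, mul_comm c1, mul_comm (Φ q)]
    rw [s1, s2, s3]
    refine (mul_le_mul_left g _).trans (le_of_eq ?_)
    have p1 : ENNReal.ofReal (2 * t ^ (1 - σ)) * ENNReal.ofReal (t ^ (P - 1 - 1)) = 2 * ENNReal.ofReal (t ^ (P - σ - 1)) := by
      rw [← ENNReal.ofReal_mul (by positivity), mul_assoc, ← Real.rpow_add ht, ENNReal.ofReal_mul (by norm_num)]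
      simp only [ENNReal.ofReal_ofNat]
      congr 3; ring
    generalize ENNReal.ofReal (κ * 3 ^ (m + 2)) = k0
    generalize (∫⁻ q in {q | t / 2 < G q}, ENNReal.ofReal (G q ^ σ)) = k1
    generalize (∫⁻ q in {q | c1 * t / 2 < Φ q}, ENNReal.ofReal (Φ q)) = k2
    calc _ = k0 * ((ENNReal.ofReal (2 * t ^ (1 - σ)) * ENNReal.ofReal (t ^ (P - 1 - 1))) * k1 + ENNReal.ofReal (2 / c1) * (k2 * ENNReal.ofReal (t ^ (P - 1 - 1)))) := by ring
      _ = _ := by rw [p1]; ring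
  have e4 : ENNReal.ofReal (κ * 3 ^ (m + 2)) * (2 * (ENNReal.ofReal (2 ^ (P - σ) / (P - σ)) * Y) +
      ENNReal.ofReal (2 / c1) * (ENNReal.ofReal ((2 / c1) ^ (P - 1) / (P - 1)) * Z)) = ENNReal.ofReal (α / 2) * Y + ENNReal.ofReal B * Z := by
    have q1 : ENNReal.ofReal (α / 2) = ENNReal.ofReal (κ * 3 ^ (m + 2)) * (2 * ENNReal.ofReal (2 ^ (P - σ) / (P - σ))) := by
      rw [show (2:ℝ≥0∞) = ENNReal.ofReal 2 by simp, ← ENNReal.ofReal_mul (by positivity), ← ENNReal.ofReal_mul (by positivity)]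
      congr 1
      rw [hκd, mul_assoc, ← hγ]; field_simp
    have q2 : ENNReal.ofReal B = ENNReal.ofReal (κ * 3 ^ (m + 2)) * (ENNReal.ofReal (2 / c1) * ENNReal.ofReal ((2 / c1) ^ (P - 1) / (P - 1))) := by
      rw [← ENNReal.ofReal_mul (by positivity), ← ENNReal.ofReal_mul (by positivity)]
    rw [q1, q2]; ring
  rw [e4] at key
  have hf2 : ENNReal.ofReal (α / 2) * Y ≠ ⊤ := ENNReal.mul_ne_top ENNReal.ofReal_ne_top hfin
  have e5 : ENNReal.ofReal α * Y = ENNReal.ofReal (α / 2) * Y + ENNReal.ofReal (α / 2) * Y := by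
    rw [← add_mul, ← ENNReal.ofReal_add (by positivity) (by positivity)]; congr 2; ring
  rw [e5] at key
  have k2 := (ENNReal.add_le_add_iff_left hf2).1 key
  calc Y = ENNReal.ofReal (2 / α) * (ENNReal.ofReal (α / 2) * Y) := by
        rw [← mul_assoc, ← ENNReal.ofReal_mul (by positivity), show 2 / α * (α / 2) = 1 by field_simp, ENNReal.ofReal_one, one_mul]
    _ ≤ ENNReal.ofReal (2 / α) * (ENNReal.ofReal B * Z) := mul_le_mul_right k2 _
    _ = _ := by rw [← mul_assoc, ← ENNReal.ofReal_mul (by positivity)]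

end KK
end

section
open MeasureTheory Set Filter Topology
open scoped ENNReal
namespace KK

/-- linear part of the parabolic dilation -/
noncomputable def Dl {m : ℕ} (r : ℝ) : X m →L[ℝ] X m :=
  ContinuousLinearMap.prodMap ((r ^ 2) • ContinuousLinearMap.id ℝ ℝ) (r • ContinuousLinearMap.id ℝ (Fin m → ℝ))

/-- parabolic dilation -/
noncomputable def S {m : ℕ} (r : ℝ) (z q : X m) : X m := z + Dl r q

lemma S_apply {m : ℕ} (r : ℝ) (z q : X m) : S r z q = (z.1 + r ^ 2 * q.1, z.2 + r • q.2) := rfl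

lemma Dl_et {m : ℕ} (r : ℝ) : Dl r (et : X m) = (r ^ 2) • et := by simp [Dl, et]

lemma Dl_ex {m : ℕ} (r : ℝ) (j : Fin m) : Dl r (ex j) = r • ex j := by simp [Dl, ex]

lemma S_cd {m : ℕ} (r : ℝ) (z : X m) : ContDiff ℝ (⊤ : ℕ∞) (S r z) :=
  contDiff_const.add (Dl r).contDiff

lemma S_meas {m : ℕ} (r : ℝ) (z : X m) : Measurable (S r z) := (S_cd r z).continuous.measurable

lemma dd_S {m : ℕ} {f : X m → ℝ} (hf : Differentiable ℝ f) (c r : ℝ) (z e q : X m) :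
    dd e (fun q => c * f (S r z q)) q = c * dd (Dl r e) f (S r z q) := by
  unfold dd
  have h1 : HasFDerivAt (S r z) (Dl r) q := (Dl r).hasFDerivAt.const_add z
  have h2 := ((hf (S r z q)).hasFDerivAt.comp q h1).const_mul c
  have : fderiv ℝ (fun q => c * f (S r z q)) q = c • (fderiv ℝ f (S r z q)).comp (Dl r) := h2.fderiv
  rw [this]; simp

/-- inverse of the dilation -/
noncomputable def Si {m : ℕ} (r : ℝ) (z q : X m) : X m := ((r ^ 2)⁻¹ * (q.1 - z.1), r⁻¹ • (q.2 - z.2))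

lemma S_Si {m : ℕ} {r : ℝ} (hr : 0 < r) (z q : X m) : S r z (Si r z q) = q := by
  rw [S_apply]; ext i
  · simp only [Si]; field_simp; ring
  · simp only [Si, smul_smul, mul_inv_cancel₀ hr.ne', one_smul]; simp

lemma Si_S {m : ℕ} {r : ℝ} (hr : 0 < r) (z q : X m) : Si r z (S r z q) = q := by
  rw [S_apply]; ext i
  · simp only [Si]; field_simp; ring
  · simp only [Si, Pi.smul_apply, Pi.sub_apply, Pi.add_apply, smul_eq_mul]; field_simp; ring

/-- dilation as homeomorphism -/
noncomputable def Sh {m : ℕ} {r : ℝ} (hr : 0 < r) (z : X m) : X m ≃ₜ X m where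
  toFun := S r z
  invFun := Si r z
  left_inv := Si_S hr z
  right_inv := S_Si hr z
  continuous_toFun := (S_cd r z).continuous
  continuous_invFun := by unfold Si; fun_prop

lemma Sm.S {m : ℕ} {f : X m → ℝ} (hf : Sm f) (c : ℝ) {r : ℝ} (hr : 0 < r) (z : X m) : Sm (fun q => c * f (S r z q)) :=
  Sm.const_mul c ⟨hf.1.comp (S_cd r z), hf.2.comp_homeomorph (Sh hr z)⟩

lemma S_map {m : ℕ} {r : ℝ} (hr : 0 < r) (z : X m) :
    Measure.map (S r z) volume = ENNReal.ofReal ((r ^ (m + 2))⁻¹) • (volume : Measure (X m)) := by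
  have h1 : Measure.map (fun t : ℝ => (r ^ 2) • t) volume = ENNReal.ofReal ((r ^ 2)⁻¹) • volume := by
    rw [Measure.map_addHaar_smul volume (by positivity)]
    simp only [Module.finrank_self, pow_one]; rw [abs_of_pos (by positivity)]
  have h2 : Measure.map (fun x : Fin m → ℝ => r • x) volume = ENNReal.ofReal ((r ^ m)⁻¹) • volume := by
    rw [Measure.map_addHaar_smul volume (by positivity)]
    simp only [Module.finrank_fin_fun]; rw [abs_of_pos (by positivity)]
  have h3 : Measure.map (fun q : X m => Dl r q) volume = ENNReal.ofReal ((r ^ (m + 2))⁻¹) • (volume : Measure (X m)) := by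
    have : (fun q : X m => Dl r q) = Prod.map (fun t : ℝ => (r ^ 2) • t) (fun x : Fin m → ℝ => r • x) := rfl
    rw [this, Measure.volume_eq_prod, ← Measure.map_prod_map _ _ (by fun_prop) (by fun_prop), h1, h2, Measure.prod_smul_left, Measure.prod_smul_right,
      smul_smul, ← ENNReal.ofReal_mul (by positivity)]
    congr 2; rw [← mul_inv]; congr 1; ring
  have h4 : S r z = (fun q => z + q) ∘ (fun q => Dl r q) := rfl
  rw [h4, ← Measure.map_map (by fun_prop) (by fun_prop), h3, Measure.map_smul, map_add_left_eq_self]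

lemma chv {m : ℕ} {r : ℝ} (hr : 0 < r) (z : X m) {f : X m → ℝ≥0∞} (hf : Measurable f) {B : Set (X m)} (hB : MeasurableSet B) :
    ∫⁻ q in S r z ⁻¹' B, f (S r z q) = ENNReal.ofReal ((r ^ (m + 2))⁻¹) * ∫⁻ q in B, f q := by
  rw [← setLIntegral_map hB hf (S_meas r z), S_map hr, Measure.restrict_smul, lintegral_smul_measure, smul_eq_mul]

lemma S_C {m : ℕ} {r : ℝ} (hr : 0 < r) (z : X m) (M : ℝ) : S r z ⁻¹' C (M * r) z = C M 0 := by
  ext q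
  simp only [mem_preimage, C, mem_prod, Metric.mem_ball, S_apply, Prod.fst_zero, Prod.snd_zero, dist_self_add_left, dist_zero_right, norm_smul, norm_mul,
    Real.norm_eq_abs, abs_of_pos hr, abs_of_pos (pow_pos hr 2)]
  rw [mul_pow, mul_comm (M ^ 2), mul_comm M, mul_lt_mul_iff_right₀ (by positivity), mul_lt_mul_iff_right₀ hr]

lemma ball_C {m : ℕ} {M : ℝ} (hM : 1 ≤ M) : Metric.ball (0 : X m) M ⊆ C M 0 := by
  intro q hq
  rw [← Prod.mk_zero_zero, ← ball_prod_same] at hq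
  exact ⟨Metric.ball_subset_ball (by nlinarith) hq.1, hq.2⟩

lemma C_one {m : ℕ} : C 1 (0 : X m) = Metric.ball 0 1 := by
  rw [← Prod.mk_zero_zero, ← ball_prod_same]; simp [C]

section
variable {n : ℕ} {u : X (n+1) → ℝ}

lemma dd2_S (hu : Sm u) (c r : ℝ) (z : X (n+1)) (j k : Fin (n+1)) (q) :
    dd (ex j) (dd (ex k) (fun q => c * u (S r z q))) q = c * r ^ 2 * dd (ex j) (dd (ex k) u) (S r z q) := by
  have h : dd (ex k) (fun q => c * u (S r z q)) = fun q => (c * r) * dd (ex k) u (S r z q) := by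
    funext q; rw [dd_S (hu.1.differentiable (by simp)), Dl_ex, dd_smul]; ring
  rw [h, dd_S ((hu.dd _).1.differentiable (by simp)), Dl_ex, dd_smul]; ring

lemma H2_S (hu : Sm u) (c r : ℝ) (z : X (n+1)) (q) :
    H2 (fun q => c * u (S r z q)) q = (c * r ^ 2) ^ 2 * H2 u (S r z q) := by
  unfold H2; simp_rw [dd2_S hu, mul_pow _ (dd _ _ _), Finset.mul_sum]

lemma Lg_S (hu : Sm u) (a) (c r : ℝ) (z : X (n+1)) (q) :
    Lg (fun q => a (S r z q)) (fun q => c * u (S r z q)) q = (c * r ^ 2) * Lg a u (S r z q) := by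
  unfold Lg; simp_rw [dd2_S hu]
  rw [dd_S (hu.1.differentiable (by simp)), Dl_et, dd_smul, mul_add, Finset.mul_sum]
  congr 1
  · ring
  · refine Finset.sum_congr rfl fun j _ => ?_
    rw [Finset.mul_sum]; refine Finset.sum_congr rfl fun k _ => ?_
    ring

end

lemma toR {α : Type*} [MeasurableSpace α] {μ : Measure α} {f : α → ℝ} (hf : Measurable f) (h0 : ∀ q, 0 ≤ f q) {K : ℝ} (hK : 0 ≤ K)
    (h : ∫⁻ q, ENNReal.ofReal (f q) ∂μ ≤ ENNReal.ofReal K) : ∫ q, f q ∂μ ≤ K := by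
  rw [integral_eq_lintegral_of_nonneg_ae (Eventually.of_forall h0) hf.aestronglyMeasurable]
  exact ENNReal.toReal_le_of_le_ofReal hK h

lemma V2 (n : ℕ) {δ : ℝ} (hδ : 0 < δ) {σ : ℝ} (hσ : 1 < σ) :
    ∃ N : ℝ, 1 ≤ N ∧ ∀ κ > 0, ∃ c : ℝ, 0 < c ∧ ∀ a, El n δ a → ∀ (z : X (n+1)) (r l : ℝ), 0 < r → 0 < l → ∀ A, Ell n δ A →
    ∀ β : X (n+1) → ℝ, Measurable β →
    (∀ q, 0 ≤ β q ∧ β q ≤ 2 * δ⁻¹) → (∀ q j k, |A (q.2 0) j k - a (S r z q) j k| ≤ β q) → 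
    (∫ q in Metric.ball (0 : X (n+1)) (2 * n + 10), β q ≤ c) → ∀ u, Sm u →
    ∫⁻ q in C ((2 * n + 10) * r) z, ENNReal.ofReal (H2 u q ^ σ) ≤ ENNReal.ofReal (l ^ σ) * volume (C ((2 * n + 10) * r) z) →
    ∫⁻ q in C ((2 * n + 10) * r) z, ENNReal.ofReal (Lg a u q ^ 2) ≤ ENNReal.ofReal (c * l) * volume (C ((2 * n + 10) * r) z) →
    ∫⁻ q in C r z ∩ {q | N * l < H2 u q}, ENNReal.ofReal (H2 u q) ≤ ENNReal.ofReal (κ * l) * volume (C r z) := by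
  set M : ℝ := 2 * n + 10 with hM
  have hM1 : 1 ≤ M := by rw [hM]; have : (0:ℝ) ≤ n := Nat.cast_nonneg n; linarith
  have hM0 : 0 < M := by linarith
  set C1 : ℝ := 2 ^ (n + 1 + 1) * M ^ (n + 1 + 2) with hC1
  have hC11 : 1 ≤ C1 := by
    rw [hC1]; exact one_le_mul_of_one_le_of_one_le (one_le_pow₀ (by norm_num)) (one_le_pow₀ hM1)
  have hC0 : 0 < C1 := by linarith
  obtain ⟨N, hN, h⟩ := V1 n hδ hσ hC0.le
  refine ⟨N, hN, fun κ hκ => ?_⟩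
  obtain ⟨c, hc, h⟩ := h κ hκ
  refine ⟨c / C1, by positivity, fun a ha z r l hr hl A hA β hβm hβ hAβ hβc u hu h1 h2 => ?_⟩
  set k := (Real.sqrt l)⁻¹ / r ^ 2 with hk
  have hkr : k * r ^ 2 = (Real.sqrt l)⁻¹ := by rw [hk]; field_simp
  have hkr2 : (k * r ^ 2) ^ 2 = l⁻¹ := by rw [hkr, inv_pow, Real.sq_sqrt hl.le]
  set a' := fun q => a (S r z q) with ha'
  set v := fun q => k * u (S r z q) with hv
  have hvS : Sm v := hu.S k hr z
  have hH : ∀ q, H2 v q = l⁻¹ * H2 u (S r z q) := fun q => by rw [hv, H2_S hu, hkr2]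
  have hL : ∀ q, Lg a' v q ^ 2 = l⁻¹ * Lg a u (S r z q) ^ 2 := fun q => by rw [hv, ha', Lg_S hu, mul_pow, hkr2]
  have ha2 : El n δ a' := ⟨fun j k => (ha.meas j k).comp (S_meas r z), fun q => ha.em _⟩
  have hLm : Measurable (Lg a u) := (Lg_bm hδ ha hu).1
  have hHm : Measurable (H2 u) := hu.H2.cont.measurable
  have hr2 : ∀ i : ℕ, ENNReal.ofReal ((r ^ i)⁻¹) * ENNReal.ofReal (r ^ i) = 1 := fun i => by
    rw [← ENNReal.ofReal_mul (by positivity), inv_mul_cancel₀ (by positivity), ENNReal.ofReal_one]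
  -- generic transfer
  have tr : ∀ (f : X (n+1) → ℝ) (w : ℝ), 0 ≤ w → Measurable f → 
      ∫⁻ q in C (M * r) z, ENNReal.ofReal (f q) ≤ ENNReal.ofReal w * volume (C (M * r) z) →
      ∫⁻ q in Metric.ball (0 : X (n+1)) M, ENNReal.ofReal (f (S r z q)) ≤ ENNReal.ofReal (w * C1) := by
    intro f w hw hf hle
    calc _ ≤ ∫⁻ q in S r z ⁻¹' (C (M * r) z), ENNReal.ofReal (f (S r z q)) := by
          rw [S_C hr]; exact lintegral_mono_set (ball_C hM1)
      _ = ENNReal.ofReal ((r ^ (n + 1 + 2))⁻¹) * ∫⁻ q in C (M * r) z, ENNReal.ofReal (f q) :=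
          chv hr z hf.ennreal_ofReal (C_ms _ _)
      _ ≤ ENNReal.ofReal ((r ^ (n + 1 + 2))⁻¹) * (ENNReal.ofReal w * volume (C (M * r) z)) := mul_le_mul_right hle _
      _ = _ := by
        rw [C_vol (by positivity), ← ENNReal.ofReal_mul hw, ← ENNReal.ofReal_mul (by positivity)]
        congr 1; rw [hC1, mul_pow]; field_simp
  have g1 : ∫ q in Metric.ball (0 : X (n+1)) M, H2 v q ^ σ ≤ C1 := by
    refine toR (hvS.H2.cont.measurable.pow_const σ) (fun q => Real.rpow_nonneg (H2_nonneg _ _) _) hC0.le ?_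
    have := tr _ _ (by positivity) (hHm.pow_const σ) h1
    have e : ∀ q, ENNReal.ofReal (H2 v q ^ σ) = ENNReal.ofReal ((l ^ σ)⁻¹) * ENNReal.ofReal (H2 u (S r z q) ^ σ) := fun q => by
      rw [hH, ← ENNReal.ofReal_mul (by positivity), Real.mul_rpow (by positivity) (H2_nonneg _ _), Real.inv_rpow hl.le]
    simp_rw [e]
    rw [lintegral_const_mul' _ _ ENNReal.ofReal_ne_top]
    refine (mul_le_mul_right this _).trans (le_of_eq ?_)
    rw [← ENNReal.ofReal_mul (by positivity), ← mul_assoc, inv_mul_cancel₀ (by positivity), one_mul]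
  have g2 : ∫ q in Metric.ball (0 : X (n+1)) M, Lg a' v q ^ 2 ≤ c := by
    refine toR ((Lg_bm hδ ha2 hvS).1.pow_const 2) (fun q => sq_nonneg _) hc.le ?_
    have := tr _ _ (by positivity) (hLm.pow_const 2) h2
    have e : ∀ q, ENNReal.ofReal (Lg a' v q ^ 2) = ENNReal.ofReal (l⁻¹) * ENNReal.ofReal (Lg a u (S r z q) ^ 2) := fun q => by
      rw [hL, ← ENNReal.ofReal_mul (by positivity)]
    simp_rw [e]
    rw [lintegral_const_mul' _ _ ENNReal.ofReal_ne_top]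
    refine (mul_le_mul_right this _).trans (le_of_eq ?_)
    rw [← ENNReal.ofReal_mul (by positivity)]; congr 1; field_simp
  have g3 := h a' ha2 A hA β hβm hβ hAβ v hvS (hβc.trans (div_le_self hc.le hC11)) g1 g2
  have hset : MeasurableSet {q | N * l < H2 u q} := measurableSet_lt measurable_const hHm
  have e1 : S r z ⁻¹' (C r z ∩ {q | N * l < H2 u q}) = Metric.ball (0 : X (n+1)) 1 ∩ {q | N < H2 v q} := by
    rw [preimage_inter]
    congr 1
    · have := S_C hr z 1
      rw [one_mul] at this; rw [this, C_one]
    · ext q; simp only [mem_preimage, mem_setOf_eq, hH]; rw [lt_inv_mul_iff₀ hl, mul_comm]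
  have e2 := chv hr z (f := fun q => ENNReal.ofReal (H2 u q)) hHm.ennreal_ofReal ((C_ms r z).inter hset)
  rw [e1] at e2
  have e3 : ∫⁻ q in Metric.ball (0 : X (n+1)) 1 ∩ {q | N < H2 v q}, ENNReal.ofReal (H2 u (S r z q)) =
      ENNReal.ofReal l * ∫⁻ q in Metric.ball (0 : X (n+1)) 1 ∩ {q | N < H2 v q}, ENNReal.ofReal (H2 v q) := by
    rw [← lintegral_const_mul _ hvS.H2.cont.measurable.ennreal_ofReal]
    congr 1; funext q
    rw [← ENNReal.ofReal_mul hl.le, hH, mul_inv_cancel_left₀ hl.ne']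
  rw [← ofReal_integral_eq_lintegral_ofReal hvS.H2.integrable.integrableOn (Eventually.of_forall fun q => H2_nonneg _ _)] at e3
  have e4 : ∫⁻ q in C r z ∩ {q | N * l < H2 u q}, ENNReal.ofReal (H2 u q) ≤ ENNReal.ofReal (r ^ (n + 1 + 2)) * (ENNReal.ofReal l * ENNReal.ofReal κ) := by
    have := congrArg (fun x => ENNReal.ofReal (r ^ (n + 1 + 2)) * x) e2
    beta_reduce at this
    rw [← mul_assoc, mul_comm (ENNReal.ofReal (r ^ (n + 1 + 2))) (ENNReal.ofReal (r ^ (n + 1 + 2))⁻¹), hr2, one_mul] at this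
    rw [← this, e3]
    exact mul_le_mul_right (mul_le_mul_right (ENNReal.ofReal_le_ofReal g3) _) _
  refine e4.trans ?_
  rw [C_vol hr, ← ENNReal.ofReal_mul hl.le, ← ENNReal.ofReal_mul (by positivity), ← ENNReal.ofReal_mul (by positivity)]
  refine ENNReal.ofReal_le_ofReal ?_
  have : (1:ℝ) ≤ 2 ^ (n + 1 + 1) := one_le_pow₀ (by norm_num)
  calc r ^ (n + 1 + 2) * (l * κ) = 1 * (κ * l * r ^ (n + 1 + 2)) := by ring
    _ ≤ 2 ^ (n + 1 + 1) * (κ * l * r ^ (n + 1 + 2)) := mul_le_mul_of_nonneg_right this (by positivity)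
    _ = _ := by ring

end KK
end

section
open MeasureTheory Set Filter Topology
open scoped ENNReal
namespace KK

/-- max norm of a difference -/
noncomputable def mx {n : ℕ} (A B : Fin (n+1) → Fin (n+1) → ℝ) : ℝ := ⨆ j, ⨆ k, |A j k - B j k|

lemma le_mx {n : ℕ} (A B : Fin (n+1) → Fin (n+1) → ℝ) (j k) : |A j k - B j k| ≤ mx A B :=
  (le_ciSup (f := fun k => |A j k - B j k|) (Finite.bddAbove_range _) k).trans
    (le_ciSup (f := fun j => ⨆ k, |A j k - B j k|) (Finite.bddAbove_range _) j)

lemma mx_nonneg {n : ℕ} (A B : Fin (n+1) → Fin (n+1) → ℝ) : 0 ≤ mx A B := (abs_nonneg _).trans (le_mx A B 0 0)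

lemma mx_le {n : ℕ} {δ : ℝ} (hδ : 0 < δ) {A B : Fin (n+1) → Fin (n+1) → ℝ} (hA : EM δ A) (hB : EM δ B) : mx A B ≤ 2 * δ⁻¹ := by
  refine ciSup_le fun j => ciSup_le fun k => ?_
  have h1 := hA.bound hδ j k
  have h2 := hB.bound hδ j k
  have := abs_sub (A j k) (B j k)
  linarith

/-- join -/
def jn {n : ℕ} (τ : ℝ) (s : ℝ × (Fin n → ℝ)) : X (n+1) := (s.1, Fin.cons τ s.2)

lemma jn_meas {n : ℕ} {α : Type*} [MeasurableSpace α] {f : α → ℝ} {g : α → ℝ × (Fin n → ℝ)} (hf : Measurable f) (hg : Measurable g) :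
    Measurable fun x => jn (f x) (g x) := by
  refine hg.fst.prodMk (measurable_pi_iff.2 fun i => ?_)
  refine Fin.cases ?_ (fun j => ?_) i
  · simpa using hf
  · simp only [Fin.cons_succ]; exact (measurable_pi_apply j).comp hg.snd

/-- the other coordinates -/
def tl {n : ℕ} (q : X (n+1)) : ℝ × (Fin n → ℝ) := (q.1, fun j => q.2 j.succ)

lemma tl_meas {n : ℕ} : Measurable (tl : X (n+1) → _) :=
  measurable_fst.prodMk (measurable_pi_iff.2 fun j => (measurable_pi_apply j.succ).comp measurable_snd)

lemma jn_tl {n : ℕ} (q : X (n+1)) : jn (q.2 0) (tl q) = q := by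
  refine Prod.ext rfl (funext fun i => ?_)
  refine Fin.cases ?_ (fun j => ?_) i <;> simp [jn, tl]

lemma tl_jn {n : ℕ} (τ : ℝ) (s : ℝ × (Fin n → ℝ)) : tl (jn τ s) = s := by simp [jn, tl]

lemma jn0 {n : ℕ} (τ : ℝ) (s : ℝ × (Fin n → ℝ)) : (jn τ s).2 0 = τ := by simp [jn]

lemma mx_meas {n : ℕ} {α : Type*} [MeasurableSpace α] {A B : α → Fin (n+1) → Fin (n+1) → ℝ}
    (hA : ∀ j k, Measurable fun x => A x j k) (hB : ∀ j k, Measurable fun x => B x j k) : Measurable fun x => mx (A x) (B x) := by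
  unfold mx
  refine Measurable.iSup fun j => Measurable.iSup fun k => ?_
  have := (hA j k).sub (hB j k)
  exact this.abs

lemma splitX {n : ℕ} {g : X (n+1) → ℝ≥0∞} (hg : Measurable g) :
    ∫⁻ q, g q = ∫⁻ τ, ∫⁻ s : ℝ × (Fin n → ℝ), g (jn τ s) := by
  have hm : Measurable fun w : ℝ × (ℝ × (Fin n → ℝ)) => g (jn w.1 w.2) := hg.comp (jn_meas measurable_fst measurable_snd)
  have hx : ∀ t : ℝ, ∫⁻ x : Fin (n+1) → ℝ, g (t, x) = ∫⁻ τ : ℝ, ∫⁻ y : Fin n → ℝ, g (jn τ (t, y)) := by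
    intro t
    have h := volume_preserving_piFinSuccAbove (fun _ : Fin (n+1) => ℝ) 0
    have hm2 : Measurable fun w : ℝ × (Fin n → ℝ) => g (jn w.1 (t, w.2)) :=
      hg.comp (jn_meas measurable_fst (measurable_const.prodMk measurable_snd))
    have e := h.lintegral_comp hm2
    rw [Measure.volume_eq_prod, lintegral_prod _ hm2.aemeasurable] at e
    rw [← e]
    congr 1; funext x
    exact congrArg g (jn_tl ((t, x) : X (n+1))).symm
  rw [Measure.volume_eq_prod, lintegral_prod _ hg.aemeasurable]
  simp_rw [hx]
  have hm3 : Measurable fun w : (ℝ × ℝ) × (Fin n → ℝ) => g (jn w.1.2 (w.1.1, w.2)) :=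
    hg.comp (jn_meas measurable_fst.snd (measurable_fst.fst.prodMk measurable_snd))
  have hm4 : Measurable fun w : ℝ × ℝ => ∫⁻ y : Fin n → ℝ, g (jn w.2 (w.1, y)) := hm3.lintegral_prod_right'
  rw [lintegral_lintegral_swap hm4.aemeasurable]
  congr 1; funext τ
  have hm5 : Measurable fun s : ℝ × (Fin n → ℝ) => g (jn τ s) := hg.comp (jn_meas measurable_const measurable_id)
  rw [Measure.volume_eq_prod, lintegral_prod _ hm5.aemeasurable]

lemma ofR {α β : Type*} [MeasurableSpace α] [MeasurableSpace β] {ν : Measure β} [IsFiniteMeasure ν] {h : α → β → ℝ}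
    (hm : Measurable (Function.uncurry h)) {B : ℝ} (hB : ∀ a b, 0 ≤ h a b ∧ h a b ≤ B) :
    (Measurable fun a => ∫ b, h a b ∂ν) ∧ (∀ a, 0 ≤ ∫ b, h a b ∂ν ∧ ∫ b, h a b ∂ν ≤ B * ν.real univ) ∧
      ∀ a, ENNReal.ofReal (∫ b, h a b ∂ν) = ∫⁻ b, ENNReal.ofReal (h a b) ∂ν := by
  have hma : ∀ a, Measurable (h a) := fun a => hm.comp measurable_prodMk_left
  have hi : ∀ a, Integrable (h a) ν := fun a =>
    Integrable.of_bound (hma a).aestronglyMeasurable B (Eventually.of_forall fun b => by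
      rw [Real.norm_eq_abs, abs_of_nonneg (hB a b).1]; exact (hB a b).2)
  refine ⟨(StronglyMeasurable.integral_prod_right hm.stronglyMeasurable).measurable, fun a => ⟨integral_nonneg fun b => (hB a b).1, ?_⟩, fun a => ?_⟩
  · calc _ ≤ ∫ b, B ∂ν := integral_mono (hi a) (integrable_const _) fun b => (hB a b).2
      _ = _ := by rw [integral_const, smul_eq_mul, mul_comm]
  · exact ofReal_integral_eq_lintegral_ofReal (hi a) (Eventually.of_forall fun b => (hB a b).1)

section bC
variable {n : ℕ} {r : ℝ}

lemma bC_open (x : Fin n → ℝ) : IsOpen (ballC r x) := by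
  unfold ballC; exact isOpen_lt (by fun_prop) continuous_const

lemma bC_sub (hr : 0 < r) (x : Fin n → ℝ) : ballC r x ⊆ Metric.ball x r := by
  intro y hy
  rw [ball_pi _ hr]
  intro j _
  rw [Metric.mem_ball, Real.dist_eq]
  refine abs_lt_of_sq_lt_sq (lt_of_le_of_lt ?_ hy) hr.le
  exact Finset.single_le_sum (f := fun j => (y j - x j) ^ 2) (fun j _ => sq_nonneg _) (Finset.mem_univ j)

lemma bC_vol (x : Fin n → ℝ) : volume (ballC r x) = volume (ballC r (0 : Fin n → ℝ)) := by
  have : ballC r x = (fun y => y + (-x)) ⁻¹' ballC r 0 := by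
    ext y; simp [ballC, sub_eq_add_neg]
  rw [this, measure_preimage_add_right]

lemma bC_le (hr : 0 < r) : volume (ballC r (0 : Fin n → ℝ)) ≤ ENNReal.ofReal ((2 * r) ^ n) := by
  refine (measure_mono (bC_sub hr 0)).trans (le_of_eq ?_)
  rw [Real.volume_pi_ball _ hr]; simp

lemma bC_pos (hr : 0 < r) : 0 < volume (ballC r (0 : Fin n → ℝ)) :=
  (bC_open _).measure_pos _ ⟨0, by simp only [ballC, mem_setOf_eq, sub_self]; simpa using pow_pos hr 2⟩

lemma bC_top (hr : 0 < r) : volume (ballC r (0 : Fin n → ℝ)) ≠ ⊤ := ne_top_of_le_ne_top ENNReal.ofReal_ne_top (bC_le hr)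

lemma G_ms (t : ℝ) (x : Fin n → ℝ) : MeasurableSet (GammaC r t x) := measurableSet_Ioo.prod (bC_open x).measurableSet

lemma G_vol (hr : 0 < r) (t : ℝ) (x : Fin n → ℝ) :
    volume (GammaC r t x) = ENNReal.ofReal (r ^ 2 * (volume (ballC r (0 : Fin n → ℝ))).toReal) := by
  unfold GammaC
  rw [Measure.volume_eq_prod, Measure.prod_prod, bC_vol, Real.volume_Ioo, ENNReal.ofReal_mul (by positivity), ENNReal.ofReal_toReal (bC_top hr)]
  congr 2; ring

end bC

lemma osc_I {n : ℕ} {δ : ℝ} (hδ : 0 < δ) {a} (ha : El n δ a) {r : ℝ} (hr : 0 < r) (t : ℝ) (x : Fin (n+1) → ℝ) :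
    ∃ I : ℝ, 0 ≤ I ∧ oscA a r t x = (r ^ 5)⁻¹ * (((volume (ballC r (0 : Fin n → ℝ))).toReal) ^ 2)⁻¹ * I ∧
      I ≤ 2 * δ⁻¹ * (r ^ 2 * (volume (ballC r (0 : Fin n → ℝ))).toReal) * (r ^ 2 * (volume (ballC r (0 : Fin n → ℝ))).toReal) * (2 * r) ∧
      ENNReal.ofReal I = ∫⁻ τ in Ioo (x 0 - r) (x 0 + r), ∫⁻ s₁ in GammaC r t (fun j : Fin n => x j.succ),
        ∫⁻ s₂ in GammaC r t (fun j : Fin n => x j.succ), ENNReal.ofReal (mx (a (jn τ s₁)) (a (jn τ s₂))) := by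
  set Γ := GammaC r t (fun j : Fin n => x j.succ) with hΓ
  have hv := G_vol hr t (fun j : Fin n => x j.succ)
  set b := (volume (ballC r (0 : Fin n → ℝ))).toReal with hb
  have hb0 : 0 ≤ b := ENNReal.toReal_nonneg
  rw [← hΓ] at hv
  haveI : IsFiniteMeasure (volume.restrict Γ) := ⟨by rw [Measure.restrict_apply_univ, hv]; exact ENNReal.ofReal_lt_top⟩
  have hvr : (volume.restrict Γ).real univ = r ^ 2 * b := by
    rw [Measure.real, Measure.restrict_apply_univ, hv, ENNReal.toReal_ofReal (by positivity)]
  have m1 : Measurable (Function.uncurry fun (w : ℝ × (ℝ × (Fin n → ℝ))) (s : ℝ × (Fin n → ℝ)) => mx (a (jn w.1 w.2)) (a (jn w.1 s))) := by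
    refine mx_meas (fun j k => ?_) (fun j k => ?_)
    · exact (ha.meas j k).comp (jn_meas measurable_fst.fst measurable_fst.snd)
    · exact (ha.meas j k).comp (jn_meas measurable_fst.fst measurable_snd)
  obtain ⟨m2, b2, e2⟩ := ofR (ν := volume.restrict Γ) m1 (B := 2 * δ⁻¹) (fun w s => ⟨mx_nonneg _ _, mx_le hδ (ha.em _) (ha.em _)⟩)
  rw [hvr] at b2
  obtain ⟨m3, b3, e3⟩ := ofR (ν := volume.restrict Γ) (h := fun τ s₁ => ∫ s₂ in Γ, mx (a (jn τ s₁)) (a (jn τ s₂))) m2 (fun τ s => b2 (τ, s))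
  rw [hvr] at b3
  obtain ⟨_, b4, e4⟩ := ofR (α := Unit) (ν := volume.restrict (Ioo (x 0 - r) (x 0 + r)))
    (h := fun _ τ => ∫ s₁ in Γ, ∫ s₂ in Γ, mx (a (jn τ s₁)) (a (jn τ s₂))) (m3.comp measurable_snd) (fun _ τ => b3 τ)
  refine ⟨∫ τ in Ioo (x 0 - r) (x 0 + r), ∫ s₁ in Γ, ∫ s₂ in Γ, mx (a (jn τ s₁)) (a (jn τ s₂)), (b4 ()).1, rfl, (b4 ()).2.trans (le_of_eq ?_), ?_⟩
  · rw [Measure.real, Measure.restrict_apply_univ, Real.volume_Ioo, ENNReal.toReal_ofReal (by linarith)]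
    ring
  · rw [e4 ()]
    refine lintegral_congr fun τ => (e3 τ).trans (lintegral_congr fun s => e2 (τ, s))

lemma osc_le {n : ℕ} {δ : ℝ} (hδ : 0 < δ) {a} (ha : El n δ a) {r : ℝ} (hr : 0 < r) (t : ℝ) (x : Fin (n+1) → ℝ) : oscA a r t x ≤ 4 * δ⁻¹ := by
  obtain ⟨I, _, h, hI, _⟩ := osc_I hδ ha hr t x
  have hb : 0 < (volume (ballC r (0 : Fin n → ℝ))).toReal := ENNReal.toReal_pos (bC_pos hr).ne' (bC_top hr)
  rw [h]
  refine (mul_le_mul_of_nonneg_left hI (by positivity)).trans (le_of_eq ?_)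
  field_simp; ring

lemma osc_sharp {n : ℕ} {δ : ℝ} (hδ : 0 < δ) {a} (ha : El n δ a) {r R : ℝ} (hr : 0 < r) (hR : r ≤ R) (t : ℝ) (x : Fin (n+1) → ℝ) :
    oscA a r t x ≤ aSharp a R := by
  have hB : 0 ≤ 4 * δ⁻¹ := by positivity
  have h1 : oscA a r t x ≤ ⨆ r : {r : ℝ // 0 < r ∧ r ≤ R}, oscA a r.val t x :=
    le_ciSup (f := fun r : {r : ℝ // 0 < r ∧ r ≤ R} => oscA a r.val t x) ⟨4 * δ⁻¹, by rintro _ ⟨ρ, rfl⟩; exact osc_le hδ ha ρ.2.1 t x⟩ ⟨r, hr, hR⟩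
  refine h1.trans ?_
  refine le_ciSup (f := fun z : ℝ × (Fin (n+1) → ℝ) => ⨆ r : {r : ℝ // 0 < r ∧ r ≤ R}, oscA a r.val z.1 z.2) ⟨4 * δ⁻¹, ?_⟩ (t, x)
  rintro _ ⟨z, rfl⟩
  exact Real.iSup_le (fun ρ => osc_le hδ ha ρ.2.1 _ _) hB

lemma exists_le_lintegral_div {β : Type*} [MeasurableSpace β] {ν : Measure β} [IsFiniteMeasure ν] {J : β → ℝ≥0∞} (h0 : ν univ ≠ 0) (hJ : Measurable J) :
    ∃ s, J s ≤ (∫⁻ y, J y ∂ν) / ν univ := by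
  obtain ⟨s, -, hs⟩ := exists_le_setLAverage (μ := ν) (s := univ) (f := J) h0 (measure_ne_top _ _) hJ.aemeasurable
  rw [setLAverage_eq, Measure.restrict_univ] at hs
  exact ⟨s, hs⟩

lemma pick {α β : Type*} [MeasurableSpace α] [MeasurableSpace β] {μ : Measure α} {ν : Measure β} [SFinite μ] [SFinite ν] {F : α → β → β → ℝ≥0∞}
    (hF : Measurable fun w : (α × β) × β => F w.1.1 w.1.2 w.2) (h0 : ν univ ≠ 0) (h1 : ν univ ≠ ⊤) :
    ∃ s, ∫⁻ x, ∫⁻ y, F x y s ∂ν ∂μ ≤ (∫⁻ x, ∫⁻ y, ∫⁻ y', F x y y' ∂ν ∂ν ∂μ) / ν univ := by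
  have m1 : Measurable fun w : (α × β) × β => F w.1.1 w.2 w.1.2 := hF.comp ((measurable_fst.fst.prodMk measurable_snd).prodMk measurable_fst.snd)
  have m2 : Measurable fun w : α × β => ∫⁻ y, F w.1 y w.2 ∂ν := m1.lintegral_prod_right'
  have hsw : Measurable fun w : β × α => (w.2, w.1) := measurable_snd.prodMk measurable_fst
  have m3 : Measurable fun w : β × α => ∫⁻ y, F w.2 y w.1 ∂ν := m2.comp hsw
  have m4 : Measurable fun s => ∫⁻ x, ∫⁻ y, F x y s ∂ν ∂μ := m3.lintegral_prod_right'
  haveI : IsFiniteMeasure ν := ⟨lt_top_iff_ne_top.2 h1⟩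
  obtain ⟨s, hs⟩ := exists_le_lintegral_div h0 m4
  refine ⟨s, hs.trans (le_of_eq ?_)⟩
  congr 1
  rw [lintegral_lintegral_swap m3.aemeasurable]
  refine lintegral_congr fun x => ?_
  refine lintegral_lintegral_swap (Measurable.aemeasurable ?_)
  have m5 : Measurable fun w : β × β => ((x, w.2), w.1) := (measurable_const.prodMk measurable_snd).prodMk measurable_fst
  exact hF.comp m5

set_option maxHeartbeats 1000000 in
lemma freeze {n : ℕ} {δ : ℝ} (hδ : 0 < δ) {a} (ha : El n δ a) {r : ℝ} (hr : 0 < r) (z : X (n+1)) {M K ε : ℝ} (hM : 1 ≤ M) (hK : K = 2 * M * (n + 1))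
    (h : oscA a (K * r) (z.1 - M * r ^ 2) z.2 ≤ ε) :
    ∃ A, Ell n δ A ∧ ∃ β : X (n+1) → ℝ, Measurable β ∧ (∀ q, 0 ≤ β q ∧ β q ≤ 2 * δ⁻¹) ∧
      (∀ q j k, |A (q.2 0) j k - a (S r z q) j k| ≤ β q) ∧ ∫ q in Metric.ball (0 : X (n+1)) M, β q ≤ ε * (K ^ (n + 3) * 2 ^ n) := by
  have hn : (0:ℝ) ≤ n := Nat.cast_nonneg n
  have hKM : M ≤ K := by rw [hK]; nlinarith
  have hK2 : 2 * M ≤ K ^ 2 := by rw [hK]; nlinarith [mul_nonneg (by linarith : (0:ℝ) ≤ M) hn]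
  have hK3 : (n + 1) * M ^ 2 ≤ K ^ 2 := by rw [hK]; nlinarith [mul_nonneg (sq_nonneg M) hn, mul_nonneg (sq_nonneg M) (sq_nonneg (n:ℝ)), sq_nonneg M]
  have hM0 : 0 < M := by linarith
  have hK0 : 0 < K := by linarith
  have hr' : 0 < K * r := by positivity
  obtain ⟨I, hI0, hI, -, hIe⟩ := osc_I hδ ha hr' (z.1 - M * r ^ 2) z.2
  have hvG := G_vol hr' (z.1 - M * r ^ 2) (fun j : Fin n => z.2 j.succ)
  have hbl : (volume (ballC (K * r) (0 : Fin n → ℝ))).toReal ≤ (2 * (K * r)) ^ n := ENNReal.toReal_le_of_le_ofReal (by positivity) (bC_le hr')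
  have hb : 0 < (volume (ballC (K * r) (0 : Fin n → ℝ))).toReal := ENNReal.toReal_pos (bC_pos hr').ne' (bC_top hr')
  set b := (volume (ballC (K * r) (0 : Fin n → ℝ))).toReal
  set Γ := GammaC (K * r) (z.1 - M * r ^ 2) (fun j : Fin n => z.2 j.succ) with hΓ
  have hΓm : MeasurableSet Γ := G_ms _ _
  set T := Ioo (z.2 0 - K * r) (z.2 0 + K * r) with hT
  rw [hI] at h
  have hε : 0 ≤ ε := le_trans (by positivity) h
  have hIle : I ≤ ε * ((K * r) ^ 5 * b ^ 2) := by
    have := mul_le_mul_of_nonneg_right h (by positivity : 0 ≤ (K * r) ^ 5 * b ^ 2)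
    refine le_trans (le_of_eq ?_) this
    field_simp
  have mF : Measurable fun w : ((ℝ × (ℝ × (Fin n → ℝ))) × (ℝ × (Fin n → ℝ))) => ENNReal.ofReal (mx (a (jn w.1.1 w.1.2)) (a (jn w.1.1 w.2))) := by
    refine (mx_meas (fun j k => ?_) (fun j k => ?_)).ennreal_ofReal
    · exact (ha.meas j k).comp (jn_meas measurable_fst.fst measurable_fst.snd)
    · exact (ha.meas j k).comp (jn_meas measurable_fst.fst measurable_snd)
  have hvp : 0 < (K * r) ^ 2 * b := mul_pos (pow_pos hr' 2) hb
  have hv0 : volume Γ ≠ 0 := by rw [hvG]; exact (ENNReal.ofReal_pos.2 hvp).ne'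
  have hv1 : volume Γ ≠ ⊤ := by rw [hvG]; exact ENNReal.ofReal_ne_top
  obtain ⟨s, hs⟩ := pick (μ := volume.restrict T) (ν := volume.restrict Γ)
    (F := fun τ s₁ s₂ => ENNReal.ofReal (mx (a (jn τ s₁)) (a (jn τ s₂)))) mF (by rwa [Measure.restrict_apply_univ]) (by rwa [Measure.restrict_apply_univ])
  rw [← hIe, Measure.restrict_apply_univ, hvG, ← ENNReal.ofReal_div_of_pos hvp] at hs
  have hJs : ∫⁻ τ in T, ∫⁻ s₁ in Γ, ENNReal.ofReal (mx (a (jn τ s₁)) (a (jn τ s))) ≤ ENNReal.ofReal (ε * ((K * r) ^ 3 * (2 * (K * r)) ^ n)) := by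
    refine hs.trans (ENNReal.ofReal_le_ofReal ?_)
    rw [div_le_iff₀ hvp]
    refine hIle.trans ?_
    calc ε * ((K * r) ^ 5 * b ^ 2) = ε * (K * r) ^ 5 * b * b := by ring
      _ ≤ ε * (K * r) ^ 5 * b * (2 * (K * r)) ^ n := mul_le_mul_of_nonneg_left hbl (by positivity)
      _ = _ := by ring
  -- definitions
  set g : X (n+1) → ℝ := fun q => mx (a q) (a (jn (q.2 0) s)) with hg
  have h0m : Measurable fun q : X (n+1) => q.2 0 := (measurable_pi_apply 0).comp measurable_snd
  have hgm : Measurable g := mx_meas ha.meas (fun j k => (ha.meas j k).comp (jn_meas h0m measurable_const))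
  set β : X (n+1) → ℝ := fun q => g (S r z q) with hβ
  have hβm : Measurable β := hgm.comp (S_meas r z)
  refine ⟨fun τ => a (jn (z.2 0 + r * τ) s), ⟨fun j k => (ha.meas j k).comp (jn_meas (by fun_prop) measurable_const), fun τ => ha.em _⟩, β, hβm,
    fun q => ⟨mx_nonneg _ _, mx_le hδ (ha.em _) (ha.em _)⟩, fun q j k => ?_, ?_⟩
  · rw [abs_sub_comm]
    exact le_mx (a (S r z q)) (a (jn (z.2 0 + r * q.2 0) s)) j k
  · refine toR hβm (fun q => mx_nonneg _ _) (by positivity) ?_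
    set B : Set (X (n+1)) := {q | q.2 0 ∈ T ∧ tl q ∈ Γ} with hB
    have hBm : MeasurableSet B := (h0m measurableSet_Ioo).inter (tl_meas hΓm)
    have hsub : Metric.ball (0 : X (n+1)) M ⊆ S r z ⁻¹' B := by
      intro q hq
      rw [← Prod.mk_zero_zero, ← ball_prod_same, ball_pi _ hM0] at hq
      have q1 : |q.1| < M := by simpa [Real.dist_eq] using hq.1
      have q2 : ∀ i, |q.2 i| < M := fun i => by simpa [Real.dist_eq] using hq.2 i (mem_univ i)
      have r2 : 0 < r ^ 2 := by positivity
      refine ⟨?_, ?_, ?_⟩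
      · have h3 := abs_lt.1 (q2 0)
        have : (S r z q).2 0 = z.2 0 + r * q.2 0 := rfl
        rw [this, hT, mem_Ioo]
        constructor <;> nlinarith
      · have h3 := abs_lt.1 q1
        have : (tl (S r z q)).1 = z.1 + r ^ 2 * q.1 := rfl
        rw [this, mem_Ioo]
        constructor <;> nlinarith
      · have : ∀ j, (tl (S r z q)).2 j - z.2 j.succ = r * q.2 j.succ := fun j => by
          have : (tl (S r z q)).2 j = z.2 j.succ + r * q.2 j.succ := rfl
          rw [this]; ring
        simp only [ballC, mem_setOf_eq, this]
        calc ∑ j : Fin n, (r * q.2 j.succ) ^ 2 ≤ ∑ j : Fin n, r ^ 2 * M ^ 2 := Finset.sum_le_sum fun j _ => by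
              rw [mul_pow]; refine mul_le_mul_of_nonneg_left ?_ r2.le
              exact sq_le_sq' (abs_lt.1 (q2 j.succ)).1.le (abs_lt.1 (q2 j.succ)).2.le
          _ = r ^ 2 * (n * M ^ 2) := by rw [Finset.sum_const, Finset.card_univ, Fintype.card_fin, nsmul_eq_mul]; ring
          _ < r ^ 2 * ((n + 1) * M ^ 2) := by nlinarith [mul_pos r2 (pow_pos hM0 2)]
          _ ≤ r ^ 2 * K ^ 2 := mul_le_mul_of_nonneg_left hK3 r2.le
          _ = _ := by ring
    have hBJ : ∫⁻ q in B, ENNReal.ofReal (g q) = ∫⁻ τ in T, ∫⁻ s₁ in Γ, ENNReal.ofReal (mx (a (jn τ s₁)) (a (jn τ s))) := by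
      rw [← lintegral_indicator hBm, splitX (hgm.ennreal_ofReal.indicator hBm)]
      rw [← lintegral_indicator measurableSet_Ioo]
      refine lintegral_congr fun τ => ?_
      by_cases hτ : τ ∈ T
      · rw [indicator_of_mem hτ, ← lintegral_indicator hΓm]
        refine lintegral_congr fun s₁ => ?_
        by_cases h1 : s₁ ∈ Γ
        · rw [indicator_of_mem h1, indicator_of_mem (by exact ⟨by rwa [jn0], by rwa [tl_jn]⟩), hg]; simp only [jn0]
        · rw [indicator_of_notMem h1, indicator_of_notMem (fun hh => h1 (by have := hh.2; rwa [tl_jn] at this))]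
      · rw [indicator_of_notMem hτ]
        rw [lintegral_congr (g := fun _ => 0), lintegral_zero]
        intro s₁
        exact indicator_of_notMem (fun hh => hτ (by have := hh.1; rwa [jn0] at this)) _
    calc _ ≤ ∫⁻ q in S r z ⁻¹' B, ENNReal.ofReal (g (S r z q)) := lintegral_mono_set hsub
      _ = _ := chv hr z hgm.ennreal_ofReal hBm
      _ ≤ ENNReal.ofReal ((r ^ (n + 1 + 2))⁻¹) * ENNReal.ofReal (ε * ((K * r) ^ 3 * (2 * (K * r)) ^ n)) := by
        rw [hBJ]; exact mul_le_mul_right hJs _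
      _ = _ := by
        rw [← ENNReal.ofReal_mul (by positivity)]
        congr 1
        rw [mul_pow, mul_pow 2, mul_pow K r n]; field_simp; ring

end KK
end

section
open MeasureTheory Set Filter Topology
open scoped ENNReal
namespace KK

lemma large {m : ℕ} {σ τ l r R M κ : ℝ} (hσ : 1 < σ) {G : X m → ℝ} (hm : Measurable G) (h0 : ∀ q, 0 ≤ G q) (hR : 0 < R)
    (hs : ∀ q, q ∉ C R 0 → G q = 0) (hτ : 0 < τ) (hl : 0 < l) (hr : 0 < r) (hM : 1 ≤ M) (hκ : 0 < κ)
    (h1 : τ * R ^ (m + 2) ≤ κ / 2 * r ^ (m + 2)) (h2 : τ ^ (1 - σ) * M ^ (m + 2) ≤ κ / 2) (z : X m)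
    (h : ∫⁻ q in C (M * r) z, ENNReal.ofReal (G q ^ σ) ≤ ENNReal.ofReal (l ^ σ) * volume (C (M * r) z)) :
    ∫⁻ q in C r z, ENNReal.ofReal (G q) ≤ ENNReal.ofReal (κ * l) * volume (C r z) := by
  have hM0 : 0 < M := by linarith
  have hT : 0 < τ * l := mul_pos hτ hl
  have hp : ∀ q, ENNReal.ofReal (G q) ≤ (C R (0 : X m)).indicator (fun _ => ENNReal.ofReal (τ * l)) q +
      ENNReal.ofReal ((τ * l) ^ (1 - σ)) * ENNReal.ofReal (G q ^ σ) := by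
    intro q
    by_cases hq : q ∈ C R (0 : X m)
    · rw [indicator_of_mem hq, ← ENNReal.ofReal_mul (by positivity), ← ENNReal.ofReal_add hT.le (mul_nonneg (by positivity) (Real.rpow_nonneg (h0 q) _))]
      refine ENNReal.ofReal_le_ofReal ?_
      have := trunc (h0 q) hT hσ zero_le_one le_rfl
      simpa using this
    · rw [hs q hq]; simp
  have hsub : C r z ⊆ C (M * r) z := by
    have : r ≤ M * r := by nlinarith
    exact prod_mono (Metric.ball_subset_ball (pow_le_pow_left₀ hr.le this 2)) (Metric.ball_subset_ball this)
  calc _ ≤ ∫⁻ q in C r z, ((C R (0 : X m)).indicator (fun _ => ENNReal.ofReal (τ * l)) q +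
        ENNReal.ofReal ((τ * l) ^ (1 - σ)) * ENNReal.ofReal (G q ^ σ)) := lintegral_mono hp
    _ = (∫⁻ q in C r z, (C R (0 : X m)).indicator (fun _ => ENNReal.ofReal (τ * l)) q) +
        ENNReal.ofReal ((τ * l) ^ (1 - σ)) * ∫⁻ q in C r z, ENNReal.ofReal (G q ^ σ) := by
      rw [lintegral_add_left (measurable_const.indicator (C_ms _ _)), lintegral_const_mul' _ _ ENNReal.ofReal_ne_top]
    _ ≤ ENNReal.ofReal (τ * l) * volume (C R (0 : X m)) +
        ENNReal.ofReal ((τ * l) ^ (1 - σ)) * (ENNReal.ofReal (l ^ σ) * volume (C (M * r) z)) := by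
      refine add_le_add ?_ (mul_le_mul_right ((lintegral_mono_set hsub).trans h) _)
      refine (setLIntegral_le_lintegral _ _).trans (le_of_eq ?_)
      rw [lintegral_indicator (C_ms _ _), setLIntegral_const]
    _ ≤ _ := by
      rw [C_vol hR, C_vol (by positivity), C_vol hr, ← ENNReal.ofReal_mul (by positivity), ← ENNReal.ofReal_mul (by positivity),
        ← ENNReal.ofReal_mul (by positivity), ← ENNReal.ofReal_mul (by positivity), ← ENNReal.ofReal_add (by positivity) (by positivity)]
      refine ENNReal.ofReal_le_ofReal ?_
      have e : (τ * l) ^ (1 - σ) * l ^ σ = τ ^ (1 - σ) * l := by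
        rw [Real.mul_rpow hτ.le hl.le, mul_assoc, ← Real.rpow_add hl]; simp
      have i1 := mul_le_mul_of_nonneg_left h1 (by positivity : 0 ≤ l * 2 ^ (m + 1))
      have i2 := mul_le_mul_of_nonneg_left h2 (by positivity : 0 ≤ l * 2 ^ (m + 1) * r ^ (m + 2))
      calc _ = l * 2 ^ (m + 1) * (τ * R ^ (m + 2)) + ((τ * l) ^ (1 - σ) * l ^ σ) * (2 ^ (m + 1) * (M * r) ^ (m + 2)) := by ring
        _ = l * 2 ^ (m + 1) * (τ * R ^ (m + 2)) + l * 2 ^ (m + 1) * r ^ (m + 2) * (τ ^ (1 - σ) * M ^ (m + 2)) := by rw [e, mul_pow]; ring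
        _ ≤ _ := add_le_add i1 i2
        _ = _ := by ring

lemma H2_supp {m : ℕ} {u : X m → ℝ} {q : X m} (hq : q ∉ tsupport u) : H2 u q = 0 := by
  have ho : IsOpen (tsupport u)ᶜ := (isClosed_tsupport u).isOpen_compl
  have h0 : EqOn u (fun _ => 0) (tsupport u)ᶜ := fun x hx => image_eq_zero_of_notMem_tsupport hx
  have hz : ∀ e : X m, dd e (fun _ : X m => (0:ℝ)) = fun _ => 0 := fun e => by funext x; simp [dd]
  unfold H2
  refine Finset.sum_eq_zero fun j _ => Finset.sum_eq_zero fun k _ => ?_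
  have h1 := dd_congr ho h0 (ex k)
  rw [hz] at h1
  have h2 := dd_congr ho h1 (ex j)
  rw [hz] at h2
  rw [h2 hq]; simp

lemma supp_C {n : ℕ} {u : X (n+1) → ℝ} {R : ℝ} (hR : 0 < R) (hs : Function.support u ⊆ Qcyl R (0 : ℝ × (Fin (n + 1) → ℝ))) :
    HasCompactSupport u ∧ tsupport u ⊆ C (2 * R) 0 := by
  have h1 : tsupport u ⊆ Metric.closedBall (0:ℝ) (R ^ 2) ×ˢ Metric.closedBall (0 : Fin (n+1) → ℝ) R := by
    refine closure_minimal (hs.trans ?_) (Metric.isClosed_closedBall.prod Metric.isClosed_closedBall)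
    refine prod_mono (fun t ht => ?_) ((bC_sub hR _).trans Metric.ball_subset_closedBall)
    simp only [Prod.fst_zero, zero_add, mem_Ioo] at ht
    rw [mem_closedBall_zero_iff, Real.norm_eq_abs, abs_of_pos ht.1]; exact ht.2.le
  refine ⟨(((isCompact_closedBall _ _).prod (isCompact_closedBall _ _)).of_isClosed_subset (isClosed_tsupport u) h1), h1.trans ?_⟩
  exact prod_mono (Metric.closedBall_subset_ball (by nlinarith [pow_pos hR 2])) (Metric.closedBall_subset_ball (by linarith))

lemma main (n : ℕ) {δ : ℝ} (hδ : 0 < δ) {P : ℝ} (hP : 1 < P) : ∃ K : ℝ, 0 < K ∧ ∀ ω : ℝ → ℝ, ContinuousOn ω (Ici 0) → ω 0 = 0 →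
    ∃ R : ℝ, 0 < R ∧ ∀ a, El n δ a → (∀ R' : ℝ, 0 ≤ R' → aSharp a R' ≤ ω R') → ∀ u : X (n+1) → ℝ, Sm u → tsupport u ⊆ C (2 * R) 0 →
      ∫ q, H2 u q ^ P ≤ K * ∫ q, (Lg a u q ^ 2) ^ P := by
  set σ := (1 + P) / 2 with hσd
  have hσ : 1 < σ := by rw [hσd]; linarith
  have hσP : σ < P := by rw [hσd]; linarith
  obtain ⟨N, hN, hV⟩ := V2 n hδ hσ
  have hn : (0:ℝ) ≤ n := Nat.cast_nonneg n
  set M : ℝ := 2 * n + 10 with hM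
  have hM1 : 1 ≤ M := by rw [hM]; linarith
  have hM0 : 0 < M := by linarith
  obtain ⟨κ, hκ, hRV⟩ := RV (n+1) hσ hσP hM1 hN
  obtain ⟨c, hc, hV⟩ := hV κ hκ
  obtain ⟨K, hK, hRV⟩ := hRV c hc
  refine ⟨K, hK, fun ω hω hω0 => ?_⟩
  set K1 : ℝ := 2 * M * (n + 1) with hK1
  have hK10 : 0 < K1 := by positivity
  set D : ℝ := K1 ^ (n + 3) * 2 ^ n with hD
  have hD0 : 0 < D := by positivity
  obtain ⟨R0, hR0, hωR⟩ : ∃ R0 : ℝ, 0 < R0 ∧ ω R0 ≤ c / D := by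
    have h1 := Metric.continuousWithinAt_iff.1 (hω 0 self_mem_Ici) (c / D) (by positivity)
    obtain ⟨e, he, h1⟩ := h1
    refine ⟨e / 2, by positivity, ?_⟩
    have h2 := h1 (x := e / 2) (mem_Ici.2 (by positivity)) (by rw [Real.dist_eq, sub_zero, abs_of_pos (by positivity)]; linarith)
    rw [hω0, Real.dist_eq, sub_zero] at h2
    exact (le_abs_self _).trans h2.le
  set r0 := R0 / K1 with hr0
  have hr00 : 0 < r0 := by positivity
  obtain ⟨τ, hτ, hτM⟩ : ∃ τ : ℝ, 0 < τ ∧ τ ^ (1 - σ) * M ^ (n + 1 + 2) ≤ κ / 2 := by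
    refine ⟨(κ / 2 / M ^ (n + 1 + 2)) ^ (1 / (1 - σ)), by positivity, ?_⟩
    rw [← Real.rpow_mul (by positivity), one_div_mul_cancel (by linarith), Real.rpow_one]
    exact le_of_eq (by field_simp)
  set s := min 1 (κ / 2 / τ) with hs
  have hs0 : 0 < s := by rw [hs]; positivity
  have hs1 : s ≤ 1 := min_le_left _ _
  have hs2 : s ≤ κ / 2 / τ := min_le_right _ _
  refine ⟨r0 * s / 2, by positivity, fun a ha hsh u hu hsu => ?_⟩
  have e2 : 2 * (r0 * s / 2) = r0 * s := by ring
  rw [e2] at hsu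
  have hHm : Measurable (H2 u) := hu.H2.cont.measurable
  have hLm : Measurable (Lg a u) := (Lg_bm hδ ha hu).1
  have hP0 : 0 < P := by linarith
  set Q := 2 + 2 * (n + 1 : ℝ) ^ 2 * δ⁻¹ ^ 2 with hQ
  have hLe : ∀ q, Lg a u q ^ 2 ≤ Q * en u q := fun q => Lg_sq_le hδ ha u q
  have hQ0 : 0 ≤ Q := by positivity
  have iP : Integrable fun q => (Lg a u q ^ 2) ^ P := by
    refine ((hu.en.rpow_int hP).const_mul (Q ^ P)).mono' ((hLm.pow_const 2).pow_const P).aestronglyMeasurable (Eventually.of_forall fun q => ?_)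
    rw [Real.norm_eq_abs, abs_of_nonneg (Real.rpow_nonneg (sq_nonneg _) _), ← Real.mul_rpow hQ0 (en_nonneg _ _)]
    exact Real.rpow_le_rpow (sq_nonneg _) (hLe q) hP0.le
  have i1 : Integrable fun q => Lg a u q ^ 2 := by
    refine (hu.en.integrable.const_mul Q).mono' (hLm.pow_const 2).aestronglyMeasurable (Eventually.of_forall fun q => ?_)
    rw [Real.norm_eq_abs, abs_of_nonneg (sq_nonneg _)]
    exact hLe q
  have fin : ∀ f : X (n+1) → ℝ, Integrable f → ∫⁻ q, ENNReal.ofReal (f q) ≠ ⊤ := fun f hf => by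
    have := hf.lintegral_lt_top; exact this.ne
  have D0 : RVdata (n+1) σ M N κ c (H2 u) (fun q => Lg a u q ^ 2) := by
    refine ⟨hu.H2.cont, H2_nonneg u, hLm.pow_const 2, fun q => sq_nonneg _, fin _ (hu.H2.rpow_int hσ), fin _ i1, fun z r l hr hl h1 h2 => ?_⟩
    by_cases hrr : r ≤ r0
    · have hosc : oscA a (K1 * r) (z.1 - M * r ^ 2) z.2 ≤ c / D := by
        refine (osc_sharp hδ ha (R := R0) (by positivity) ?_ _ _).trans ((hsh R0 hR0.le).trans hωR)
        rw [hr0, le_div_iff₀ hK10] at hrr; linarith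
      obtain ⟨A, hA, β, hβm, hβ, hAβ, hβi⟩ := freeze hδ ha hr z hM1 hK1 hosc
      rw [← hD, div_mul_cancel₀ _ hD0.ne'] at hβi
      exact hV a ha z r l hr hl A hA β hβm hβ hAβ hβi u hu h1 h2
    · push Not at hrr
      refine (lintegral_mono_set inter_subset_left).trans ?_
      refine large hσ hHm (H2_nonneg u) (R := r0 * s) (by positivity) (fun q hq => H2_supp fun hh => hq (hsu hh)) hτ hl hr hM1 hκ ?_ hτM z h1
      have k1 : s ^ (n + 1 + 2) ≤ s := pow_le_of_le_one hs0.le hs1 (by omega)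
      have k2 : τ * s ≤ κ / 2 := by rw [le_div_iff₀ hτ] at hs2; linarith
      calc τ * (r0 * s) ^ (n + 1 + 2) = τ * s ^ (n + 1 + 2) * r0 ^ (n + 1 + 2) := by rw [mul_pow]; ring
        _ ≤ τ * s * r0 ^ (n + 1 + 2) := by gcongr
        _ ≤ κ / 2 * r0 ^ (n + 1 + 2) := by gcongr
        _ ≤ κ / 2 * r ^ (n + 1 + 2) := by gcongr
  have key := hRV _ _ D0 (fin _ (hu.H2.rpow_int hP))
  rw [← ofReal_integral_eq_lintegral_ofReal (hu.H2.rpow_int hP) (Eventually.of_forall fun q => Real.rpow_nonneg (H2_nonneg _ _) _),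
    ← ofReal_integral_eq_lintegral_ofReal iP (Eventually.of_forall fun q => Real.rpow_nonneg (sq_nonneg _) _), ← ENNReal.ofReal_mul hK.le] at key
  refine (ENNReal.ofReal_le_ofReal_iff (mul_nonneg hK.le (integral_nonneg fun q => Real.rpow_nonneg (sq_nonneg _) _))).1 key

end KK
end

theorem stmt15 (n : ℕ) (hn : 1 ≤ n) (δ : ℝ) (hδ : δ ∈ Set.Ioo (0 : ℝ) 1)
    (p : ℝ) (hp : 2 < p) :
    ∃ N : ℝ, 0 < N ∧
      ∀ ω : ℝ → ℝ, ContinuousOn ω (Set.Ici 0) → ω 0 = 0 →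
        ∃ R : ℝ, 0 < R ∧
          ∀ a : ℝ × (Fin (n + 1) → ℝ) → Fin (n + 1) → Fin (n + 1) → ℝ,
            (∀ j k, Measurable fun q => a q j k) →
            (∀ q j k, a q j k = a q k j) →
            (∀ (q : ℝ × (Fin (n + 1) → ℝ)) (θ : Fin (n + 1) → ℝ),
              δ * ∑ j, (θ j) ^ 2 ≤ ∑ j, ∑ k, a q j k * θ j * θ k ∧
              ∑ j, ∑ k, a q j k * θ j * θ k ≤ δ⁻¹ * ∑ j, (θ j) ^ 2) →
            (∀ R' : ℝ, 0 ≤ R' → aSharp a R' ≤ ω R') →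
            ∀ u : ℝ × (Fin (n + 1) → ℝ) → ℝ, ContDiff ℝ (⊤ : ℕ∞) u →
              Function.support u ⊆ Qcyl R (0 : ℝ × (Fin (n + 1) → ℝ)) →
              LpNorm p (fun q => Real.sqrt (∑ j, ∑ k, (pdxx j k u q) ^ 2))
                ≤ N * LpNorm p (fun q =>
                    pdt u q + ∑ j, ∑ k, a q j k * pdxx j k u q) := by
  have hp0 : 0 < p := by linarith
  obtain ⟨K, hK, h⟩ := KK.main n hδ.1 (P := p / 2) (by linarith)
  refine ⟨K ^ (1 / p), by positivity, fun ω hω hω0 => ?_⟩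
  obtain ⟨R, hR, h⟩ := h ω hω hω0
  refine ⟨R, hR, fun a ham has hae hsh u hu hsu => ?_⟩
  obtain ⟨hc, hC⟩ := KK.supp_C hR hsu
  have key := h a ⟨ham, fun q => ⟨has q, hae q⟩⟩ hsh u ⟨hu, hc⟩ hC
  have e1 : ∀ q, |Real.sqrt (∑ j, ∑ k, (pdxx j k u q) ^ 2)| ^ p = KK.H2 u q ^ (p / 2) := fun q => by
    have h0 := KK.H2_nonneg u q
    change |Real.sqrt (KK.H2 u q)| ^ p = _
    rw [abs_of_nonneg (Real.sqrt_nonneg _), Real.sqrt_eq_rpow, ← Real.rpow_mul h0]; congr 1; ring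
  have e2 : ∀ q, |pdt u q + ∑ j, ∑ k, a q j k * pdxx j k u q| ^ p = (KK.Lg a u q ^ 2) ^ (p / 2) := fun q => by
    change |KK.Lg a u q| ^ p = _
    rw [← sq_abs, ← Real.rpow_natCast, ← Real.rpow_mul (abs_nonneg _)]; congr 1; push_cast; ring
  unfold LpNorm
  simp_rw [e1, e2]
  rw [← Real.mul_rpow hK.le (MeasureTheory.integral_nonneg fun q => Real.rpow_nonneg (sq_nonneg _) _)]
  exact Real.rpow_le_rpow (MeasureTheory.integral_nonneg fun q => Real.rpow_nonneg (KK.H2_nonneg _ _) _) key (by positivity)
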